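/- arXiv:math/0301262 — 8 statements merged into one kernel-verified Lean document; each statement's English description precedes it below -/
import Mathlib

section
/- Let A be a commutative noetherian local ring and p a prime ideal of A. Then depth(A) ≤ depth(A_p) + dim(A/p). -/
open CategoryTheory

noncomputable section

/-- We equip module categories with their standard derived category structure,
so that small `Ext`-groups are available. -/
instance extHDC (R : Type) [CommRing R] : HasDerivedCategory (ModuleCat.{0} R) :=
  HasDerivedCategory.standard _

instance extHasExt (R : Type) [CommRing R] : HasExt.{1} (ModuleCat.{0} R) :=
  hasExt_of_hasDerivedCategory _

/-- The `Ext`-group `Ext^n_R(M, N)` of two `R`-modules. -/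
abbrev extGrp (R : Type) [CommRing R] (M N : Type) [AddCommGroup M] [Module R M]
    [AddCommGroup N] [Module R N] (n : ℕ) : Type 1 :=
  Abelian.Ext (ModuleCat.of R M) (ModuleCat.of R N) n

/-- The Ext-depth of a module `M` over a local ring `R`:
`E-dp M = inf {n | Ext^n_R(k, M) ≠ 0}` where `k` is the residue field (`⊤` if no such `n`). -/
def extDepth (R : Type) [CommRing R] [IsLocalRing R] (M : Type) [AddCommGroup M]
    [Module R M] : ℕ∞ :=
  sInf {n : ℕ∞ | ∃ i : ℕ, n = i ∧ Nontrivial (extGrp R (IsLocalRing.ResidueField R) M i)}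

open Abelian in
lemma aux_dim {A : Type} [CommRing A] (p q : Ideal A) [p.IsPrime] [q.IsPrime] (hpq : p ≤ q)
    (x : A) (hxp : x ∉ p) (hxq : x ∈ q) :
    ringKrullDim (A ⧸ q) + 1 ≤ ringKrullDim (A ⧸ p) := by
  refine le_trans ?_ (ringKrullDim_quotient_succ_le_of_nonZeroDivisor
    (r := Ideal.Quotient.mk p x) ?_)
  · gcongr
    refine ringKrullDim_le_of_surjective (Ideal.Quotient.lift _ (Ideal.Quotient.factor hpq) ?_)
      (Ideal.Quotient.lift_surjective_of_surjective _ _ (Ideal.Quotient.factor_surjective hpq))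
    intro a ha
    have : Ideal.span {Ideal.Quotient.mk p x} ≤ RingHom.ker (Ideal.Quotient.factor hpq) := by
      rw [Ideal.span_singleton_le_iff_mem, RingHom.mem_ker, Ideal.Quotient.factor_mk]
      exact Ideal.Quotient.eq_zero_iff_mem.mpr hxq
    exact this ha
  · rw [mem_nonZeroDivisors_iff_ne_zero]
    exact fun h => hxp (Ideal.Quotient.eq_zero_iff_mem.mp h)

open Abelian in
lemma aux_ext_iso {A : Type} [CommRing A] {N N' : Type} [AddCommGroup N] [Module A N]
    [AddCommGroup N'] [Module A N'] (e : N ≃ₗ[A] N') (M : ModuleCat.{0} A) (i : ℕ)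
    (h : Subsingleton (Ext.{0} (ModuleCat.of A N') M i)) :
    Subsingleton (Ext.{0} (ModuleCat.of A N) M i) := by
  refine subsingleton_of_forall_eq 0 fun y => ?_
  have h1 : y = (Ext.mk₀.{0} e.toModuleIso.hom).comp
      ((Ext.mk₀.{0} e.toModuleIso.inv).comp y (zero_add i)) (zero_add i) := by
    rw [Ext.mk₀_comp_mk₀_assoc, Iso.hom_inv_id, Ext.mk₀_id_comp]
  rw [h1, Subsingleton.elim ((Ext.mk₀.{0} e.toModuleIso.inv).comp y (zero_add i)) 0, Ext.comp_zero]

open Abelian in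
lemma aux_ischebeck {A : Type} [CommRing A] [IsNoetherianRing A] [IsLocalRing A]
    (M : ModuleCat.{0} A) [Module.Finite A M] (n : ℕ)
    (hM : ∀ i < n, Subsingleton
      (Ext.{0} (ModuleCat.of A (IsLocalRing.ResidueField A)) M i)) (d : ℕ) :
    ∀ (N : Type) [AddCommGroup N] [Module A N] [Module.Finite A N],
      (∀ q ∈ Module.support A N, ringKrullDim (A ⧸ q.asIdeal) ≤ d) →
      ∀ i, i + d < n → Subsingleton (Ext.{0} (ModuleCat.of A N) M i) := by
  induction d using Nat.strong_induction_on with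
  | _ d ih =>
  intro N _ _ hN
  refine IsNoetherianRing.induction_on_isQuotientEquivQuotientPrime A hN
    (motive := fun N => (∀ q ∈ Module.support A N, ringKrullDim (A ⧸ q.asIdeal) ≤ d) →
      ∀ i, i + d < n → Subsingleton (Ext.{0} (ModuleCat.of A N) M i)) ?_ ?_ ?_
  · intro N _ _ _ _ _ i _
    refine subsingleton_of_forall_eq 0 fun y => ?_
    have h0 : 𝟙 (ModuleCat.of A N) = 0 :=
      (ModuleCat.isZero_of_subsingleton (ModuleCat.of A N)).eq_of_src _ _
    rw [← Ext.mk₀_id_comp y, h0, Ext.mk₀_zero, Ext.zero_comp]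
  · intro N _ _ _ p e hsupp i hi
    have hmem : p ∈ Module.support A N := by
      rw [Module.mem_support_iff_of_finite, e.annihilator_eq, Ideal.annihilator_quotient]
    by_cases hpm : p.asIdeal = IsLocalRing.maximalIdeal A
    · exact aux_ext_iso (e.trans (Submodule.quotEquivOfEq _ _ hpm)) M i (hM i (by omega))
    · have hple := IsLocalRing.le_maximalIdeal p.2.ne_top
      obtain ⟨x, hxm, hxp⟩ := SetLike.exists_of_lt (lt_of_le_of_ne hple hpm)
      have hd := hsupp p hmem
      obtain ⟨d', rfl⟩ : ∃ d', d = d' + 1 := by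
        refine Nat.exists_eq_succ_of_ne_zero ?_
        rintro rfl
        have h1 := (aux_dim p.asIdeal _ hple x hxp hxm).trans hd
        have h2 : (0 : WithBot ℕ∞) ≤ ringKrullDim (A ⧸ IsLocalRing.maximalIdeal A) :=
          ringKrullDim_nonneg_of_nontrivial
        have h3 : (0 : WithBot ℕ∞) + 1 ≤ 0 := (by gcongr : _ ≤ _).trans h1
        exact absurd h3 (by decide)
      have hreg : IsSMulRegular N x := by
        rw [e.isSMulRegular_congr, isSMulRegular_quotient_iff_mem_of_smul_mem]
        intro y hy
        exact (p.2.mem_or_mem hy).resolve_left hxp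
      have hQ : Subsingleton (Ext.{0} (ModuleCat.of A (QuotSMulTop x N)) M (i + 1)) := by
        refine ih d' (by omega) _ ?_ (i + 1) (by omega)
        intro q hq
        rw [Module.support_quotSMulTop] at hq
        have hpq : p.asIdeal ≤ q.asIdeal := by
          have := Module.mem_support_iff_of_finite.mp hq.1
          rwa [e.annihilator_eq, Ideal.annihilator_quotient] at this
        have hxq : x ∈ q.asIdeal := by simpa using hq.2
        have h1 := (aux_dim p.asIdeal q.asIdeal hpq x hxp hxq).trans hd
        push_cast at h1
        generalize ringKrullDim (A ⧸ q.asIdeal) = D at h1 ⊢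
        induction D with
        | bot => exact bot_le
        | coe D =>
          induction D with
          | top => exact absurd h1 (by exact_mod_cast not_le.mpr (ENat.coe_lt_top (d' + 1)))
          | coe e =>
            norm_cast at h1 ⊢
            exact_mod_cast Nat.le_of_succ_le_succ h1
      have hS := IsSMulRegular.smulShortComplex_shortExact (M := ModuleCat.of A N) hreg
      have hsurj : ∀ y : Ext.{0} (ModuleCat.of A N) M i, ∃ z, x • z = y := by
        intro y
        obtain ⟨z, hz⟩ := Ext.contravariant_sequence_exact₁ hS M y (add_comm 1 i)
          (Subsingleton.elim (α := Ext.{0} (ModuleCat.of A (QuotSMulTop x N)) M (i + 1)) _ _)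
        refine ⟨z, ?_⟩
        have h4 (w : Ext.{0} (ModuleCat.of A N) M i) :
            x • w = (Ext.mk₀.{0} (x • 𝟙 (ModuleCat.of A N))).comp w (zero_add i) := by
          simp [Ext.mk₀_smul]
        exact (h4 z).trans hz
      have hbot : (⊤ : Submodule A (Ext.{0} (ModuleCat.of A N) M i)) = ⊥ := by
        refine Submodule.eq_bot_of_le_smul_of_le_jacobson_bot (IsLocalRing.maximalIdeal A) _
          Module.Finite.fg_top ?_ (IsLocalRing.jacobson_eq_maximalIdeal ⊥ bot_ne_top).ge
        intro y _
        obtain ⟨z, rfl⟩ := hsurj y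
        exact Submodule.smul_mem_smul hxm trivial
      exact (Submodule.subsingleton_iff A).mp (subsingleton_of_bot_eq_top hbot.symm)
  · intro N₁ _ _ _ N₂ _ _ _ N₃ _ _ _ f g hf hg hfg h₁ h₃ hsupp i hi
    have hs := Module.support_of_exact hfg hf hg
    have e₁ := h₁ (fun q hq => hsupp q (hs ▸ Or.inl hq)) i hi
    have e₃ := h₃ (fun q hq => hsupp q (hs ▸ Or.inr hq)) i hi
    let S : ShortComplex (ModuleCat.{0} A) := ShortComplex.mk (ModuleCat.ofHom f)
      (ModuleCat.ofHom g) (by ext y; exact hfg.apply_apply_eq_zero y)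
    have hS : S.ShortExact :=
      { exact := (ShortComplex.ShortExact.moduleCat_exact_iff_function_exact S).mpr hfg
        mono_f := (ModuleCat.mono_iff_injective _).mpr hf
        epi_g := (ModuleCat.epi_iff_surjective _).mpr hg }
    refine subsingleton_of_forall_eq 0 fun y => ?_
    obtain ⟨z, hz⟩ := Ext.contravariant_sequence_exact₂ hS M y
      (Subsingleton.elim (α := Ext.{0} (ModuleCat.of A N₁) M i) _ _)
    rw [← hz, Subsingleton.elim (α := Ext.{0} (ModuleCat.of A N₃) M i) z 0]
    exact Ext.comp_zero _ _ _ _ _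

open Abelian in
lemma aux_le_extDepth {A : Type} [CommRing A] [IsLocalRing A] (n : ℕ) :
    (n : ℕ∞) ≤ extDepth A A ↔ ∀ i < n, Subsingleton
      (Ext.{0} (ModuleCat.of A (IsLocalRing.ResidueField A)) (ModuleCat.of A A) i) := by
  have key (i : ℕ) : Subsingleton
      (Ext.{0} (ModuleCat.of A (IsLocalRing.ResidueField A)) (ModuleCat.of A A) i) ↔
      ¬ Nontrivial (extGrp A (IsLocalRing.ResidueField A) A i) := by
    rw [not_nontrivial_iff_subsingleton]
    exact Ext.chgUniv.{1, 0}.subsingleton_congr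
  simp only [key]
  unfold extDepth
  rw [le_sInf_iff]
  constructor
  · intro h i hi hn
    have := h i ⟨i, rfl, hn⟩
    norm_cast at this
    omega
  · rintro h _ ⟨i, rfl, hn⟩
    by_contra hlt
    exact h i (by exact_mod_cast not_le.mp hlt) hn

open Abelian in
lemma aux_main {A : Type} [CommRing A] [IsNoetherianRing A] [IsLocalRing A]
    (p : Ideal A) [p.IsPrime] (d : ℕ) (hd : ringKrullDim (A ⧸ p) ≤ d) (m : ℕ)
    (h : ((m + d : ℕ) : ℕ∞) ≤ extDepth A A) :
    (m : ℕ∞) ≤ extDepth (Localization.AtPrime p) (Localization.AtPrime p) := by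
  rw [aux_le_extDepth] at h ⊢
  have hext : ∀ i < m, Subsingleton (Ext.{0} (ModuleCat.of A (A ⧸ p)) (ModuleCat.of A A) i) := by
    intro i hi
    refine aux_ischebeck (ModuleCat.of A A) (m + d) h d (A ⧸ p) ?_ i (by omega)
    intro q hq
    rw [Module.mem_support_iff_of_finite, Ideal.annihilator_quotient] at hq
    exact (ringKrullDim_le_of_surjective _ (Ideal.Quotient.factor_surjective hq)).trans hd
  have hsupp : Module.support A (A ⧸ p) = PrimeSpectrum.zeroLocus p := by
    rw [Module.support_eq_zeroLocus, Ideal.annihilator_quotient]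
  obtain ⟨rs, hlen, hmem, hreg⟩ := ModuleCat.exists_isRegular_of_exists_subsingleton_ext p m
    (ModuleCat.of A A) (by simpa using (Ideal.IsPrime.ne_top ‹_›).lt_top)
    (ModuleCat.of A (A ⧸ p)) hsupp hext
  have hreg' := RingTheory.Sequence.IsWeaklyRegular.isRegular_of_isLocalization_of_mem
    (Localization.AtPrime p) p hreg.1 hmem
  have hsupp' : Module.support (Localization.AtPrime p)
      (IsLocalRing.ResidueField (Localization.AtPrime p)) ⊆
      PrimeSpectrum.zeroLocus (IsLocalRing.maximalIdeal (Localization.AtPrime p)) := by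
    erw [Module.support_eq_zeroLocus, Ideal.annihilator_quotient]
  have hres := ModuleCat.subsingleton_ext_of_exists_isRegular
    (IsLocalRing.maximalIdeal (Localization.AtPrime p))
    (ModuleCat.of _ (IsLocalRing.ResidueField (Localization.AtPrime p))) hsupp'
    (ModuleCat.of _ (Localization.AtPrime p))
    (by simpa using (Ideal.IsPrime.ne_top inferInstance).lt_top)
    (rs.map (algebraMap A (Localization.AtPrime p))) (by
      intro r hr
      obtain ⟨a, ha, rfl⟩ := List.mem_map.mp hr
      exact (IsLocalization.AtPrime.to_map_mem_maximal_iff _ p a).mpr (hmem a ha)) hreg'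
  simpa [hlen] using hres

/-- For a noetherian local ring `A` and a prime `p`,
`depth A ≤ depth A_p + dim A/p`. -/
theorem depth_le_depth_localization_add_dim_quotient
    (A : Type) [CommRing A] [IsNoetherianRing A] [IsLocalRing A]
    (p : Ideal A) [p.IsPrime] :
    (extDepth A A : WithBot ℕ∞) ≤
      (extDepth (Localization.AtPrime p) (Localization.AtPrime p) : WithBot ℕ∞) +
        (show WithBot ℕ∞ from ringKrullDim (A ⧸ p)) := by
  obtain ⟨d, hd⟩ : ∃ d : ℕ, ringKrullDim (A ⧸ p) = d := by
    have h1 : ringKrullDim (A ⧸ p) ≠ ⊤ := ((ringKrullDim_quotient_le p).trans_lt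
      (ringKrullDim_lt_top (R := A))).ne
    have h2 : ringKrullDim (A ⧸ p) ≠ ⊥ := fun h => by
      have := ringKrullDim_nonneg_of_nontrivial (R := A ⧸ p)
      simp [h] at this
    generalize ringKrullDim (A ⧸ p) = D at h1 h2
    induction D with
    | bot => simp at h2
    | coe D =>
      induction D with
      | top => simp at h1
      | coe d => exact ⟨d, rfl⟩
  have key := aux_main p d hd.le
  change _ ≤ _ + ringKrullDim (A ⧸ p)
  rw [hd]
  generalize extDepth A A = a at key
  generalize extDepth (Localization.AtPrime p) (Localization.AtPrime p) = b at key
  have hab : a ≤ b + d := by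
    refine ENat.forall_natCast_le_iff_le.mp fun n hn => ?_
    by_cases hnd : n ≤ d
    · exact (Nat.cast_le.mpr hnd).trans le_add_self
    · have := key (n - d) (by rwa [Nat.sub_add_cancel (by omega)])
      calc (n : ℕ∞) = ((n - d : ℕ) : ℕ∞) + d := by
            rw [← Nat.cast_add, Nat.sub_add_cancel (by omega)]
        _ ≤ _ := by gcongr
  exact_mod_cast hab
end
end

section
/- Let (A,m,k) be a noetherian local ring and let X = (0 → X_m → ⋯ → X_1 → X_0) be a complex of A-modules (not necessarily finitely generated) which is not exact. Suppose that for every i ≥ 1, either H_i(X) = 0 or Ext-depth of H_i(X) is 0, and that the Ext-depth of each X_i (for i ≥ 1) equals q. Then q < m. -/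
open CategoryTheory

noncomputable section

/-- The homology of a pair of composable linear maps `M → N → P` at `N`. -/
abbrev HomologyAt {A M N P : Type} [CommRing A] [AddCommGroup M] [Module A M] [AddCommGroup N]
    [Module A N] [AddCommGroup P] [Module A P] (f : M →ₗ[A] N) (g : N →ₗ[A] P) : Type :=
  ↥(LinearMap.ker g) ⧸ Submodule.comap (LinearMap.ker g).subtype (LinearMap.range f)

theorem aux_ext_vanish_of_exact {A : Type} [CommRing A] {K M N P : Type}
    [AddCommGroup K] [Module A K] [AddCommGroup M]
    [Module A M] [AddCommGroup N] [Module A N] [AddCommGroup P] [Module A P]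
    (f : M →ₗ[A] N) (g : N →ₗ[A] P) (hf : Function.Injective f) (hg : Function.Surjective g)
    (hfg : Function.Exact f g) (j : ℕ)
    (hN : Subsingleton (extGrp A K N j)) (hM : Subsingleton (extGrp A K M (j + 1))) :
    Subsingleton (extGrp A K P j) := by
  let S : ShortComplex (ModuleCat.{0} A) :=
    ShortComplex.mk (ModuleCat.ofHom f) (ModuleCat.ofHom g) (by
      rw [← ModuleCat.ofHom_comp, hfg.linearMap_comp_eq_zero]; rfl)
  have hS : S.ShortExact :=
    { exact := (ShortComplex.ShortExact.moduleCat_exact_iff_function_exact S).2 hfg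
      mono_f := (ModuleCat.mono_iff_injective _).2 hf
      epi_g := (ModuleCat.epi_iff_surjective _).2 hg }
  refine subsingleton_of_forall_eq 0 fun x => ?_
  obtain ⟨y, hy⟩ := Abelian.Ext.covariant_sequence_exact₃ (ModuleCat.of A K) hS x
    (n₁ := j + 1) rfl (hM.elim _ _)
  rw [← hy, hN.elim y 0]
  simp

theorem aux_ext_zero_of_injective {A : Type} [CommRing A] {K M N : Type}
    [AddCommGroup K] [Module A K] [AddCommGroup M]
    [Module A M] [AddCommGroup N] [Module A N]
    (f : M →ₗ[A] N) (hf : Function.Injective f)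
    (hN : Subsingleton (extGrp A K N 0)) : Subsingleton (extGrp A K M 0) := by
  have : Mono (ModuleCat.ofHom f) := (ModuleCat.mono_iff_injective _).2 hf
  exact (Abelian.Ext.postcomp_mk₀_injective_of_mono (ModuleCat.of A K)
    (ModuleCat.ofHom f)).subsingleton

theorem aux_ext_of_subsingleton {A : Type} [CommRing A] {K M : Type}
    [AddCommGroup K] [Module A K] [AddCommGroup M] [Module A M] [Subsingleton M] (j : ℕ) :
    Subsingleton (extGrp A K M j) := by
  refine subsingleton_of_forall_eq 0 fun x => ?_
  have h : (𝟙 (ModuleCat.of A M)) = 0 := by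
    ext y
    exact Subsingleton.elim _ _
  rw [← Abelian.Ext.comp_mk₀_id x, h, Abelian.Ext.mk₀_zero, Abelian.Ext.comp_zero]

theorem aux_exact_of_subsingleton {A M N P : Type} [CommRing A] [AddCommGroup M] [Module A M]
    [AddCommGroup N] [Module A N] [AddCommGroup P] [Module A P] (f : M →ₗ[A] N) (g : N →ₗ[A] P)
    (h : Subsingleton (HomologyAt f g)) (x : N) (hx : g x = 0) : x ∈ LinearMap.range f := by
  have : (⟨x, hx⟩ : LinearMap.ker g) ∈
      Submodule.comap (LinearMap.ker g).subtype (LinearMap.range f) := by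
    rw [← Submodule.Quotient.mk_eq_zero]
    exact h.elim _ _
  exact this

theorem aux_range_vanish
    (A : Type) [CommRing A] (K : Type) [AddCommGroup K] [Module A K]
    (m : ℕ) (X : ℕ → Type) [∀ i, AddCommGroup (X i)] [∀ i, Module A (X i)]
    (d : ∀ i, X (i+1) →ₗ[A] X i)
    (hcx : ∀ i, (d i).comp (d (i+1)) = 0)
    (htop : ∀ i, m < i → Subsingleton (X i))
    (hX : ∀ i, 1 ≤ i → i ≤ m → ∀ j < m, Subsingleton (extGrp A K (X i) j))
    (n : ℕ) : ∀ i, i + n = m →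
      (∀ j, i ≤ j → j + 1 ≤ m → Subsingleton (HomologyAt (d (j+1)) (d j))) →
      ∀ t ≤ i, Subsingleton (extGrp A K (LinearMap.range (d i)) t) := by
  induction n with
  | zero =>
    intro i hi _ t _
    have := htop (i + 1) (by omega)
    have : Subsingleton (LinearMap.range (d i)) :=
      (d i).surjective_rangeRestrict.subsingleton
    exact aux_ext_of_subsingleton t
  | succ n ih =>
    intro i hi hex t ht
    have h1 := ih (i + 1) (by omega) (fun j hj hj' => hex j (by omega) hj') (t + 1) (by omega)
    refine aux_ext_vanish_of_exact (LinearMap.range (d (i+1))).subtype (d i).rangeRestrict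
      Subtype.val_injective (d i).surjective_rangeRestrict ?_ t
      (hX (i + 1) (by omega) (by omega) t (by omega)) h1
    intro x
    constructor
    · intro hx
      have hx' : d i x = 0 := congrArg Subtype.val hx
      exact ⟨⟨x, aux_exact_of_subsingleton _ _ (hex i le_rfl (by omega)) x hx'⟩, rfl⟩
    · rintro ⟨⟨_, y, rfl⟩, rfl⟩
      apply Subtype.ext
      exact LinearMap.congr_fun (hcx i) y

/-- **consequence of the Acyclicity Lemma.** Let
`X = (0 → X_m → ⋯ → X_1 → X_0)` be a non-exact complex such that for `i ≥ 1` each homology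
`H_i` is zero or has Ext-depth `0`, while each `X_i` (`i ≥ 1`) has Ext-depth `q`.
Then `q < m`. (Here `d i : X_{i+1} → X_i`, the modules `X_i` for `i > m` are zero, and
`HomologyAt (d (i+1)) (d i)` is the homology `H_{i+1}`.) -/
theorem extDepth_lt_of_acyclicity
    (A : Type) [CommRing A] [IsNoetherianRing A] [IsLocalRing A]
    (m : ℕ) (X : ℕ → Type) [∀ i, AddCommGroup (X i)] [∀ i, Module A (X i)]
    (d : ∀ i, X (i+1) →ₗ[A] X i)
    (hcx : ∀ i, (d i).comp (d (i+1)) = 0)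
    (htop : ∀ i, m < i → Subsingleton (X i))
    (q : ℕ∞)
    (hne : ∃ i, i + 1 ≤ m ∧ Nontrivial (HomologyAt (d (i+1)) (d i)))
    (hH : ∀ i, i + 1 ≤ m →
      (Subsingleton (HomologyAt (d (i+1)) (d i)) ∨ extDepth A (HomologyAt (d (i+1)) (d i)) = 0))
    (hX : ∀ i, 1 ≤ i → i ≤ m → extDepth A (X i) = q) :
    q < (m : ℕ∞) := by
  by_contra hq
  rw [not_lt] at hq
  have hX' : ∀ i, 1 ≤ i → i ≤ m → ∀ j < m,
      Subsingleton (extGrp A (IsLocalRing.ResidueField A) (X i) j) := by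
    intro i h1 h2 j hj
    by_contra hs
    rw [not_subsingleton_iff_nontrivial] at hs
    have h3 : extDepth A (X i) ≤ (j : ℕ∞) := sInf_le ⟨j, rfl, hs⟩
    rw [hX i h1 h2] at h3
    have h4 : (m : ℕ∞) ≤ j := hq.trans h3
    have h5 : m ≤ j := by exact_mod_cast h4
    omega
  have key : ∀ n i, i + 1 + n = m → Subsingleton (HomologyAt (d (i+1)) (d i)) := by
    intro n
    induction n using Nat.strong_induction_on with
    | _ n ih =>
      intro i hi
      rcases hH i (by omega) with h | h
      · exact h
      exfalso
      have hB := aux_range_vanish A (IsLocalRing.ResidueField A) m X d hcx htop hX' n (i + 1) hi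
        (fun j hj hj' => ih (m - (j + 1)) (by omega) j (by omega)) 1 (by omega)
      have hZ : Subsingleton (extGrp A (IsLocalRing.ResidueField A) (LinearMap.ker (d i)) 0) :=
        aux_ext_zero_of_injective (LinearMap.ker (d i)).subtype Subtype.val_injective
          (hX' (i + 1) (by omega) (by omega) 0 (by omega))
      have hle : LinearMap.range (d (i+1)) ≤ LinearMap.ker (d i) :=
        LinearMap.range_le_ker_iff.2 (hcx i)
      have hHH : Subsingleton (extGrp A (IsLocalRing.ResidueField A)
          (HomologyAt (d (i+1)) (d i)) 0) := by
        refine aux_ext_vanish_of_exact (Submodule.inclusion hle)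
          (Submodule.mkQ (Submodule.comap (LinearMap.ker (d i)).subtype
            (LinearMap.range (d (i+1)))))
          (Submodule.inclusion_injective hle) (Submodule.mkQ_surjective _) ?_ 0 hZ hB
        intro x
        rw [Submodule.mkQ_apply, Submodule.Quotient.mk_eq_zero]
        constructor
        · intro hx
          exact ⟨⟨x.1, hx⟩, rfl⟩
        · rintro ⟨y, rfl⟩
          exact y.2
      have hne' : {n : ℕ∞ | ∃ t : ℕ, n = t ∧ Nontrivial (extGrp A (IsLocalRing.ResidueField A)
          (HomologyAt (d (i+1)) (d i)) t)}.Nonempty := by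
        by_contra hemp
        rw [Set.not_nonempty_iff_eq_empty] at hemp
        rw [extDepth, hemp, sInf_empty] at h
        exact absurd h (by simp)
      obtain ⟨t, ht, hnt⟩ := csInf_mem hne'
      have h0 : (t : ℕ∞) = 0 := ht.symm.trans h
      have h0' : t = 0 := by exact_mod_cast h0
      subst h0'
      exact not_subsingleton_iff_nontrivial.2 hnt hHH
  obtain ⟨i, hi, hnt⟩ := hne
  exact not_subsingleton_iff_nontrivial.2 hnt (key (m - (i + 1)) i (by omega))
end
end

section
/- Let (A,m) be a noetherian local ring of dimension d and let C be a balanced big Cohen-Macaulay A-module. Then the Ext-depth of C equals d, and C ≠ mC. -/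
open CategoryTheory

noncomputable section

/-- A system of parameters of a local ring: a list of `dim A` elements of the maximal ideal
generating an ideal of coheight zero. -/
def IsSOP (A : Type) [CommRing A] [IsLocalRing A] (rs : List A) : Prop :=
  (rs.length : WithBot ℕ∞) = ringKrullDim A ∧
    (∀ r ∈ rs, r ∈ IsLocalRing.maximalIdeal A) ∧
    ringKrullDim (A ⧸ Ideal.ofList rs) ≤ 0

/-- A balanced big Cohen-Macaulay module: every system of parameters of `A` is a regular
sequence on `C`. -/
def IsBalancedBigCM (A : Type) [CommRing A] [IsLocalRing A] (C : Type) [AddCommGroup C]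
    [Module A C] : Prop :=
  ∀ rs : List A, IsSOP A rs → RingTheory.Sequence.IsRegular C rs

open CategoryTheory Abelian Limits RingTheory.Sequence Pointwise in
lemma aux_vanish {A : Type} [CommRing A] (N : ModuleCat.{0} A) (rs : List A) :
    ∀ (M : ModuleCat.{0} A), (∀ r ∈ rs, r ∈ Module.annihilator A N) → IsWeaklyRegular M rs →
    ∀ i < rs.length, Subsingleton (Ext.{0} N M i) := by
  induction rs with
  | nil => intro M _ _ i hi; simp at hi
  | cons a rs ih =>
    intro M mem reg i hi
    rw [isWeaklyRegular_cons_iff] at reg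
    have ha : a ∈ Module.annihilator A N := mem a List.mem_cons_self
    match i with
    | 0 =>
      have : Subsingleton (N →ₗ[A] M) := by
        refine ⟨fun f g => LinearMap.ext fun x => ?_⟩
        apply reg.1
        change a • f x = a • g x
        rw [← map_smul, ← map_smul, Module.mem_annihilator.mp ha, map_zero, map_zero]
      exact (Ext.addEquiv₀.trans ModuleCat.homAddEquiv).subsingleton
    | i + 1 =>
      let g := (AddCommGrpCat.ofHom ((Ext.mk₀.{0} (ModuleCat.smulShortComplex M a).f).postcomp N
        (add_zero (i + 1))))
      have mono_g : Mono g := by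
        apply (Ext.covariant_sequence_exact₁'.{0} N reg.1.smulShortComplex_shortExact i (i + 1)
          rfl).mono_g ((AddCommGrpCat.isZero_of_iff_subsingleton.mpr ?_).eq_zero_of_src _)
        exact ih (ModuleCat.of A (QuotSMulTop a M)) (fun r hr => mem r (List.mem_cons_of_mem _ hr))
          reg.2 i (by simpa using hi)
      have zero_g : g = 0 := Ext.postcomp_smul_id_eq_zero_of_mem_annihilator ha (i + 1)
      exact AddCommGrpCat.subsingleton_of_isZero (IsZero.of_mono_eq_zero _ zero_g)

open CategoryTheory Abelian Limits RingTheory.Sequence Pointwise in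
lemma aux_nontrivial {A : Type} [CommRing A] (N : ModuleCat.{0} A) (rs : List A) :
    ∀ (M : ModuleCat.{0} A), (∀ r ∈ rs, r ∈ Module.annihilator A N) → IsWeaklyRegular M rs →
    Nontrivial (N →ₗ[A] (M ⧸ (Ideal.ofList rs • ⊤ : Submodule A M))) →
    Nontrivial (Ext.{0} N M rs.length) := by
  induction rs with
  | nil =>
    intro M _ _ h
    have e : (M ⧸ (Ideal.ofList ([] : List A) • ⊤ : Submodule A M)) ≃ₗ[A] M :=
      Submodule.quotEquivOfEqBot _ (by simp)
    have : Nontrivial (N →ₗ[A] M) := (e.congrRight (M := N)).symm.toEquiv.nontrivial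
    exact (Ext.addEquiv₀.trans ModuleCat.homAddEquiv).toEquiv.nontrivial
  | cons a rs ih =>
    intro M mem reg h
    have van := aux_vanish N (a :: rs) M mem reg rs.length (by simp)
    rw [isWeaklyRegular_cons_iff] at reg
    have e := Submodule.quotOfListConsSMulTopEquivQuotSMulTopInner M a rs
    have h' : Nontrivial (N →ₗ[A] (QuotSMulTop a M ⧸
        (Ideal.ofList rs • ⊤ : Submodule A (QuotSMulTop a M)))) :=
      (e.congrRight (M := N)).symm.toEquiv.nontrivial
    have ih' := ih (ModuleCat.of A (QuotSMulTop a M))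
      (fun r hr => mem r (List.mem_cons_of_mem _ hr)) reg.2 h'
    have mono_d := (Ext.covariant_sequence_exact₃'.{0} N reg.1.smulShortComplex_shortExact
      rs.length (rs.length + 1) rfl).mono_g
      ((AddCommGrpCat.isZero_of_iff_subsingleton.mpr van).eq_zero_of_src _)
    rw [AddCommGrpCat.mono_iff_injective] at mono_d
    exact @Function.Injective.nontrivial _ _ ih' _ mono_d

lemma aux_socle {A : Type} [CommRing A] (I : Ideal A) (D : Type) [AddCommGroup D] [Module A D]
    [Nontrivial D] (k : ℕ) (hk : I ^ k • (⊤ : Submodule A D) = ⊥) :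
    Nontrivial ((A ⧸ I) →ₗ[A] D) := by
  classical
  have hex : ∃ k, I ^ k • (⊤ : Submodule A D) = ⊥ := ⟨k, hk⟩
  obtain ⟨n, hn⟩ : ∃ n, Nat.find hex = n + 1 := by
    refine Nat.exists_eq_succ_of_ne_zero fun h0 => ?_
    have := Nat.find_spec hex
    rw [h0] at this
    simp at this
  have h1 := Nat.find_spec hex
  rw [hn] at h1
  have h2 : I ^ n • (⊤ : Submodule A D) ≠ ⊥ := Nat.find_min hex (by omega)
  obtain ⟨x, hx, hx0⟩ := Submodule.exists_mem_ne_zero_of_ne_bot h2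
  have hI : ∀ a ∈ I, a • x = 0 := by
    intro a ha
    have : a • x ∈ I • (I ^ n • (⊤ : Submodule A D)) := Submodule.smul_mem_smul ha hx
    rwa [← mul_smul, ← pow_succ', h1, Submodule.mem_bot] at this
  let f : (A ⧸ I) →ₗ[A] D := Submodule.liftQ I (LinearMap.toSpanSingleton A D x)
    (fun a ha => by simpa using hI a ha)
  refine ⟨f, 0, fun hf => hx0 ?_⟩
  have : f (Submodule.Quotient.mk 1) = 0 := by rw [hf]; rfl
  have h2 : f (Submodule.Quotient.mk 1) = (1 : A) • x := rfl
  rw [h2, one_smul] at this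
  exact this

/-- A balanced big Cohen-Macaulay module `C` over a `d`-dimensional
noetherian local ring has Ext-depth `d`, and `C ≠ mC`. -/
theorem extDepth_eq_dim_of_balancedBigCM
    (A : Type) [CommRing A] [IsNoetherianRing A] [IsLocalRing A]
    (C : Type) [AddCommGroup C] [Module A C]
    (hC : IsBalancedBigCM A C) :
    (extDepth A C : WithBot ℕ∞) = ringKrullDim A ∧
      (IsLocalRing.maximalIdeal A) • (⊤ : Submodule A C) ≠ ⊤ := by
  obtain ⟨s, hs, hcard⟩ :=
    (IsLocalRing.maximalIdeal A).exists_finset_card_eq_height_of_isNoetherianRing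
  have hof : Ideal.ofList s.toList = Ideal.span (s : Set A) := by
    simp [Ideal.ofList]
  have hdim : ((s.card : ℕ∞) : WithBot ℕ∞) = ringKrullDim A := by
    rw [hcard, IsLocalRing.maximalIdeal_height_eq_ringKrullDim]
  have hmem : ∀ r ∈ s.toList, r ∈ IsLocalRing.maximalIdeal A := fun r hr =>
    hs.1.2 (Ideal.subset_span (by simpa using hr))
  have hsop : IsSOP A s.toList := by
    refine ⟨by rw [Finset.length_toList]; exact hdim, hmem, ?_⟩
    rw [hof]
    have := IsLocalRing.quotient_artinian_of_mem_minimalPrimes_of_isLocalRing _ hs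
    have : Ring.KrullDimLE 0 (A ⧸ Ideal.span (s : Set A)) := inferInstance
    exact Ring.krullDimLE_iff.mp this
  have hreg := hC _ hsop
  have hrad : IsLocalRing.maximalIdeal A ≤ (Ideal.ofList s.toList).radical := by
    rw [hof, Ideal.radical_eq_sInf]
    refine le_sInf fun p hp => ?_
    have := hp.2
    exact hs.2 ⟨hp.2, hp.1⟩ (IsLocalRing.le_maximalIdeal hp.2.ne_top)
  obtain ⟨k, hk⟩ := Ideal.exists_pow_le_of_le_radical_of_fg hrad (IsNoetherian.noetherian _)
  constructor
  · set I := Ideal.ofList s.toList with hI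
    have hle : IsLocalRing.maximalIdeal A ≤
        Module.annihilator A (ModuleCat.of A (IsLocalRing.ResidueField A)) :=
      (Ideal.annihilator_quotient (I := IsLocalRing.maximalIdeal A)).ge
    have hann := fun r hr => hle (hmem r hr)
    have hnt : Nontrivial (C ⧸ (I • ⊤ : Submodule A C)) :=
      Submodule.Quotient.nontrivial_iff.mpr hreg.top_ne_smul.symm
    have hbot : IsLocalRing.maximalIdeal A ^ k •
        (⊤ : Submodule A (C ⧸ (I • ⊤ : Submodule A C))) = ⊥ := by
      rw [eq_bot_iff, Submodule.smul_le]
      rintro a ha x -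
      obtain ⟨x, rfl⟩ := Submodule.Quotient.mk_surjective _ x
      rw [← Submodule.Quotient.mk_smul, Submodule.mem_bot, Submodule.Quotient.mk_eq_zero]
      exact Submodule.smul_mem_smul (hk ha) trivial
    have hsoc := aux_socle _ _ k hbot
    have h1 := aux_vanish (ModuleCat.of A (IsLocalRing.ResidueField A)) s.toList
      (ModuleCat.of A C) hann hreg.toIsWeaklyRegular
    have h2 := aux_nontrivial (ModuleCat.of A (IsLocalRing.ResidueField A)) s.toList
      (ModuleCat.of A C) hann hreg.toIsWeaklyRegular hsoc
    rw [Finset.length_toList] at h1 h2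
    rw [← hdim]
    congr 1
    refine IsLeast.csInf_eq ⟨⟨s.card, rfl, ?_⟩, ?_⟩
    · exact (Abelian.Ext.chgUniv.{0, 1} (X := ModuleCat.of A (IsLocalRing.ResidueField A))
        (Y := ModuleCat.of A C) (n := s.card)).nontrivial
    · rintro _ ⟨i, rfl, hi⟩
      by_contra hlt
      have := h1 i (by simpa using hlt)
      have : Nontrivial (Abelian.Ext.{0} (ModuleCat.of A (IsLocalRing.ResidueField A))
        (ModuleCat.of A C) i) := 
          (Abelian.Ext.chgUniv.{1, 0} (X := ModuleCat.of A (IsLocalRing.ResidueField A))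
            (Y := ModuleCat.of A C) (n := i)).nontrivial
      exact not_subsingleton _ ‹_›
  · intro h
    apply hreg.top_ne_smul
    have : ∀ n, IsLocalRing.maximalIdeal A ^ n • (⊤ : Submodule A C) = ⊤ := by
      intro n
      induction n with
      | zero => simp
      | succ n ih => rw [pow_succ, mul_smul, h, ih]
    exact le_antisymm ((this k).ge.trans (Submodule.smul_mono_left hk)) le_top
end
end

section
/- Let C be a balanced big Cohen-Macaulay module over a noetherian local ring A, and let p be a prime in the small support of C (i.e., the Ext-depth of C_p over A_p is finite). Then Ext-depth_{A_p}(C_p) = ht p = dim A_p, ht p + dim A/p = dim A, and pC_p ≠ C_p. -/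
open CategoryTheory

noncomputable section

open Abelian in
lemma ext_smul_zero {R : Type} [CommRing R] {X Y : ModuleCat.{0} R} {n : ℕ} (r : R)
    (hr : r • 𝟙 X = 0) (x : Ext X Y n) : r • x = 0 := by
  rw [← Ext.mk₀_id_comp x, ← Ext.smul_comp, ← Ext.mk₀_smul, hr, Ext.mk₀_zero, Ext.zero_comp]

lemma residue_smul_id {R : Type} [CommRing R] [IsLocalRing R] (r : R)
    (hr : r ∈ IsLocalRing.maximalIdeal R) :
    r • 𝟙 (ModuleCat.of R (IsLocalRing.ResidueField R)) = 0 := by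
  ext x
  change r • (show IsLocalRing.ResidueField R from x) = 0
  rw [Algebra.smul_def]
  have : algebraMap R (IsLocalRing.ResidueField R) r = 0 := Ideal.Quotient.eq_zero_iff_mem.mpr hr
  rw [this, zero_mul]

open Abelian in
lemma ext_mid {R : Type} [CommRing R] {X M : ModuleCat.{0} R} (n : ℕ) (r : R)
    (hr : r • 𝟙 X = 0) (reg : IsSMulRegular M r) [h : Nontrivial (Ext X M n)] :
    Nontrivial (Ext X (ModuleCat.of R (QuotSMulTop r M)) n) := by
  obtain ⟨x, hx⟩ := exists_ne (0 : Ext X M n)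
  refine ⟨x.comp (Ext.mk₀ (M.smulShortComplex r).g) (add_zero n), 0, fun h0 => hx ?_⟩
  obtain ⟨y, hy⟩ := Ext.covariant_sequence_exact₂ X reg.smulShortComplex_shortExact x h0
  rw [← hy]
  exact (Ext.smul_eq_comp_mk₀ y r).symm.trans (ext_smul_zero r hr y)

open Abelian in
lemma ext_up {R : Type} [CommRing R] {X M : ModuleCat.{0} R} (n : ℕ) (r : R)
    (hr : r • 𝟙 X = 0) (reg : IsSMulRegular M r) :
    Nontrivial (Ext X M (n + 1)) → Nontrivial (Ext X (ModuleCat.of R (QuotSMulTop r M)) n) := by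
  intro h
  obtain ⟨x, hx⟩ := exists_ne (0 : Ext X M (n+1))
  obtain ⟨y, hy⟩ := Ext.covariant_sequence_exact₁ X reg.smulShortComplex_shortExact x
    ((Ext.smul_eq_comp_mk₀ x r).symm.trans (ext_smul_zero r hr x)) rfl
  refine ⟨y, 0, fun h0 => hx ?_⟩
  rw [← hy, h0]
  apply Ext.zero_comp

open Abelian in
lemma ext_zero {R : Type} [CommRing R] {X M : ModuleCat.{0} R} (r : R)
    (hr : r • 𝟙 X = 0) (reg : IsSMulRegular M r) :
    ¬ Nontrivial (Ext X M 0) := by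
  intro h
  obtain ⟨x, hx⟩ := exists_ne (0 : Ext X M 0)
  have := reg.smulShortComplex_shortExact.mono_f
  refine hx (Ext.postcomp_mk₀_injective_of_mono X (M.smulShortComplex r).f ?_)
  refine Eq.trans ?_ (map_zero _).symm
  exact ((Ext.smul_eq_comp_mk₀ x r).symm.trans (ext_smul_zero r hr x))

open Abelian in
lemma ext_down {R : Type} [CommRing R] {X M : ModuleCat.{0} R} (n : ℕ) (r : R)
    (reg : IsSMulRegular M r) (h0 : ¬ Nontrivial (Ext X M n)) :
    Nontrivial (Ext X (ModuleCat.of R (QuotSMulTop r M)) n) → Nontrivial (Ext X M (n + 1)) := by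
  intro h
  obtain ⟨x, hx⟩ := exists_ne (0 : Ext X (ModuleCat.of R (QuotSMulTop r M)) n)
  refine ⟨Ext.comp x reg.smulShortComplex_shortExact.extClass rfl, 0, fun h1 => hx ?_⟩
  obtain ⟨y, hy⟩ := Ext.covariant_sequence_exact₃ X reg.smulShortComplex_shortExact x rfl h1
  rw [not_nontrivial_iff_subsingleton] at h0
  rw [← hy]
  have : y = 0 := h0.elim _ _
  rw [this]
  apply Ext.zero_comp

open Pointwise in
lemma main_ext {R : Type} [CommRing R] [IsLocalRing R] (xs : List R)
    (hxs : ∀ x ∈ xs, x ∈ IsLocalRing.maximalIdeal R) (K : ℕ) :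
    ∀ (M : Type) [AddCommGroup M] [Module R M],
    RingTheory.Sequence.IsWeaklyRegular M xs →
    (IsLocalRing.maximalIdeal R ^ K) • (⊤ : Submodule R M) ≤ Ideal.ofList xs • ⊤ →
    (∃ n, Nontrivial (extGrp R (IsLocalRing.ResidueField R) M n)) →
    (∀ i < xs.length, ¬ Nontrivial (extGrp R (IsLocalRing.ResidueField R) M i)) ∧
    Nontrivial (extGrp R (IsLocalRing.ResidueField R) M xs.length) ∧
    IsLocalRing.maximalIdeal R • (⊤ : Submodule R M) ≠ ⊤ := by
  induction xs with
  | nil =>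
    intro M _ _ _ hK ⟨n, hn⟩
    have hM : Nontrivial M := by
      by_contra h
      rw [not_nontrivial_iff_subsingleton] at h
      have hz : Limits.IsZero (ModuleCat.of R M) := ModuleCat.isZero_of_subsingleton _
      obtain ⟨x, hx⟩ := exists_ne (0 : extGrp R (IsLocalRing.ResidueField R) M n)
      refine hx ?_
      have := Abelian.Ext.comp_mk₀_id x
      rw [hz.eq_of_src (𝟙 (ModuleCat.of R M)) 0, Abelian.Ext.mk₀_zero, Abelian.Ext.comp_zero] at this
      exact this.symm
    simp only [Ideal.ofList_nil, Submodule.bot_smul, le_bot_iff] at hK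
    have htop : IsLocalRing.maximalIdeal R • (⊤ : Submodule R M) ≠ ⊤ := by
      intro h
      have : ∀ k, (IsLocalRing.maximalIdeal R ^ k) • (⊤ : Submodule R M) = ⊤ := by
        intro k
        induction k with
        | zero => simp
        | succ k ih => rw [pow_succ, Submodule.mul_smul, h, ih]
      exact bot_ne_top (hK.symm.trans (this K))
    refine ⟨by simp, ?_, htop⟩
    -- minimal k with m^k M = 0
    have hex : ∃ k, (IsLocalRing.maximalIdeal R ^ k) • (⊤ : Submodule R M) = ⊥ := ⟨K, hK⟩
    classical
    have hk := Nat.find_spec hex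
    have hmin := fun m => Nat.find_min hex (m := m)
    revert hk hmin
    generalize Nat.find hex = k
    intro hk hmin
    cases k with
    | zero => simp at hk
    | succ k =>
      have h1 := hmin k (Nat.lt_succ_self k)
      obtain ⟨m, hm, hm0⟩ := (Submodule.ne_bot_iff _).mp h1
      have hkill : ∀ r ∈ IsLocalRing.maximalIdeal R, r • m = 0 := by
        intro r hr
        have : r • m ∈ (IsLocalRing.maximalIdeal R ^ (k+1)) • (⊤ : Submodule R M) := by
          rw [pow_succ', Submodule.mul_smul]
          exact Submodule.smul_mem_smul hr hm
        rw [hk] at this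
        simpa using this
      let f : IsLocalRing.ResidueField R →ₗ[R] M :=
        Submodule.liftQ (IsLocalRing.maximalIdeal R) (LinearMap.toSpanSingleton R M m)
          (fun r hr => by simpa using hkill r hr)
      refine ⟨Abelian.Ext.mk₀ (ModuleCat.ofHom f), 0, fun h0 => hm0 ?_⟩
      rw [Abelian.Ext.mk₀_eq_zero_iff] at h0
      have h2 : f (Submodule.Quotient.mk (1 : R)) = 0 := by
        have := congrArg (fun g => g.hom (Submodule.Quotient.mk (1 : R))) h0
        exact this
      have h3 : f (Submodule.Quotient.mk (1 : R)) = (1 : R) • m := rfl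
      rw [h3, one_smul] at h2
      exact h2
  | cons x xs ih =>
    intro M _ _ hreg hK ⟨n, hn⟩
    rw [RingTheory.Sequence.isWeaklyRegular_cons_iff] at hreg
    obtain ⟨hx, hreg⟩ := hreg
    have hxm : x • 𝟙 (ModuleCat.of R (IsLocalRing.ResidueField R)) = 0 :=
      residue_smul_id x (hxs x (by simp))
    have hmap : ∀ I : Ideal R, Submodule.map (x • (⊤ : Submodule R M)).mkQ (I • ⊤) = I • ⊤ := by
      intro I
      rw [Submodule.map_smul'', Submodule.map_top, Submodule.range_mkQ]
    obtain ⟨h1, h2, h3⟩ := ih (fun y hy => hxs y (by simp [hy])) (QuotSMulTop x M) hreg (by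
      have := Submodule.map_mono (f := (x • (⊤ : Submodule R M)).mkQ) hK
      rw [hmap, hmap, Ideal.ofList_cons, Submodule.sup_smul] at this
      refine this.trans (sup_le ?_ le_rfl)
      rw [← hmap, Submodule.map_le_iff_le_comap]
      rw [Submodule.ideal_span_singleton_smul]
      refine le_trans ?_ (Submodule.comap_mono bot_le)
      change _ ≤ LinearMap.ker _
      rw [Submodule.ker_mkQ])
      ⟨n, ext_mid (M := ModuleCat.of R M) n x hxm hx⟩
    have h4 : ∀ i < (x :: xs).length, ¬ Nontrivial (extGrp R (IsLocalRing.ResidueField R) M i) := by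
      intro i hi
      cases i with
      | zero => exact ext_zero (M := ModuleCat.of R M) x hxm hx
      | succ i => exact fun h => h1 i (by simpa using hi)
                    (ext_up (M := ModuleCat.of R M) i x hxm hx h)
    refine ⟨h4, ext_down (M := ModuleCat.of R M) xs.length x hx (h4 _ (by simp)) h2, fun h => h3 ?_⟩
    rw [← hmap, h, Submodule.map_top, Submodule.range_mkQ]

lemma step_prime {A : Type} [CommRing A] [IsNoetherianRing A] (p : PrimeSpectrum A) (I : Ideal A) :
    ∃ x ∈ p.asIdeal, ∀ q : PrimeSpectrum A, I ≤ q.asIdeal → x ∈ q.asIdeal →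
      ∃ q' : PrimeSpectrum A, q' ≤ q ∧ I ≤ q'.asIdeal ∧ (p ≤ q' ∨ q' < q) := by
  have hfin : {J ∈ I.minimalPrimes | ¬ p.asIdeal ≤ J}.Finite :=
    (I.finite_minimalPrimes_of_isNoetherianRing A).subset (fun _ h => h.1)
  have := (Ideal.subset_union_prime_finite hfin (f := id) ⊥ ⊥ (I := p.asIdeal)
    (fun J hJ _ _ => hJ.1.1.1)).not.mpr (by
      rintro ⟨J, hJ, h⟩
      exact hJ.2 h)
  obtain ⟨x, hxp, hx⟩ := Set.not_subset.mp this
  refine ⟨x, hxp, fun q hIq hxq => ?_⟩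
  obtain ⟨J, hJ, hJq⟩ := Ideal.exists_minimalPrimes_le hIq
  refine ⟨⟨J, hJ.1.1⟩, hJq, hJ.1.2, ?_⟩
  by_cases hpJ : p.asIdeal ≤ J
  · exact Or.inl hpJ
  · refine Or.inr (lt_of_le_of_ne hJq ?_)
    rintro rfl
    exact hx (Set.mem_biUnion (x := J) ⟨hJ, hpJ⟩ hxq)

lemma extend_list {A : Type} [CommRing A] [IsNoetherianRing A] (d : ℕ∞) (p : PrimeSpectrum A)
    (xs : List A) (hd : Order.coheight p + (xs.length + 1) ≤ d)
    (h : ∀ q : PrimeSpectrum A, Ideal.ofList xs ≤ q.asIdeal →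
      Order.coheight q + xs.length ≤ d) :
    ∃ x ∈ p.asIdeal, (∀ q : PrimeSpectrum A, Ideal.ofList (xs ++ [x]) ≤ q.asIdeal →
      Order.coheight q + (xs ++ [x]).length ≤ d) ∧
      (∀ k : ℕ∞, k + 1 ≤ Order.height p →
        (∀ q : PrimeSpectrum A, Ideal.ofList xs ≤ q.asIdeal → q ≤ p → k ≤ Order.height q) →
        ∀ q : PrimeSpectrum A, Ideal.ofList (xs ++ [x]) ≤ q.asIdeal → q ≤ p →
          k + 1 ≤ Order.height q) := by
  obtain ⟨x, hx, H⟩ := step_prime p (Ideal.ofList xs)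
  have key : ∀ q : PrimeSpectrum A, Ideal.ofList (xs ++ [x]) ≤ q.asIdeal →
      Ideal.ofList xs ≤ q.asIdeal ∧ x ∈ q.asIdeal := by
    intro q hq
    rw [Ideal.ofList_append, sup_le_iff, Ideal.ofList_singleton,
      Ideal.span_singleton_le_iff_mem] at hq
    exact hq
  refine ⟨x, hx, fun q hq => ?_, fun k hk hh q hq hqp => ?_⟩
  · obtain ⟨q', hq'q, hI, h1⟩ := H q (key q hq).1 (key q hq).2
    simp only [List.length_append, List.length_singleton, Nat.cast_add, Nat.cast_one]
    rcases h1 with h1 | h1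
    · exact le_trans (by gcongr; exact h1.trans hq'q) hd
    · refine le_trans ?_ (h q' hI)
      rw [add_comm (xs.length : ℕ∞), ← add_assoc]
      gcongr
      exact Order.coheight_add_one_le h1
  · obtain ⟨q', hq'q, hI, h1⟩ := H q (key q hq).1 (key q hq).2
    rcases h1 with h1 | h1
    · exact hk.trans (Order.height_mono (h1.trans hq'q))
    · refine le_trans ?_ (Order.height_add_one_le h1)
      gcongr
      exact hh q' hI (hq'q.trans hqp)

lemma build_list {A : Type} [CommRing A] [IsNoetherianRing A] (d : ℕ∞) (p : PrimeSpectrum A)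
    (hd : Order.height p + Order.coheight p ≤ d) (hd' : ∀ q : PrimeSpectrum A, Order.coheight q ≤ d)
    (i : ℕ) : (i : ℕ∞) ≤ Order.height p → ∃ xs : List A, xs.length = i ∧
      (∀ x ∈ xs, x ∈ p.asIdeal) ∧
      (∀ q : PrimeSpectrum A, Ideal.ofList xs ≤ q.asIdeal → Order.coheight q + xs.length ≤ d) ∧
      (∀ q : PrimeSpectrum A, Ideal.ofList xs ≤ q.asIdeal → q ≤ p → (i : ℕ∞) ≤ Order.height q) := by
  induction i with
  | zero => exact fun _ => ⟨[], rfl, by simp, by simpa using hd', by simp⟩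
  | succ i ih =>
    intro hi
    push_cast at hi
    obtain ⟨xs, hl, hp, h1, h2⟩ := ih (le_trans le_self_add hi)
    obtain ⟨x, hx, h3, h4⟩ := extend_list d p xs (by
      rw [hl, add_comm]
      exact le_trans (by gcongr) hd) h1
    refine ⟨xs ++ [x], by simp [hl], ?_, h3, ?_⟩
    · intro y hy
      rcases List.mem_append.mp hy with hy | hy
      · exact hp y hy
      · rw [List.mem_singleton.mp hy]; exact hx
    · push_cast
      exact h4 i hi h2

lemma to_sop {A : Type} [CommRing A] [IsNoetherianRing A] [IsLocalRing A] (d : ℕ)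
    (hd : ringKrullDim A = d) (n : ℕ) : ∀ (xs : List A), xs.length + n = d →
    (∀ x ∈ xs, x ∈ IsLocalRing.maximalIdeal A) →
    (∀ q : PrimeSpectrum A, Ideal.ofList xs ≤ q.asIdeal →
      Order.coheight q + xs.length ≤ (d : ℕ∞)) →
    ∃ ys, IsSOP A (xs ++ ys) := by
  induction n with
  | zero =>
    intro xs hl hm h
    refine ⟨[], ?_⟩
    rw [List.append_nil]
    refine ⟨by rw [hd, ← hl]; rfl, hm, ?_⟩
    rw [ringKrullDim_quotient]
    rw [Order.krullDim_nonpos_iff_forall_isMax]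
    intro q r hqr
    have h1 := h q.1 q.2
    have h2 : Order.coheight q.1 = 0 := by
      rw [← hl] at h1
      simp only [add_zero] at h1
      have : Order.coheight q.1 + xs.length ≤ 0 + (xs.length : ℕ∞) := by simpa using h1
      simpa using (ENat.add_le_add_iff_right (ENat.natCast_ne_top _)).mp this
    exact Order.coheight_eq_zero.mp h2 hqr
  | succ n ih =>
    intro xs hl hm h
    obtain ⟨x, hx, h3, -⟩ := extend_list d (IsLocalRing.closedPoint A) xs (by
      have : Order.coheight (IsLocalRing.closedPoint A) = 0 :=
        Order.coheight_eq_zero.mpr (fun q _ => IsLocalRing.le_maximalIdeal q.2.ne_top)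
      rw [this, zero_add]
      norm_cast
      omega) h
    obtain ⟨ys, hys⟩ := ih (xs ++ [x]) (by simp; omega) (by
      intro y hy
      rcases List.mem_append.mp hy with hy | hy
      · exact hm y hy
      · rw [List.mem_singleton.mp hy]; exact hx) h3
    exact ⟨[x] ++ ys, by simpa using hys⟩

lemma max_pow_le {A : Type} [CommRing A] [IsNoetherianRing A]
    (p : Ideal A) [hp : p.IsPrime] (h : ℕ)
    (hh : Order.height (⟨p, hp⟩ : PrimeSpectrum A) = h) (xs : List A)
    (hx : ∀ q : PrimeSpectrum A, Ideal.ofList xs ≤ q.asIdeal → q ≤ ⟨p, hp⟩ →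
      (h : ℕ∞) ≤ Order.height q) :
    ∃ K, IsLocalRing.maximalIdeal (Localization.AtPrime p) ^ K ≤
      Ideal.ofList (xs.map (algebraMap A (Localization.AtPrime p))) := by
  apply Ideal.exists_pow_le_of_le_radical_of_fg _ (IsNoetherian.noetherian _)
  rw [Ideal.radical_eq_sInf]
  refine le_sInf ?_
  rintro Q ⟨hQ, hQp⟩
  rw [← Ideal.map_ofList, Ideal.map_le_iff_le_comap] at hQ
  have hle : Q.comap (algebraMap A (Localization.AtPrime p)) ≤ p := by
    exact (Ideal.comap_mono (IsLocalRing.le_maximalIdeal hQp.ne_top)).trans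
      (le_of_eq (Localization.AtPrime.under_maximalIdeal (I := p)))
  let q : PrimeSpectrum A := ⟨Q.comap (algebraMap A (Localization.AtPrime p)), hQp.comap _⟩
  have h1 := hx q hQ hle
  rw [← Localization.AtPrime.map_eq_maximalIdeal, Ideal.map_le_iff_le_comap]
  by_contra hne
  have hlt : q < ⟨p, hp⟩ := lt_of_le_not_ge hle hne
  have h2 := Order.height_add_one_le hlt
  rw [hh] at h2
  have h3 : (h : ℕ∞) + 1 ≤ h := le_trans (by gcongr) h2
  norm_cast at h3
  omega

lemma coheight_eq_dim {A : Type} [CommRing A] (p : Ideal A) [hp : p.IsPrime] :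
    ringKrullDim (A ⧸ p) = Order.coheight (⟨p, hp⟩ : PrimeSpectrum A) := by
  rw [ringKrullDim_quotient, Order.coheight_eq_krullDim_Ici]
  rfl

/-- If `C` is a balanced big Cohen-Macaulay module over `A` and `p` is in
the small support of `C`, then `E-dp_{A_p} C_p = ht p = dim A_p`, `ht p + dim A/p = dim A`,
and `p C_p ≠ C_p`. -/
theorem balancedBigCM_smallSupport
    (A : Type) [CommRing A] [IsNoetherianRing A] [IsLocalRing A]
    (C : Type) [AddCommGroup C] [Module A C]
    (hC : IsBalancedBigCM A C)
    (p : Ideal A) [hp : p.IsPrime]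
    (hsupp : extDepth (Localization.AtPrime p) (LocalizedModule p.primeCompl C) ≠ ⊤) :
    extDepth (Localization.AtPrime p) (LocalizedModule p.primeCompl C) =
        Order.height (⟨p, hp⟩ : PrimeSpectrum A) ∧
      ((Order.height (⟨p, hp⟩ : PrimeSpectrum A) : WithBot ℕ∞) =
        ringKrullDim (Localization.AtPrime p)) ∧
      ((Order.height (⟨p, hp⟩ : PrimeSpectrum A) : WithBot ℕ∞) +
        (show WithBot ℕ∞ from ringKrullDim (A ⧸ p)) = ringKrullDim A) ∧
      (Ideal.map (algebraMap A (Localization.AtPrime p)) p) •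
          (⊤ : Submodule (Localization.AtPrime p) (LocalizedModule p.primeCompl C)) ≠ ⊤ := by
  obtain ⟨d, hd⟩ : ∃ d : ℕ, ringKrullDim A = d := by
    have h1 : ringKrullDim A ≠ ⊤ := ringKrullDim_ne_top
    have h2 : ringKrullDim A ≠ ⊥ := ringKrullDim_ne_bot
    generalize ringKrullDim A = a at h1 h2
    induction a with
    | bot => exact absurd rfl h2
    | coe a =>
      induction a with
      | top => exact absurd rfl h1
      | coe n => exact ⟨n, rfl⟩
  set P : PrimeSpectrum A := ⟨p, hp⟩ with hP
  have hsum : Order.height P + Order.coheight P ≤ (d : ℕ∞) := by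
    have h1 : Order.krullDim (PrimeSpectrum A) = ((d : ℕ∞) : WithBot ℕ∞) := hd
    rw [Order.krullDim_eq_iSup_height_add_coheight_of_nonempty, WithBot.coe_inj] at h1
    rw [← h1]
    exact le_iSup (fun a : PrimeSpectrum A => Order.height a + Order.coheight a) P
  have hcoh : ∀ q : PrimeSpectrum A, Order.coheight q ≤ (d : ℕ∞) := by
    intro q
    have h1 : Order.krullDim (PrimeSpectrum A) = ((d : ℕ∞) : WithBot ℕ∞) := hd
    have h2 := Order.coheight_le_krullDim q
    rw [h1] at h2
    exact WithBot.coe_le_coe.mp h2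
  obtain ⟨h, hh⟩ : ∃ h : ℕ, Order.height P = h := by
    have : Order.height P ≠ ⊤ := ne_top_of_le_ne_top (ENat.natCast_ne_top d) (le_self_add.trans hsum)
    exact ⟨_, (ENat.natCast_toNat this).symm⟩
  obtain ⟨xs, hl, hxp, hx1, hx2⟩ := build_list (d : ℕ∞) P hsum hcoh h hh.ge
  have hpm : p ≤ IsLocalRing.maximalIdeal A := IsLocalRing.le_maximalIdeal hp.ne_top
  have hwr : ∀ zs : List A, (∀ x ∈ zs, x ∈ p) →
      (∀ q : PrimeSpectrum A, Ideal.ofList zs ≤ q.asIdeal → Order.coheight q + zs.length ≤ (d : ℕ∞)) →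
      RingTheory.Sequence.IsWeaklyRegular (LocalizedModule p.primeCompl C)
        (zs.map (algebraMap A (Localization.AtPrime p))) := by
    intro zs hz hz1
    have hlen : zs.length ≤ d := by
      have h1 := hz1 P (Ideal.span_le.mpr hz)
      exact_mod_cast le_trans le_add_self h1
    obtain ⟨ys, hys⟩ := to_sop d hd (d - zs.length) zs (by omega) (fun x hx => hpm (hz x hx)) hz1
    have h1 := (hC _ hys).toIsWeaklyRegular
    rw [RingTheory.Sequence.isWeaklyRegular_append_iff] at h1
    exact h1.1.of_isLocalizedModule (Localization.AtPrime p) p.primeCompl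
      (LocalizedModule.mkLinearMap p.primeCompl C)
  obtain ⟨K, hK⟩ := max_pow_le p h hh xs hx2
  have hex : ∃ n, Nontrivial (extGrp (Localization.AtPrime p)
      (IsLocalRing.ResidueField (Localization.AtPrime p)) (LocalizedModule p.primeCompl C) n) := by
    by_contra hcon
    apply hsupp
    rw [extDepth, sInf_eq_top]
    rintro _ ⟨i, -, hi⟩
    exact absurd ⟨i, hi⟩ hcon
  have hmem : ∀ x ∈ p, algebraMap A (Localization.AtPrime p) x ∈
      IsLocalRing.maximalIdeal (Localization.AtPrime p) := by
    intro x hx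
    rw [← Localization.AtPrime.map_eq_maximalIdeal]
    exact Ideal.mem_map_of_mem _ hx
  obtain ⟨e1, e2, e3⟩ := main_ext (xs.map (algebraMap A (Localization.AtPrime p))) (by
    intro y hy
    obtain ⟨x, hx, rfl⟩ := List.mem_map.mp hy
    exact hmem x (hxp x hx)) K _ (hwr xs hxp hx1) (Submodule.smul_mono_left hK) hex
  rw [List.length_map, hl] at e1 e2
  refine ⟨?_, ?_, ?_, ?_⟩
  · rw [hh]
    apply le_antisymm
    · exact sInf_le ⟨h, rfl, e2⟩
    · refine le_sInf ?_
      rintro _ ⟨i, rfl, hi⟩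
      by_contra hlt
      rw [not_le] at hlt
      exact e1 i (by exact_mod_cast hlt) hi
  · rw [IsLocalization.AtPrime.ringKrullDim_eq_height p, ← PrimeSpectrum.height_eq_orderHeight]
  · change _ + ringKrullDim (A ⧸ p) = _
    rw [coheight_eq_dim p, hd]
    change ((Order.height P : WithBot ℕ∞)) + (Order.coheight P : WithBot ℕ∞) = ((d : ℕ∞) : WithBot ℕ∞)
    rw [← WithBot.coe_add, WithBot.coe_inj]
    refine le_antisymm hsum ?_
    by_contra hlt
    rw [not_le] at hlt
    have hlt' := Order.add_one_le_of_lt hlt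
    obtain ⟨y, hy, hy1, -⟩ := extend_list (d : ℕ∞) P xs (by
      rw [hl, ← hh]
      refine le_trans (le_of_eq ?_) hlt'
      ring) hx1
    have hw := hwr (xs ++ [y]) (by
      intro z hz
      rcases List.mem_append.mp hz with hz | hz
      · exact hxp z hz
      · rw [List.mem_singleton.mp hz]; exact hy) hy1
    rw [List.map_append, RingTheory.Sequence.isWeaklyRegular_append_iff, List.map_singleton,
      RingTheory.Sequence.isWeaklyRegular_singleton_iff] at hw
    have hreg := hw.2.pow K
    apply e3
    rw [eq_top_iff]
    have hle : Ideal.ofList (xs.map (algebraMap A (Localization.AtPrime p))) ≤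
        IsLocalRing.maximalIdeal (Localization.AtPrime p) := by
      refine Ideal.span_le.mpr ?_
      intro y hy
      obtain ⟨x, hx, rfl⟩ := List.mem_map.mp hy
      exact hmem x (hxp x hx)
    refine le_trans ?_ (Submodule.smul_mono_left hle)
    intro m _
    rw [← Submodule.Quotient.mk_eq_zero]
    apply hreg
    change _ • _ = _ • _
    rw [smul_zero, ← Submodule.Quotient.mk_smul, Submodule.Quotient.mk_eq_zero]
    exact Submodule.smul_mem_smul (hK (Ideal.pow_mem_pow (hmem y hy) K)) trivial
  · rw [Localization.AtPrime.map_eq_maximalIdeal]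
    exact e3
end
end

section
/- Let (A,m) be a noetherian local ring, M a finitely generated A-module of finite projective dimension, p a prime ideal of A, and C a balanced big Cohen-Macaulay module over A/p. Then Tor^A_n(C, M) = 0 for all n > depth(A_p). -/
open CategoryTheory

noncomputable section

/-- `M` has finite projective dimension: `Ext^i(M, -)` vanishes for all large `i`. -/
def HasFinitePD (R : Type) [CommRing R] (M : Type) [AddCommGroup M] [Module R M] : Prop :=
  ∃ n : ℕ, ∀ i : ℕ, n < i → ∀ N : ModuleCat.{0} R,
    Subsingleton (Abelian.Ext (ModuleCat.of R M) N i)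

/-- `M` has finite injective dimension: `Ext^i(-, M)` vanishes for all large `i`. -/
def HasFiniteInjDim (R : Type) [CommRing R] (M : Type) [AddCommGroup M] [Module R M] : Prop :=
  ∃ n : ℕ, ∀ i : ℕ, n < i → ∀ N : ModuleCat.{0} R,
    Subsingleton (Abelian.Ext N (ModuleCat.of R M) i)

section
open Abelian Limits


/-- Ext in universe zero. -/
abbrev E0 (R : Type) [CommRing R] (L N : Type) [AddCommGroup L] [Module R L]
    [AddCommGroup N] [Module R N] (n : ℕ) : Type :=
  Ext.{0} (ModuleCat.of R L) (ModuleCat.of R N) n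

section
variable {R : Type} [CommRing R]

lemma subsingleton_extGrp_iff (L N : Type) [AddCommGroup L] [Module R L]
    [AddCommGroup N] [Module R N] (n : ℕ) :
    Subsingleton (extGrp R L N n) ↔ Subsingleton (E0 R L N n) :=
  (Ext.chgUniv.{0, 1} (X := ModuleCat.of R L) (Y := ModuleCat.of R N) (n := n)).subsingleton_congr

/-- short complex of linear maps -/
abbrev scOf {X Y Z : Type} [AddCommGroup X] [Module R X] [AddCommGroup Y] [Module R Y]
    [AddCommGroup Z] [Module R Z] (f : X →ₗ[R] Y) (g : Y →ₗ[R] Z) (h : Function.Exact f g) :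
    ShortComplex (ModuleCat.{0} R) :=
  ShortComplex.mk (ModuleCat.ofHom f) (ModuleCat.ofHom g) (by
    ext x; simpa using h.apply_apply_eq_zero x)

lemma scOf_shortExact {X Y Z : Type} [AddCommGroup X] [Module R X] [AddCommGroup Y] [Module R Y]
    [AddCommGroup Z] [Module R Z] (f : X →ₗ[R] Y) (g : Y →ₗ[R] Z) (h : Function.Exact f g)
    (hf : Function.Injective f) (hg : Function.Surjective g) : (scOf f g h).ShortExact where
  exact := by
    rw [ShortComplex.ShortExact.moduleCat_exact_iff_function_exact]; exact h
  mono_f := (ModuleCat.mono_iff_injective _).mpr hf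
  epi_g := (ModuleCat.epi_iff_surjective _).mpr hg

variable {X Y Z : Type} [AddCommGroup X] [Module R X] [AddCommGroup Y] [Module R Y]
    [AddCommGroup Z] [Module R Z] {f : X →ₗ[R] Y} {g : Y →ₗ[R] Z}

/-- covariant: Ext^i(L,Y)=0, Ext^{i+1}(L,X)=0 gives Ext^i(L,Z)=0 -/
lemma E0_third (L : Type) [AddCommGroup L] [Module R L] (h : Function.Exact f g)
    (hf : Function.Injective f) (hg : Function.Surjective g) (i : ℕ)
    (h2 : Subsingleton (E0 R L Y i)) (h1 : Subsingleton (E0 R L X (i+1))) :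
    Subsingleton (E0 R L Z i) := by
  refine subsingleton_of_forall_eq 0 fun x => ?_
  obtain ⟨y, rfl⟩ := Ext.covariant_sequence_exact₃ (ModuleCat.of R L)
    (scOf_shortExact f g h hf hg) x rfl (h1.elim _ _)
  rw [h2.elim y 0, Ext.zero_comp]

/-- contravariant middle -/
lemma E0_mid (N : Type) [AddCommGroup N] [Module R N] (h : Function.Exact f g)
    (hf : Function.Injective f) (hg : Function.Surjective g) (i : ℕ)
    (h2 : Subsingleton (E0 R X N i)) (h1 : Subsingleton (E0 R Z N i)) :
    Subsingleton (E0 R Y N i) := by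
  refine subsingleton_of_forall_eq 0 fun x => ?_
  obtain ⟨y, rfl⟩ := Ext.contravariant_sequence_exact₂ 
    (scOf_shortExact f g h hf hg) (ModuleCat.of R N) x (h2.elim _ _)
  rw [h1.elim y 0, Ext.comp_zero]

lemma E0_congr_left {X Y : Type} [AddCommGroup X] [Module R X] [AddCommGroup Y] [Module R Y]
    (N : Type) [AddCommGroup N] [Module R N] (e : X ≃ₗ[R] Y) (i : ℕ)
    (h : Subsingleton (E0 R X N i)) : Subsingleton (E0 R Y N i) := by
  refine subsingleton_of_forall_eq 0 fun x => ?_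
  have : (Ext.mk₀ (e.toModuleIso.hom) : Ext.{0} _ _ 0).comp x (zero_add i) = 0 := h.elim _ _
  have h2 : (Ext.mk₀ (e.toModuleIso.inv) : Ext.{0} _ _ 0).comp ((Ext.mk₀ (e.toModuleIso.hom) : Ext.{0} _ _ 0).comp x (zero_add i)) (zero_add i) = 0 := by
    rw [this, Ext.comp_zero]
  rw [Ext.mk₀_comp_mk₀_assoc] at h2
  rw [Iso.inv_hom_id, Ext.mk₀_id_comp] at h2
  exact h2

/-- retract in the second variable -/
lemma E0_retract {X Y : Type} [AddCommGroup X] [Module R X] [AddCommGroup Y] [Module R Y]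
    (L : Type) [AddCommGroup L] [Module R L] (a : X →ₗ[R] Y) (b : Y →ₗ[R] X)
    (hab : b ∘ₗ a = LinearMap.id) (i : ℕ)
    (h : Subsingleton (E0 R L Y i)) : Subsingleton (E0 R L X i) := by
  refine subsingleton_of_forall_eq 0 fun x => ?_
  have h1 : x.comp (Ext.mk₀ (ModuleCat.ofHom a)) (add_zero i) = 0 := h.elim _ _
  have h2 : (x.comp (Ext.mk₀ (ModuleCat.ofHom a)) (add_zero i)).comp
    (Ext.mk₀ (ModuleCat.ofHom b)) (add_zero i) = 0 := by rw [h1, Ext.zero_comp]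
  rw [Ext.comp_assoc_of_third_deg_zero, Ext.mk₀_comp_mk₀, ← ModuleCat.ofHom_comp, hab] at h2
  simpa using h2

lemma smul_eq_zero_of_mem_ann (L : Type) [AddCommGroup L] [Module R L] 
    (N : Type) [AddCommGroup N] [Module R N] (i : ℕ) (r : R) (hr : r ∈ Module.annihilator R L)
    (x : E0 R L N i) : r • x = 0 := by
  have := Ext.postcomp_smul_id_eq_zero_of_mem_annihilator (M := ModuleCat.of R N)
    (N := ModuleCat.of R L) hr i
  have h := congrArg (fun f => f.hom x) this
  simpa [Ext.mk₀_smul, Ext.comp_smul] using h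

open RingTheory.Sequence Pointwise in
lemma E0_of_weaklyRegular (I : Ideal R) (rs : List R) (hrs : ∀ r ∈ rs, r ∈ I) :
    ∀ (N : Type) [AddCommGroup N] [Module R N], IsWeaklyRegular N rs → 
    ∀ i < rs.length, Subsingleton (E0 R (R ⧸ I) N i) := by
  induction rs with
  | nil => intro N _ _ _ i hi; simp at hi
  | cons a rs ih =>
    intro N _ _ reg i hi
    rw [isWeaklyRegular_cons_iff] at reg
    simp only [List.mem_cons, forall_eq_or_imp] at hrs
    have ha : a ∈ Module.annihilator R (R ⧸ I) := by
      rw [Ideal.annihilator_quotient]; exact hrs.1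
    have inj : Function.Injective (LinearMap.lsmul R N a) := reg.1
    have hex : Function.Exact (LinearMap.lsmul R N a) (Submodule.mkQ (a • (⊤ : Submodule R N))) := by
      intro y
      rw [← LinearMap.mem_ker, Submodule.ker_mkQ, Submodule.mem_smul_pointwise_iff_exists]
      simp
    refine subsingleton_of_forall_eq 0 fun x => ?_
    have hx : x.comp (Ext.mk₀ (ModuleCat.ofHom (LinearMap.lsmul R N a))) (add_zero i) = 0 := by
      have : ModuleCat.ofHom (LinearMap.lsmul R N a) = a • 𝟙 (ModuleCat.of R N) := by
        ext; simp
      rw [this, Ext.mk₀_smul, Ext.comp_smul, Ext.comp_mk₀_id]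
      exact smul_eq_zero_of_mem_ann _ _ _ _ ha x
    have SE := scOf_shortExact _ _ hex inj (Submodule.mkQ_surjective _)
    match i, x, hi, hx with
    | 0, x, hi, hx =>
      have := SE.mono_f
      exact Ext.postcomp_mk₀_injective_of_mono.{0} (ModuleCat.of R (R ⧸ I)) (scOf _ _ hex).f
        (by simpa using hx)
    | i+1, x, hi, hx =>
      obtain ⟨y, rfl⟩ := Ext.covariant_sequence_exact₁ (ModuleCat.of R (R ⧸ I)) SE x hx rfl
      have := ih hrs.2 (QuotSMulTop a N) reg.2 i (by simpa using hi)
      rw [this.elim y 0, Ext.zero_comp]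
end

section
variable {R : Type} [CommRing R]

/-- linear maps inducing zero on Ext -/
def nullPc (L : Type) [AddCommGroup L] [Module R L] (X Y : Type) [AddCommGroup X] [Module R X]
    [AddCommGroup Y] [Module R Y] (i : ℕ) : Submodule R (X →ₗ[R] Y) where
  carrier := {φ | ∀ x : E0 R L X i, x.comp (Ext.mk₀ (ModuleCat.ofHom φ)) (add_zero i) = 0}
  add_mem' {a b} ha hb x := by
    rw [ModuleCat.ofHom_add, Ext.mk₀_add, Ext.comp_add, ha x, hb x, add_zero]
  zero_mem' x := by
    have : (ModuleCat.ofHom (0 : X →ₗ[R] Y)) = 0 := rfl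
    rw [this, Ext.mk₀_zero, Ext.comp_zero]
  smul_mem' r a ha x := by
    have : (ModuleCat.ofHom (r • a)) = r • ModuleCat.ofHom a := rfl
    rw [this, Ext.mk₀_smul, Ext.comp_smul, ha x, smul_zero]

lemma nullPc_smul (L : Type) [AddCommGroup L] [Module R L] (X Y : Type) [AddCommGroup X] [Module R X]
    [AddCommGroup Y] [Module R Y] (i : ℕ) (r : R) (hr : r ∈ Module.annihilator R L)
    (φ : X →ₗ[R] Y) : r • φ ∈ nullPc L X Y i := by
  intro x
  have : (ModuleCat.ofHom (r • φ)) = r • ModuleCat.ofHom φ := rfl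
  rw [this, Ext.mk₀_smul, Ext.comp_smul]
  exact smul_eq_zero_of_mem_ann _ _ _ _ hr _

lemma nullPc_comp (L : Type) [AddCommGroup L] [Module R L] (X Y Z : Type) [AddCommGroup X] [Module R X]
    [AddCommGroup Y] [Module R Y] [AddCommGroup Z] [Module R Z] (i : ℕ)
    (h : Subsingleton (E0 R L Y i)) (a : X →ₗ[R] Y) (b : Y →ₗ[R] Z) :
    b ∘ₗ a ∈ nullPc L X Z i := by
  intro x
  have h1 : x.comp (Ext.mk₀ (ModuleCat.ofHom a)) (add_zero i) = 0 := h.elim _ _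
  have h2 : (x.comp (Ext.mk₀ (ModuleCat.ofHom a)) (add_zero i)).comp
    (Ext.mk₀ (ModuleCat.ofHom b)) (add_zero i) = 0 := by rw [h1, Ext.zero_comp]
  rwa [Ext.comp_assoc_of_third_deg_zero, Ext.mk₀_comp_mk₀, ← ModuleCat.ofHom_comp] at h2

lemma subsingleton_of_id_null (L : Type) [AddCommGroup L] [Module R L] (X : Type) [AddCommGroup X] [Module R X]
    (i : ℕ) (h : (LinearMap.id : X →ₗ[R] X) ∈ nullPc L X X i) : Subsingleton (E0 R L X i) := by
  refine subsingleton_of_forall_eq 0 fun x => ?_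
  have := h x
  simpa using this

lemma E0_finfree (L : Type) [AddCommGroup L] [Module R L] (ι : Type) [Finite ι] (i : ℕ)
    (h : Subsingleton (E0 R L R i)) : Subsingleton (E0 R L (ι → R) i) := by
  classical
  have := Fintype.ofFinite ι
  apply subsingleton_of_id_null
  have : (LinearMap.id : (ι → R) →ₗ[R] (ι → R)) =
      ∑ j, (LinearMap.single R (fun _ => R) j) ∘ₗ (LinearMap.proj j) := by
    ext a b
    simp [Pi.single_apply]
  rw [this]
  exact Submodule.sum_mem _ fun j _ => nullPc_comp _ _ _ _ _ h _ _

variable [IsLocalRing R]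
open IsLocalRing

lemma exists_minimal_cover (N : Type) [AddCommGroup N] [Module R N] [Module.Finite R N] :
    ∃ (ι : Type) (_ : Finite ι) (f : (ι → R) →ₗ[R] N), Function.Surjective f ∧
      ∀ x, f x = 0 → ∀ i, x i ∈ maximalIdeal R := by
  let b := Module.Free.chooseBasis (ResidueField R) (TensorProduct R (ResidueField R) N)
  obtain ⟨v, hv⟩ := (TensorProduct.mk_surjective R N (ResidueField R)
    Ideal.Quotient.mk_surjective).comp_left b
  have hv' : ∀ i, TensorProduct.mk R (ResidueField R) N 1 (v i) = b i := fun i => congrFun hv i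
  refine ⟨_, inferInstance, Fintype.linearCombination R v, ?_, ?_⟩
  · rw [← LinearMap.range_eq_top, Fintype.range_linearCombination]
    exact span_eq_top_of_tmul_eq_basis v b hv'
  · intro x hx
    rw [Fintype.linearCombination_apply] at hx
    have h1 := congrArg (TensorProduct.mk R (ResidueField R) N 1) hx
    simp only [map_sum, map_smul, map_zero, hv'] at h1
    have h2 := Fintype.linearIndependent_iff.mp b.linearIndependent (fun i => residue R (x i)) (by
      rw [← h1]; exact Finset.sum_congr rfl fun i _ => by
        rw [← ResidueField.algebraMap_eq, algebraMap_smul])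
    intro i
    exact (residue_eq_zero_iff _).mp (h2 i)

lemma minimal_null (i : ℕ) (ι : Type) [Finite ι] (K : Type) [AddCommGroup K] [Module R K]
    [Module.Finite R K] [Module.Free R K] (φ : K →ₗ[R] (ι → R))
    (h : ∀ x i, φ x i ∈ maximalIdeal R) : φ ∈ nullPc (ResidueField R) K (ι → R) i := by
  classical
  have := Fintype.ofFinite ι
  let b := Module.Free.chooseBasis R K
  have : φ = ∑ k, ∑ j, (φ (b k) j) • ((b.coord k).smulRight (Pi.single j (1 : R) : ι → R)) := by
    refine b.ext fun l => ?_
    funext j'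
    simp only [LinearMap.sum_apply, Finset.sum_apply]
    rw [Finset.sum_eq_single l]
    · simp [Pi.single_apply]
    · intro c _ hc
      simp [Finsupp.single_apply, hc.symm]
    · simp
  rw [this]
  refine Submodule.sum_mem _ fun k _ => Submodule.sum_mem _ fun j _ => nullPc_smul _ _ _ _ _ ?_ _
  have : Module.annihilator R (ResidueField R) = maximalIdeal R := Ideal.annihilator_quotient
  rw [this]
  exact h _ _

theorem AB_aux [IsNoetherianRing R] (d : ℕ)
    (hlow : ∀ i < d, Subsingleton (E0 R (ResidueField R) R i))
    (hd : ¬ Subsingleton (E0 R (ResidueField R) R d)) (t : ℕ) :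
    ∀ (N : Type) [AddCommGroup N] [Module R N] [Module.Finite R N],
    HasProjectiveDimensionLT (ModuleCat.of R N) (t+1) →
    ¬ HasProjectiveDimensionLT (ModuleCat.of R N) t →
    ∃ j, j + t = d ∧ ¬ Subsingleton (E0 R (ResidueField R) N j) := by
  have free (N : Type) [AddCommGroup N] [Module R N] [Module.Finite R N]
    (h1 : HasProjectiveDimensionLT (ModuleCat.of R N) 1) : Module.Free R N := by
    have : Projective (ModuleCat.of R N) := projective_iff_hasProjectiveDimensionLT_one.mpr h1
    have : Module.Projective R N := (IsProjective.iff_projective (R := R) N).mpr this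
    exact Module.free_of_flat_of_isLocalRing
  have fnt (N : Type) [AddCommGroup N] [Module R N] [Module.Finite R N] [Module.Free R N]
    (h0 : ¬ HasProjectiveDimensionLT (ModuleCat.of R N) 0) : 
    ¬ Subsingleton (E0 R (ResidueField R) N d) := by
    intro hs
    have hnt : Nontrivial N := by
      rw [hasProjectiveDimensionLT_zero_iff_isZero, ModuleCat.isZero_iff_subsingleton] at h0
      exact not_subsingleton_iff_nontrivial.mp h0
    let b := Module.Free.chooseBasis R N
    obtain ⟨k⟩ : Nonempty (Module.Free.ChooseBasisIndex R N) := b.index_nonempty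
    refine hd (E0_retract (ResidueField R) (LinearMap.toSpanSingleton R N (b k)) (b.coord k) ?_ d hs)
    ext; simp
  induction t with
  | zero =>
    intro N _ _ _ h1 h0
    have := free N h1
    exact ⟨d, rfl, fnt N h0⟩
  | succ t ih =>
    intro N _ _ _ h1 h0
    obtain ⟨ι, _, f, hf, hmin⟩ := exists_minimal_cover (R := R) N
    have hex : Function.Exact (LinearMap.ker f).subtype f := LinearMap.exact_subtype_ker_map f
    have SE := scOf_shortExact _ _ hex Subtype.val_injective hf
    have hP : Projective (ModuleCat.of R (ι → R)) := (IsProjective.iff_projective (R := R) (ι → R)).mp inferInstance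
    have hK1 : HasProjectiveDimensionLT (ModuleCat.of R (LinearMap.ker f)) (t+1) :=
      (SE.hasProjectiveDimensionLT_X₃_iff t hP).mp h1
    have hK0 : ¬ HasProjectiveDimensionLT (ModuleCat.of R (LinearMap.ker f)) t := by
      intro hh
      exact h0 (SE.hasProjectiveDimensionLT_X₃ t hh inferInstance)
    obtain ⟨j, hj, hjs⟩ := ih (LinearMap.ker f) hK1 hK0
    have key : ∀ x : E0 R (ResidueField R) (LinearMap.ker f) j,
        x.comp (Ext.mk₀ (ModuleCat.ofHom (LinearMap.ker f).subtype)) (add_zero j) = 0 := by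
      rcases t with _ | t
      · have := free _ hK1
        exact minimal_null j ι (LinearMap.ker f) (LinearMap.ker f).subtype fun x i => 
          hmin x.1 x.2 i
      · intro x
        exact (E0_finfree (ResidueField R) ι j (hlow j (by omega))).elim _ _
    rcases j with _ | j
    · refine absurd (subsingleton_of_forall_eq 0 fun x => ?_) hjs
      have := SE.mono_f
      exact Ext.postcomp_mk₀_injective_of_mono.{0} (ModuleCat.of R (ResidueField R)) (scOf _ _ hex).f
        (by simpa using key x)
    · refine ⟨j, by omega, fun hs => hjs (subsingleton_of_forall_eq 0 fun x => ?_)⟩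
      obtain ⟨y, rfl⟩ := Ext.covariant_sequence_exact₁ (ModuleCat.of R (ResidueField R)) SE x (key x) rfl
      rw [hs.elim y 0, Ext.zero_comp]

/-- Auslander–Buchsbaum inequality. -/
theorem AB [IsNoetherianRing R] (e : ℕ)
    (he : ¬ Subsingleton (E0 R (ResidueField R) R e)) 
    (N : Type) [AddCommGroup N] [Module R N] [Module.Finite R N] (T : ℕ)
    (hT : HasProjectiveDimensionLT (ModuleCat.of R N) T) :
    HasProjectiveDimensionLT (ModuleCat.of R N) (e+1) := by
  classical
  have hex : ∃ e, ¬ Subsingleton (E0 R (ResidueField R) R e) := ⟨e, he⟩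
  have hde : Nat.find hex ≤ e := Nat.find_min' hex he
  have hlow : ∀ i < Nat.find hex, Subsingleton (E0 R (ResidueField R) R i) :=
    fun i hi => not_not.mp (Nat.find_min hex hi)
  have hT' : ∃ T, HasProjectiveDimensionLT (ModuleCat.of R N) T := ⟨T, hT⟩
  rcases h : Nat.find hT' with _ | t
  · have := Nat.find_spec hT'
    rw [h] at this
    exact hasProjectiveDimensionLT_of_ge _ 0 _ (by omega)
  · have h1 := Nat.find_spec hT'
    rw [h] at h1
    obtain ⟨j, hj, -⟩ := AB_aux _ hlow (Nat.find_spec hex) t N h1 (Nat.find_min hT' (by omega))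
    exact hasProjectiveDimensionLT_of_ge _ (t+1) _ (by omega)
end

section
variable {R : Type} [CommRing R] [IsLocalRing R] [IsNoetherianRing R]
open IsLocalRing

theorem ischebeck (N : Type) [AddCommGroup N] [Module R N] [Module.Finite R N] (k : ℕ)
    (hk : ∀ i ≤ k, Subsingleton (E0 R (ResidueField R) N i)) (c : ℕ) :
    ∀ (L : Type) [AddCommGroup L] [Module R L] [Module.Finite R L],
    (∀ P ∈ Module.support R L, Order.coheight P ≤ c) → ∀ i, i + c ≤ k →
      Subsingleton (E0 R L N i) := by
  induction c using Nat.strong_induction_on with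
  | _ c ih =>
  intro L _ _ hfin
  induction hfin using IsNoetherianRing.induction_on_isQuotientEquivQuotientPrime R with
  | subsingleton L =>
    intro _ i _
    have : IsZero (ModuleCat.of R L) := ModuleCat.isZero_of_subsingleton _
    refine subsingleton_of_forall_eq 0 fun x => ?_
    have h1 : (Ext.mk₀ (𝟙 (ModuleCat.of R L)) : Ext.{0} _ _ 0).comp x (zero_add i) = 0 := by
      rw [this.eq_of_src (𝟙 _) 0, Ext.mk₀_zero, Ext.zero_comp]
    simpa using h1
  | quotient L P e =>
    intro hL i hi
    refine E0_congr_left N e.symm i ?_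
    have hsupp : ∀ Q : PrimeSpectrum R, P ≤ Q → Q ∈ Module.support R L := fun Q hQ => by
      rw [e.support_eq, Module.support_eq_zeroLocus, Ideal.annihilator_quotient]
      exact hQ
    by_cases hP : P.1 = maximalIdeal R
    · rw [hP]; exact hk i (by omega)
    obtain ⟨x, hxm, hxP⟩ := SetLike.exists_of_lt (lt_of_le_of_ne (le_maximalIdeal P.2.ne_top) hP)
    have hcP : Order.coheight P ≤ c := hL P (hsupp P le_rfl)
    have inj : Function.Injective (LinearMap.lsmul R (R ⧸ P.1) x) := by
      rw [injective_iff_map_eq_zero]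
      intro y
      obtain ⟨y, rfl⟩ := Ideal.Quotient.mk_surjective y
      simp only [LinearMap.lsmul_apply, Algebra.smul_def, Ideal.Quotient.algebraMap_eq, ← map_mul,
        Ideal.Quotient.eq_zero_iff_mem]
      exact fun h => (P.2.mem_or_mem h).resolve_left hxP
    let W := LinearMap.range (LinearMap.lsmul R (R ⧸ P.1) x)
    have hex : Function.Exact (LinearMap.lsmul R (R ⧸ P.1) x) W.mkQ := by
      exact LinearMap.exact_map_mkQ_range _
    have SE := scOf_shortExact _ _ hex inj (Submodule.mkQ_surjective _)
    have hz : Subsingleton (E0 R ((R ⧸ P.1) ⧸ W) N (i+1)) := by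
      have hW : ∀ Q ∈ Module.support R ((R ⧸ P.1) ⧸ W), P < Q := by
        intro Q hQ
        rw [Module.support_eq_zeroLocus] at hQ
        have hle : P ≤ Q := fun r hr => hQ (by
          simp only [SetLike.mem_coe, Module.mem_annihilator]
          intro m
          obtain ⟨m, rfl⟩ := Submodule.mkQ_surjective _ m
          rw [← map_smul]
          obtain ⟨m, rfl⟩ := Ideal.Quotient.mk_surjective m
          rw [Algebra.smul_def, Ideal.Quotient.algebraMap_eq, Ideal.Quotient.eq_zero_iff_mem.mpr hr, zero_mul, map_zero])
        have hx : x ∈ Q.1 := hQ (by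
          simp only [SetLike.mem_coe, Module.mem_annihilator]
          intro m
          obtain ⟨m, rfl⟩ := Submodule.mkQ_surjective _ m
          rw [← map_smul, Submodule.mkQ_apply, Submodule.Quotient.mk_eq_zero]
          exact ⟨m, rfl⟩)
        exact lt_of_le_of_ne hle fun h => hxP (h ▸ hx)
      have hc0 : c ≠ 0 := by
        rintro rfl
        have : P < closedPoint R := lt_of_le_of_ne (le_maximalIdeal P.2.ne_top) 
          (fun h => hP (congrArg (·.1) h))
        simpa using (Order.coheight_le_coe_iff.mp hcP _ this)
      refine ih (c-1) (by omega) _ (fun Q hQ => ?_) (i+1) (by omega)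
      have := Order.coheight_le_coe_iff.mp hcP Q (hW Q hQ)
      have h2 : ((c : ℕ) : ℕ∞) = ((c-1 : ℕ) : ℕ∞) + 1 := by
        exact_mod_cast (by omega : c = c - 1 + 1)
      rw [h2] at this
      exact ENat.lt_add_one_iff (by simp) |>.mp this
    have hsurj : ∀ z : E0 R (R ⧸ P.1) N i, ∃ y, x • y = z := by
      intro z
      obtain ⟨y, hy⟩ := Ext.contravariant_sequence_exact₁ SE (ModuleCat.of R N) z (add_comm 1 i) (hz.elim _ _)
      refine ⟨y, ?_⟩
      rw [← hy]
      have : ModuleCat.ofHom (LinearMap.lsmul R (R ⧸ P.1) x) = x • 𝟙 (ModuleCat.of R (R ⧸ P.1)) := by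
        ext; simp
      dsimp
      rw [this, Ext.mk₀_smul, Ext.smul_comp, Ext.mk₀_id_comp]
    have hfin : Module.Finite R (E0 R (R ⧸ P.1) N i) := ModuleCat.finite_ext R (ModuleCat.of R (R ⧸ P.1)) (ModuleCat.of R N) i
    have htop : (⊤ : Submodule R (E0 R (R ⧸ P.1) N i)) ≤ (maximalIdeal R) • ⊤ := by
      intro z _
      obtain ⟨y, rfl⟩ := hsurj z
      exact Submodule.smul_mem_smul hxm trivial
    have := Submodule.eq_bot_of_le_smul_of_le_jacobson_bot (maximalIdeal R) _ hfin.fg_top htop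
      (by rw [jacobson_eq_maximalIdeal _ bot_ne_top])
    exact (Submodule.subsingleton_iff R).mp (subsingleton_of_bot_eq_top this.symm)
  | exact L₁ L₂ L₃ f g hf hg hfg h₁ h₃ =>
    intro hL i hi
    exact E0_mid N hfg hf hg i 
      (h₁ (fun P hP => hL P (Module.support_subset_of_injective f hf hP)) i hi)
      (h₃ (fun P hP => hL P (Module.support_subset_of_surjective g hg hP)) i hi)
end

section
variable {A : Type} [CommRing A] 
open IsLocalRing

lemma coheight_le_of_height (p q : Ideal A) [p.IsPrime] [hq : q.IsPrime] (hpq : p ≤ q) (h : ℕ)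
    (hh : (q.map (Ideal.Quotient.mk p)).height ≤ h) (P : PrimeSpectrum (Localization.AtPrime q))
    (hP : p.map (algebraMap A (Localization.AtPrime q)) ≤ P.1) : Order.coheight P ≤ h := by
  have surj := Ideal.Quotient.mk_surjective (I := p)
  have hker : RingHom.ker (Ideal.Quotient.mk p) = p := Ideal.mk_ker
  have hQ : (q.map (Ideal.Quotient.mk p)).IsPrime :=
    Ideal.map_isPrime_of_surjective surj (by rwa [hker])
  let Q : PrimeSpectrum (A ⧸ p) := ⟨_, hQ⟩
  have hQ' : Order.height Q ≤ h := by
    rw [← PrimeSpectrum.height_eq_orderHeight]; exact hh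
  have hle : ∀ P' : Set.Ici P, p ≤ P'.1.1.comap (algebraMap A _) := fun P' => by
    rw [← Ideal.map_le_iff_le_comap]; exact hP.trans P'.2
  have hpr : ∀ P' : Set.Ici P, ((P'.1.1.comap (algebraMap A _)).map (Ideal.Quotient.mk p)).IsPrime :=
    fun P' => Ideal.map_isPrime_of_surjective surj (by rw [hker]; exact hle P')
  have hinj : ∀ P' : Set.Ici P, ((P'.1.1.comap (algebraMap A _)).map (Ideal.Quotient.mk p)).comap
      (Ideal.Quotient.mk p) = P'.1.1.comap (algebraMap A _) := fun P' => by
    rw [Ideal.comap_map_of_surjective' _ surj, hker, sup_eq_left]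
    exact hle P'
  let f : Set.Ici P → Set.Iic Q := fun P' => ⟨⟨_, hpr P'⟩, by
    refine Ideal.map_mono ?_
    have : P'.1.1 ≤ maximalIdeal _ := le_maximalIdeal P'.1.2.ne_top
    refine (Ideal.comap_mono this).trans ?_
    exact (IsLocalization.AtPrime.under_maximalIdeal (Localization.AtPrime q) q).le⟩
  have hf : StrictMono f := by
    intro a b hab
    refine lt_of_le_of_ne (Ideal.map_mono (Ideal.comap_mono hab.le)) fun heq => hab.ne ?_
    have h1 : (a.1.1.comap (algebraMap A _)).map (Ideal.Quotient.mk p) =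
      (b.1.1.comap (algebraMap A _)).map (Ideal.Quotient.mk p) := 
      congrArg (fun x : Set.Iic Q => x.1.1) heq
    have h2 := congrArg (Ideal.comap (Ideal.Quotient.mk p)) h1
    rw [hinj, hinj] at h2
    apply Subtype.ext
    apply PrimeSpectrum.ext
    rw [← IsLocalization.map_under q.primeCompl (Localization.AtPrime q) a.1.1,
      ← IsLocalization.map_under q.primeCompl (Localization.AtPrime q) b.1.1]
    exact congrArg _ h2
  have := Order.krullDim_le_of_strictMono f hf
  rw [← Order.coheight_eq_krullDim_Ici, ← Order.height_eq_krullDim_Iic] at this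
  exact (WithBot.coe_le_coe.mp this).trans hQ'

variable [IsNoetherianRing A]

theorem pd_local (p q : Ideal A) [p.IsPrime] [hq : q.IsPrime] (hpq : p ≤ q) (h e : ℕ)
    (hh : (q.map (Ideal.Quotient.mk p)).height ≤ h) 
    (he : ¬ Subsingleton (E0 (Localization.AtPrime p) (ResidueField (Localization.AtPrime p))
      (Localization.AtPrime p) e))
    (N : Type) [AddCommGroup N] [Module (Localization.AtPrime q) N] 
    [Module.Finite (Localization.AtPrime q) N] (T : ℕ)
    (hT : HasProjectiveDimensionLT (ModuleCat.of (Localization.AtPrime q) N) T) :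
    HasProjectiveDimensionLT (ModuleCat.of (Localization.AtPrime q) N) (e+h+1) := by
  let R := Localization.AtPrime q
  let S := Localization.AtPrime p
  have hR : IsNoetherianRing R := IsLocalization.isNoetherianRing q.primeCompl R inferInstance
  have hle : q.primeCompl ≤ p.primeCompl := fun x hx hx' => hx (hpq hx')
  let _ : Algebra R S := IsLocalization.localizationAlgebraOfSubmonoidLe R S _ _ hle
  have : IsScalarTower A R S := IsLocalization.localization_isScalarTower_of_submonoid_le R S _ _ hle
  have := IsLocalization.isLocalization_of_submonoid_le R S _ _ hle
  have key : ∃ i ≤ e + h, ¬ Subsingleton (E0 R (ResidueField R) R i) := by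
    by_contra! hcon
    let I : Ideal R := p.map (algebraMap A R)
    have hIm : I ≤ maximalIdeal R := by
      rw [← IsLocalization.AtPrime.map_eq_maximalIdeal q R]
      exact Ideal.map_mono hpq
    have hsupp : Module.support R (R ⧸ I) = PrimeSpectrum.zeroLocus I := by
      rw [Module.support_eq_zeroLocus, Ideal.annihilator_quotient]
    have hext : ∀ g < e + 1, Subsingleton (E0 R (R ⧸ I) R g) := by
      intro g hg
      refine ischebeck R (e+h) hcon h (R ⧸ I) (fun P hP => ?_) g (by omega)
      rw [hsupp] at hP
      exact coheight_le_of_height p q hpq h hh P hP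
    obtain ⟨rs, hlen, hmem, hreg⟩ := ModuleCat.exists_isRegular_of_exists_subsingleton_ext I (e+1)
      (ModuleCat.of R R) (by
        rw [smul_eq_mul, Ideal.mul_top, lt_top_iff_ne_top]
        exact fun h => (maximalIdeal.isMaximal R).ne_top (top_le_iff.mp (h ▸ hIm)))
      (ModuleCat.of R (R ⧸ I)) hsupp hext
    have hS : RingTheory.Sequence.IsWeaklyRegular S (rs.map (algebraMap R S)) :=
      RingTheory.Sequence.IsWeaklyRegular.of_isLocalization S (p.primeCompl.map (algebraMap A R)) 
        hreg.toIsWeaklyRegular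
    refine he (E0_of_weaklyRegular (maximalIdeal S) _ ?_ S hS e (by simp [hlen]))
    intro r hr
    obtain ⟨r, hr', rfl⟩ := List.mem_map.mp hr
    have := Ideal.mem_map_of_mem (algebraMap R S) (hmem r hr')
    rw [Ideal.map_map, ← IsScalarTower.algebraMap_eq, IsLocalization.AtPrime.map_eq_maximalIdeal p S] at this
    exact this
  obtain ⟨i, hi, hne⟩ := key
  have := AB i hne N T hT
  exact hasProjectiveDimensionLT_of_ge _ (i+1) _ (by omega)

lemma pd_localized (q : Ideal A) [hq : q.IsPrime] 
    (N : Type) [AddCommGroup N] [Module A N] (T : ℕ)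
    (hT : HasProjectiveDimensionLT (ModuleCat.of A N) (T+1)) :
    HasProjectiveDimensionLT (ModuleCat.of (Localization.AtPrime q) (LocalizedModule q.primeCompl N)) (T+1) := by
  have h1 : HasProjectiveDimensionLE (ModuleCat.of A N) T := hT
  have h2 := ModuleCat.localizedModule_hasProjectiveDimensionLE T q.primeCompl (ModuleCat.of A N)
  exact ModuleCat.hasProjectiveDimensionLE_of_linearEquiv 
    (M := (ModuleCat.of A N).localizedModule q.primeCompl)
    (N := ModuleCat.of (Localization.AtPrime q) (LocalizedModule q.primeCompl N)) 
    (Shrink.linearEquiv _ _) T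

end

section
variable {B : Type} [CommRing B] [IsNoetherianRing B] [IsLocalRing B]
open IsLocalRing Pointwise

lemma dim_step (I : Ideal B) (x : B) (hx : ∀ P ∈ I.minimalPrimes, x ∉ P) :
    ringKrullDim (B ⧸ (I ⊔ Ideal.span {x})) + 1 ≤ ringKrullDim (B ⧸ I) := by
  have h1 := Module.supportDim_quotSMulTop_succ_le_of_notMem_minimalPrimes (R := B) (M := B ⧸ I) (x := x)
    (by rwa [Ideal.annihilator_quotient])
  rw [Module.supportDim_quotient_eq_ringKrullDim] at h1
  refine le_trans ?_ h1
  gcongr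
  rw [← Module.supportDim_quotient_eq_ringKrullDim]
  have hle : I ≤ I ⊔ Ideal.span {x} := le_sup_left
  refine Module.supportDim_le_of_surjective 
    (Submodule.liftQ (x • (⊤ : Submodule B (B ⧸ I))) (Submodule.factor hle) ?_) ?_
  · intro y hy
    obtain ⟨z, -, rfl⟩ := (Submodule.mem_smul_pointwise_iff_exists _ _ _).mp hy
    obtain ⟨z, rfl⟩ := Ideal.Quotient.mk_surjective z
    rw [LinearMap.mem_ker, map_smul]
    refine (Submodule.Quotient.mk_eq_zero (I ⊔ Ideal.span {x}) (x := x • z)).mpr ?_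
    exact Ideal.mem_sup_right (Ideal.mul_mem_right _ _ (Ideal.mem_span_singleton_self x))
  · intro y
    obtain ⟨y, rfl⟩ := Ideal.Quotient.mk_surjective y
    exact ⟨Submodule.Quotient.mk (Submodule.Quotient.mk y), rfl⟩

lemma param_extend (Q : Ideal B) [hQ : Q.IsPrime] (k : ℕ) :
    ∀ xs : List B, (∀ x ∈ xs, x ∈ Q) → 
    ringKrullDim (B ⧸ Ideal.ofList xs) ≤ k →
    ∃ (ys : List B) (k' : ℕ), (∀ y ∈ ys, y ∈ Q) ∧ ys.length + k' = k ∧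
      ringKrullDim (B ⧸ Ideal.ofList (xs ++ ys)) ≤ k' ∧
      Q ∈ (Ideal.ofList (xs ++ ys)).minimalPrimes := by
  have step (xs : List B) (hxs : ∀ x ∈ xs, x ∈ Q) 
      (hmin : Q ∉ (Ideal.ofList xs).minimalPrimes) :
      ∃ x ∈ Q, ringKrullDim (B ⧸ Ideal.ofList (xs ++ [x])) + 1 ≤ ringKrullDim (B ⧸ Ideal.ofList xs) := by
    have hle : Ideal.ofList xs ≤ Q := Ideal.span_le.mpr hxs
    have h1 : ¬ ((Q : Set B) ⊆ ⋃ P ∈ (Ideal.ofList xs).minimalPrimes, (P : Set B)) := by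
      intro h
      obtain ⟨P, hP, hQP⟩ := (Q.subset_union_prime_finite 
        (Ideal.finite_minimalPrimes_of_isNoetherianRing B (Ideal.ofList xs)) (f := id) 0 0 
        fun _ h _ _ ↦ h.1.1).1 h
      have : P ≤ Q := hP.2 ⟨hQ, hle⟩ hQP
      exact hmin (le_antisymm this hQP ▸ hP)
    obtain ⟨x, hx, hx'⟩ := Set.not_subset.mp h1
    refine ⟨x, hx, ?_⟩
    have h3 := dim_step (Ideal.ofList xs) x (fun P hP h => hx' (Set.mem_biUnion hP h))
    have h4 : Ideal.ofList (xs ++ [x]) = Ideal.ofList xs ⊔ Ideal.span {x} := by simp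
    rwa [h4]
  induction k with
  | zero =>
    intro xs hxs hdim
    by_cases hmin : Q ∈ (Ideal.ofList xs).minimalPrimes
    · exact ⟨[], 0, by simp, rfl, by rwa [List.append_nil], by rwa [List.append_nil]⟩
    obtain ⟨x, hx, h⟩ := step xs hxs hmin
    have hle : Ideal.ofList (xs ++ [x]) ≤ Q := Ideal.span_le.mpr (by
      intro y hy
      simp only [List.mem_append, List.mem_singleton, Set.mem_ofPred_eq] at hy
      rcases hy with hy | rfl
      · exact hxs y hy
      · exact hx)
    have : Nontrivial (B ⧸ Ideal.ofList (xs ++ [x])) := 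
      Ideal.Quotient.nontrivial_iff.mpr fun h => hQ.ne_top (top_le_iff.mp (h ▸ hle))
    have h0 : 0 ≤ ringKrullDim (B ⧸ Ideal.ofList (xs ++ [x])) := ringKrullDim_nonneg_of_nontrivial
    have h1 : (0 : WithBot ℕ∞) + 1 ≤ 0 := (add_le_add_left h0 1).trans (h.trans hdim)
    exact absurd h1 (by decide)
  | succ k ih =>
    intro xs hxs hdim
    by_cases hmin : Q ∈ (Ideal.ofList xs).minimalPrimes
    · exact ⟨[], k+1, by simp, by simp, by rwa [List.append_nil], by rwa [List.append_nil]⟩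
    obtain ⟨x, hx, h⟩ := step xs hxs hmin
    obtain ⟨ys, k', h1, h2, h3, h4⟩ := ih (xs ++ [x]) (by
      intro y hy
      simp only [List.mem_append, List.mem_singleton] at hy
      rcases hy with hy | rfl
      · exact hxs y hy
      · exact hx) (by
      have := h.trans hdim
      exact (ENat.WithBot.add_le_add_one_right_iff).mp (by exact_mod_cast this))
    refine ⟨x :: ys, k', ?_, by simp; omega, ?_, ?_⟩
    · intro y hy
      rcases List.mem_cons.mp hy with rfl | hy
      · exact hx
      · exact h1 y hy
    · rwa [List.append_cons]
    · rwa [List.append_cons]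

theorem exists_params (Q : Ideal B) [hQ : Q.IsPrime] :
    ∃ xs ys : List B, (∀ x ∈ xs, x ∈ Q) ∧ Q.height ≤ xs.length ∧ IsSOP B (xs ++ ys) := by
  classical
  obtain ⟨d, hd⟩ : ∃ d : ℕ, ringKrullDim B = d := by
    obtain ⟨a, ha⟩ := WithBot.ne_bot_iff_exists.mp (ringKrullDim_ne_bot (R := B))
    have : a ≠ ⊤ := by rintro rfl; exact ringKrullDim_ne_top (R := B) ha.symm
    obtain ⟨d, rfl⟩ := ENat.ne_top_iff_exists.mp this
    exact ⟨d, ha.symm⟩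
  have cardle : ∀ (zs : List B) (P : Ideal B), P ∈ (Ideal.ofList zs).minimalPrimes → 
      P.height ≤ zs.length := by
    intro zs P hP
    have : Ideal.ofList zs = Ideal.span (zs.toFinset : Set B) := by
      simp [Ideal.ofList]
    rw [this] at hP
    refine (Ideal.height_le_card_of_mem_minimalPrimes_span_finset hP).trans ?_
    exact_mod_cast zs.toFinset_card_le
  obtain ⟨xs, k, hxs, hk, h1, hmin⟩ := param_extend Q d [] (by simp) (by
    rw [← hd]
    exact ringKrullDim_quotient_le _)
  rw [List.nil_append] at h1 hmin
  have hQm : Q ≤ maximalIdeal B := le_maximalIdeal hQ.ne_top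
  obtain ⟨ys, k', hys, hk', h2, hmin2⟩ := param_extend (maximalIdeal B) k xs (fun x hx => hQm (hxs x hx)) h1
  have hh := cardle _ _ hmin2
  have hd' : (d : ℕ∞) ≤ (xs ++ ys).length := by
    rw [← IsLocalRing.maximalIdeal_height_eq_ringKrullDim] at hd
    have : (maximalIdeal B).height = d := by exact_mod_cast hd
    rwa [← this]
  have hd'' : d ≤ xs.length + ys.length := by simpa using (by exact_mod_cast hd' : d ≤ (xs ++ ys).length)
  have hk0 : k' = 0 := by omega
  refine ⟨xs, ys, hxs, cardle _ _ hmin, ?_, ?_, ?_⟩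
  · rw [hd]
    have : (xs ++ ys).length = d := by simp; omega
    rw [this]
  · intro r hr
    rcases List.mem_append.mp hr with hr | hr
    · exact hQm (hxs r hr)
    · exact hys r hr
  · simpa [hk0] using h2
end

section
open TensorProduct

lemma params_q {A : Type} [CommRing A] [IsNoetherianRing A] [IsLocalRing A] (p q : Ideal A)
    [p.IsPrime] [hq : q.IsPrime] (hpq : p ≤ q)
    (C : Type) [AddCommGroup C] [Module (A ⧸ p) C] [Module A C] [IsScalarTower A (A ⧸ p) C]
    (hloc : IsLocalRing (A ⧸ p))
    (hC : @IsBalancedBigCM (A ⧸ p) _ hloc C _ _) :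
    ∃ xs : List A, (∀ x ∈ xs, x ∈ q) ∧ (q.map (Ideal.Quotient.mk p)).height ≤ xs.length ∧
      RingTheory.Sequence.IsWeaklyRegular C xs := by
  haveI : (q.map (Ideal.Quotient.mk p)).IsPrime :=
    Ideal.map_isPrime_of_surjective Ideal.Quotient.mk_surjective (by rwa [Ideal.mk_ker])
  obtain ⟨xs, ys, hx, hh, hsop⟩ := exists_params (q.map (Ideal.Quotient.mk p))
  have hreg := ((RingTheory.Sequence.isWeaklyRegular_append_iff C xs ys).mp
    (hC _ hsop).toIsWeaklyRegular).1
  have hsurj : ∀ zs : List (A ⧸ p), (∀ x ∈ zs, x ∈ q.map (Ideal.Quotient.mk p)) →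
      ∃ xs' : List A, (∀ x ∈ xs', x ∈ q) ∧ xs'.map (algebraMap A (A ⧸ p)) = zs := by
    intro zs
    induction zs with
    | nil => intro _; exact ⟨[], by simp, rfl⟩
    | cons z zs ih =>
      intro h
      obtain ⟨l, hl, hl'⟩ := ih (fun x hx => h x (List.mem_cons_of_mem _ hx))
      obtain ⟨a, ha, ha'⟩ := (Ideal.mem_map_iff_of_surjective _ Ideal.Quotient.mk_surjective).mp
        (h z List.mem_cons_self)
      refine ⟨a :: l, ?_, ?_⟩
      · intro x hx
        rcases List.mem_cons.mp hx with rfl | hx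
        · exact ha
        · exact hl x hx
      · simp only [List.map_cons, hl']
        rw [← ha']; rfl
  obtain ⟨l, hl, rfl⟩ := hsurj xs hx
  refine ⟨l, hl, by simpa using hh, ?_⟩
  exact (RingTheory.Sequence.isWeaklyRegular_map_algebraMap_iff (A ⧸ p) C l).mp hreg

lemma syz_pd {R : Type} [CommRing R] (S P : ℕ → Type) [∀ k, AddCommGroup (S k)]
    [∀ k, Module R (S k)] [∀ k, AddCommGroup (P k)] [∀ k, Module R (P k)]
    [∀ k, Module.Projective R (P k)] (ι : ∀ k, S (k+1) →ₗ[R] P k) (π : ∀ k, P k →ₗ[R] S k)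
    (hex : ∀ k, Function.Exact (ι k) (π k)) (hi : ∀ k, Function.Injective (ι k))
    (hs : ∀ k, Function.Surjective (π k)) (d : ℕ)
    (hd : HasProjectiveDimensionLT (ModuleCat.of R (S 0)) (d+1)) (k : ℕ) :
    HasProjectiveDimensionLT (ModuleCat.of R (S k)) (d-k+1) := by
  induction k with
  | zero => simpa using hd
  | succ k ih =>
    have hse := scOf_shortExact (ι k) (π k) (hex k) (hi k) (hs k)
    have hP : Projective (ModuleCat.of R (P k)) := (IsProjective.iff_projective (R:=R) (P k)).mp inferInstance
    have := (hse.hasProjectiveDimensionLT_X₃_iff (d-(k+1)) hP).mp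
      (by
        haveI := ih
        exact hasProjectiveDimensionLT_of_ge _ (d-k+1) _ (by omega))
    exact this

lemma syz_proj {R : Type} [CommRing R] (S P : ℕ → Type) [∀ k, AddCommGroup (S k)]
    [∀ k, Module R (S k)] [∀ k, AddCommGroup (P k)] [∀ k, Module R (P k)]
    [∀ k, Module.Projective R (P k)] (ι : ∀ k, S (k+1) →ₗ[R] P k) (π : ∀ k, P k →ₗ[R] S k)
    (hex : ∀ k, Function.Exact (ι k) (π k)) (hi : ∀ k, Function.Injective (ι k))
    (hs : ∀ k, Function.Surjective (π k)) (d : ℕ)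
    (hd : HasProjectiveDimensionLT (ModuleCat.of R (S 0)) (d+1)) (k : ℕ) (hk : d ≤ k) :
    Module.Projective R (S k) := by
  have := syz_pd S P ι π hex hi hs d hd k
  rw [Nat.sub_eq_zero_of_le hk, zero_add] at this
  rw [IsProjective.iff_projective (R:=R) (S k)]
  exact projective_iff_hasProjectiveDimensionLT_one.mpr this

lemma retr {R : Type} [CommRing R] {X Y Z : Type} [AddCommGroup X] [Module R X]
    [AddCommGroup Y] [Module R Y] [AddCommGroup Z] [Module R Z] [Module.Projective R Z]
    (f : X →ₗ[R] Y) (g : Y →ₗ[R] Z) (h : Function.Exact f g) (hf : Function.Injective f)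
    (hg : Function.Surjective g) : ∃ r : Y →ₗ[R] X, r ∘ₗ f = LinearMap.id := by
  have h1 : ∃ l, g ∘ₗ l = LinearMap.id := Module.projective_lifting_property g _ hg
  have h2 : (Function.Injective f ∧ ∃ l, g ∘ₗ l = LinearMap.id) ↔
      (Function.Surjective g ∧ ∃ l, l ∘ₗ f = LinearMap.id) :=
    (Function.Exact.split_tfae' h).out 0 1
  exact (h2.mp ⟨hf, h1⟩).2

lemma lTensor_inj_of_retr {R : Type} [CommRing R] {X Y : Type} [AddCommGroup X] [Module R X]
    [AddCommGroup Y] [Module R Y] (C : Type) [AddCommGroup C] [Module R C]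
    (f : X →ₗ[R] Y) (r : Y →ₗ[R] X) (h : r ∘ₗ f = LinearMap.id) :
    Function.Injective (f.lTensor C) := by
  refine Function.LeftInverse.injective (g := r.lTensor C) fun x => ?_
  rw [← LinearMap.comp_apply, ← LinearMap.lTensor_comp, h, LinearMap.lTensor_id]; rfl

instance lTensor_isLocalized {A : Type} [CommRing A] (T : Submonoid A) (C : Type) [AddCommGroup C]
    [Module A C] {X X' : Type} [AddCommGroup X] [Module A X] [AddCommGroup X'] [Module A X']
    (g : X →ₗ[A] X') [IsLocalizedModule T g] : IsLocalizedModule T (g.lTensor C) := by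
  have h1 : IsLocalizedModule T (AlgebraTensorModule.rTensor A C g) := inferInstance
  have h2 := IsLocalizedModule.of_linearEquiv T (AlgebraTensorModule.rTensor A C g)
    (TensorProduct.comm A X' C)
  have h3 := IsLocalizedModule.of_linearEquiv_right T
    ((TensorProduct.comm A X' C).toLinearMap ∘ₗ (AlgebraTensorModule.rTensor A C g))
    (TensorProduct.comm A C X)
  convert h3
  ext; simp

/-- Key contradiction -/
lemma hom_zero {A : Type} [CommRing A] [IsNoetherianRing A] (C : Type) [AddCommGroup C] [Module A C]
    (S P : ℕ → Type) [∀ k, AddCommGroup (S k)]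
    [∀ k, Module A (S k)] [∀ k, AddCommGroup (P k)] [∀ k, Module A (P k)]
    [∀ k, Module.Flat A (P k)] (ι : ∀ k, S (k+1) →ₗ[A] P k) (π : ∀ k, P k →ₗ[A] S k)
    (hex : ∀ k, Function.Exact (ι k) (π k)) 
    (hs : ∀ k, Function.Surjective (π k)) 
    (hi : ∀ k, Function.Injective ((ι k).lTensor C)) (q : Ideal A) (xs : List A)
    (hxq : ∀ x ∈ xs, x ∈ q) (hreg : RingTheory.Sequence.IsWeaklyRegular C xs) 
    (h : ℕ) (hh : xs.length = h + 1) [Module.Flat A (S h)] (j i : ℕ) (hij : i + j = h) :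
    Subsingleton (E0 A (A ⧸ q) (C ⊗[A] S i) i) := by
  induction j generalizing i with
  | zero =>
    obtain rfl : i = h := by omega
    exact E0_of_weaklyRegular q xs hxq _ (hreg.isWeaklyRegular_rTensor) i (by omega)
  | succ j ih =>
    refine E0_third (A ⧸ q) (lTensor_exact C (hex i) (hs i)) (hi i)
      (LinearMap.lTensor_surjective C (hs i)) i ?_ (ih (i+1) (by omega))
    exact E0_of_weaklyRegular q xs hxq _ (hreg.isWeaklyRegular_rTensor) i (by omega)

lemma eq_zero_of_E0 {A : Type} [CommRing A] (q : Ideal A) (N : Type) [AddCommGroup N] [Module A N]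
    (h : Subsingleton (E0 A (A ⧸ q) N 0)) (w : N) (hw : ∀ a ∈ q, a • w = 0) : w = 0 := by
  let f : (A ⧸ q) →ₗ[A] N := Submodule.liftQ q (LinearMap.toSpanSingleton A N w) (by
    intro a ha; simpa using hw a ha)
  have h1 : Subsingleton (ModuleCat.of A (A ⧸ q) ⟶ ModuleCat.of A N) :=
    (Ext.homEquiv₀.{0} (X := ModuleCat.of A (A ⧸ q)) (Y := ModuleCat.of A N)).symm.subsingleton
  have h2 : ModuleCat.ofHom f = 0 := Subsingleton.elim _ _
  have h3 : f (Submodule.Quotient.mk 1) = 0 := by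
    have := congrArg (fun g => g.hom (Submodule.Quotient.mk 1)) h2
    exact this
  rw [Submodule.liftQ_apply] at h3
  simpa using h3
end

section
open TensorProduct

lemma core_step {A : Type} [CommRing A] [IsNoetherianRing A] [IsLocalRing A]
    (p : Ideal A) [p.IsPrime]
    (C : Type) [AddCommGroup C] [Module (A ⧸ p) C] [Module A C] [IsScalarTower A (A ⧸ p) C]
    (hloc : IsLocalRing (A ⧸ p))
    (hC : @IsBalancedBigCM (A ⧸ p) _ hloc C _ _) (e : ℕ)
    (he : ¬ Subsingleton (E0 (Localization.AtPrime p)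
      (IsLocalRing.ResidueField (Localization.AtPrime p)) (Localization.AtPrime p) e))
    (S P : ℕ → Type) [∀ k, AddCommGroup (S k)]
    [∀ k, Module A (S k)] [∀ k, AddCommGroup (P k)] [∀ k, Module A (P k)]
    [∀ k, Module.Projective A (P k)] (ι : ∀ k, S (k+1) →ₗ[A] P k) (π : ∀ k, P k →ₗ[A] S k)
    (hex : ∀ k, Function.Exact (ι k) (π k)) (hi : ∀ k, Function.Injective (ι k))
    (hs : ∀ k, Function.Surjective (π k)) [Module.Finite A (S 0)] (T : ℕ)
    (hT : HasProjectiveDimensionLT (ModuleCat.of A (S 0)) (T+1)) (n : ℕ) (hn : e ≤ n)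
    (ih : ∀ k, n + 1 ≤ k → Function.Injective ((ι k).lTensor C)) :
    Function.Injective ((ι n).lTensor C) := by
  rw [← LinearMap.ker_eq_bot]
  by_contra hne
  have hnt : Nontrivial (LinearMap.ker ((ι n).lTensor C)) := Submodule.nontrivial_iff_ne_bot.mpr hne
  obtain ⟨q, hq⟩ := associatedPrimes.nonempty A (LinearMap.ker ((ι n).lTensor C))
  obtain ⟨hqp, ⟨w, hwk⟩, hw⟩ := isAssociatedPrime_iff.mp hq
  have hw' : ∀ a, a ∈ q ↔ a • w = 0 := by
    intro a; rw [hw, Submodule.mem_colon_singleton]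
    simp [Subtype.ext_iff]
  have hpq : p ≤ q := by
    intro a ha
    rw [hw']
    have : ∀ z : C ⊗[A] S (n+1), a • z = 0 := by
      intro z
      induction z with
      | zero => simp
      | add x y hx hy => rw [smul_add, hx, hy, add_zero]
      | tmul c s =>
        rw [TensorProduct.smul_tmul', ← algebraMap_smul (A ⧸ p) a c]
        have : algebraMap A (A ⧸ p) a = 0 := Ideal.Quotient.eq_zero_iff_mem.mpr ha
        rw [this, zero_smul, TensorProduct.zero_tmul]
    exact this w
  obtain ⟨xs, hxq, hht, hreg⟩ := params_q p q hpq C hloc hC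
  let M := q.primeCompl
  let Aq := Localization.AtPrime q
  let S' : ℕ → Type := fun k => LocalizedModule q.primeCompl (S k)
  let P' : ℕ → Type := fun k => LocalizedModule q.primeCompl (P k)
  let ι' : ∀ k, S' (k+1) →ₗ[Aq] P' k := fun k => LocalizedModule.map q.primeCompl (ι k)
  let π' : ∀ k, P' k →ₗ[Aq] S' k := fun k => LocalizedModule.map q.primeCompl (π k)
  have hi' : ∀ k, Function.Injective (ι' k) := fun k => LocalizedModule.map_injective _ _ (hi k)
  have hs' : ∀ k, Function.Surjective (π' k) := fun k => LocalizedModule.map_surjective _ _ (hs k)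
  have hex' : ∀ k, Function.Exact (ι' k) (π' k) := fun k => LocalizedModule.map_exact _ _ _ (hex k)
  have hpd : HasProjectiveDimensionLT (ModuleCat.of Aq (S' 0)) (e + xs.length + 1) :=
    pd_local p q hpq xs.length e hht he (S' 0) (T+1) (pd_localized q (S 0) T hT)
  have hproj : ∀ k, e + xs.length ≤ k → Module.Projective Aq (S' k) := fun k hk =>
    syz_proj S' P' ι' π' hex' hi' hs' _ hpd k hk
  have hflat : ∀ k, e + xs.length ≤ k → Module.Flat A (S' k) := fun k hk => by
    have := hproj k hk
    exact Module.Flat.trans A Aq (S' k)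
  have hflatP : ∀ k, Module.Flat A (P' k) := fun k => by
    have : Module.Projective Aq (P' k) := inferInstance
    exact Module.Flat.trans A Aq (P' k)
  let g : ∀ k, S k →ₗ[A] S' k := fun k => LocalizedModule.mkLinearMap q.primeCompl (S k)
  let gP : ∀ k, P k →ₗ[A] P' k := fun k => LocalizedModule.mkLinearMap q.primeCompl (P k)
  let ιA : ∀ k, S' (k+1) →ₗ[A] P' k := fun k => (ι' k).restrictScalars A
  let πA : ∀ k, P' k →ₗ[A] S' k := fun k => (π' k).restrictScalars A
  have hcomm : ∀ k, ιA k ∘ₗ g (k+1) = gP k ∘ₗ ι k := by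
    intro k; ext x
    exact LocalizedModule.map_mk (S := q.primeCompl) (ι k) x 1
  have hmap : ∀ k, IsLocalizedModule.map q.primeCompl ((g (k+1)).lTensor C) ((gP k).lTensor C)
      ((ι k).lTensor C) = (ιA k).lTensor C := by
    intro k
    apply IsLocalizedModule.linearMap_ext q.primeCompl ((g (k+1)).lTensor C) ((gP k).lTensor C)
    rw [IsLocalizedModule.map_comp, ← LinearMap.lTensor_comp, ← LinearMap.lTensor_comp, hcomm]
  have hinj : ∀ k, n + 1 ≤ k → Function.Injective ((ιA k).lTensor C) := by
    intro k hk
    rw [← hmap]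
    exact IsLocalizedModule.map_injective _ _ _ _ (ih k hk)
  have hw0 : (g (n+1)).lTensor C w ≠ 0 := by
    intro h0
    obtain ⟨c, hc⟩ := (IsLocalizedModule.eq_zero_iff q.primeCompl ((g (n+1)).lTensor C)).mp h0
    exact c.2 ((hw' _).mpr hc)
  have hwι : (ιA n).lTensor C ((g (n+1)).lTensor C w) = 0 := by
    rw [← LinearMap.comp_apply, ← LinearMap.lTensor_comp, hcomm, LinearMap.lTensor_comp,
      LinearMap.comp_apply, LinearMap.mem_ker.mp hwk, map_zero]
  rcases hlen : xs.length with _ | h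
  · have : Module.Projective Aq (S' n) := hproj n (by omega)
    obtain ⟨r, hr⟩ := retr (ι' n) (π' n) (hex' n) (hi' n) (hs' n)
    have := lTensor_inj_of_retr C (ιA n) (r.restrictScalars A) (by
      ext x; exact LinearMap.congr_fun hr x)
    exact hw0 (this (hwι.trans (map_zero _).symm))
  · have hfl : Module.Flat A (S' (n+1+h)) := hflat _ (by omega)
    have key := hom_zero C (fun k => S' (n+1+k)) (fun k => P' (n+1+k)) (fun k => ιA (n+1+k))
      (fun k => πA (n+1+k)) (fun k => hex' _) (fun k => hs' _) (fun k => hinj _ (by omega)) q xs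
      hxq hreg h hlen h 0 (by omega)
    exact hw0 (eq_zero_of_E0 q _ key _ (fun a ha => by rw [← map_smul, (hw' a).mp ha, map_zero]))

lemma core {A : Type} [CommRing A] [IsNoetherianRing A] [IsLocalRing A]
    (p : Ideal A) [p.IsPrime]
    (C : Type) [AddCommGroup C] [Module (A ⧸ p) C] [Module A C] [IsScalarTower A (A ⧸ p) C]
    (hloc : IsLocalRing (A ⧸ p))
    (hC : @IsBalancedBigCM (A ⧸ p) _ hloc C _ _) (e : ℕ)
    (he : ¬ Subsingleton (E0 (Localization.AtPrime p)
      (IsLocalRing.ResidueField (Localization.AtPrime p)) (Localization.AtPrime p) e))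
    (S P : ℕ → Type) [∀ k, AddCommGroup (S k)]
    [∀ k, Module A (S k)] [∀ k, AddCommGroup (P k)] [∀ k, Module A (P k)]
    [∀ k, Module.Projective A (P k)] (ι : ∀ k, S (k+1) →ₗ[A] P k) (π : ∀ k, P k →ₗ[A] S k)
    (hex : ∀ k, Function.Exact (ι k) (π k)) (hi : ∀ k, Function.Injective (ι k))
    (hs : ∀ k, Function.Surjective (π k)) [Module.Finite A (S 0)] (T : ℕ)
    (hT : HasProjectiveDimensionLT (ModuleCat.of A (S 0)) (T+1)) (n : ℕ) (hn : e ≤ n) :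
    Function.Injective ((ι n).lTensor C) := by
  have main : ∀ m n, e ≤ n → T ≤ n + m → Function.Injective ((ι n).lTensor C) := by
    intro m
    induction m with
    | zero =>
      intro n hn hTn
      have : Module.Projective A (S n) := syz_proj S P ι π hex hi hs T hT n (by omega)
      obtain ⟨r, hr⟩ := retr (ι n) (π n) (hex n) (hi n) (hs n)
      exact lTensor_inj_of_retr C _ r hr
    | succ m ih =>
      intro n hn hTn
      exact core_step p C hloc hC e he S P ι π hex hi hs T hT n hn
        (fun k hk => ih k (by omega) (by omega))
  exact main T n hn (by omega)
end

section
open TensorProduct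

lemma fpd_lt {A : Type} [CommRing A] (M : Type) [AddCommGroup M] [Module A M]
    (hpd : HasFinitePD A M) : ∃ T : ℕ, HasProjectiveDimensionLT (ModuleCat.of A M) (T+1) := by
  obtain ⟨T, hT⟩ := hpd
  refine ⟨T, HasProjectiveDimensionLT.mk.{1} fun i hi N e => ?_⟩
  have := hT i (by omega) N
  exact Subsingleton.elim _ _

lemma exists_nontrivial_of_depth {R : Type} [CommRing R] [IsLocalRing R] (n : ℕ)
    (hn : extDepth R R < (n : ℕ∞)) :
    ∃ e < n, ¬ Subsingleton (E0 R (IsLocalRing.ResidueField R) R e) := by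
  unfold extDepth at hn
  obtain ⟨m, ⟨i, rfl, hi⟩, hm⟩ := sInf_lt_iff.mp hn
  refine ⟨i, by exact_mod_cast hm, ?_⟩
  rw [← subsingleton_extGrp_iff, not_subsingleton_iff_nontrivial]
  exact hi

lemma range_quot {A : Type} [CommRing A] {X Y Z : Type} [AddCommGroup X] [Module A X]
    [AddCommGroup Y] [Module A Y] [AddCommGroup Z] [Module A Z] (f : X →ₗ[A] Y) (g : Y →ₗ[A] Z)
    (h : Function.Exact f g) : ∃ ι : (Y ⧸ LinearMap.range f) →ₗ[A] Z,
      ι ∘ₗ (LinearMap.range f).mkQ = g ∧ Function.Injective ι ∧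
      LinearMap.range ι = LinearMap.range g := by
  refine ⟨(LinearMap.range f).liftQ g (by
    rintro _ ⟨x, rfl⟩; exact h.apply_apply_eq_zero x), Submodule.liftQ_mkQ _ _ _, ?_,
    Submodule.range_liftQ _ _ _⟩
  rw [← LinearMap.ker_eq_bot, Submodule.ker_liftQ, h.linearMap_ker_eq]
  exact Submodule.mkQ_map_self _

lemma tor_main {A : Type} [CommRing A] [IsNoetherianRing A] [IsLocalRing A]
    (M : Type) [AddCommGroup M] [Module A M] [Module.Finite A M] (T : ℕ)
    (hT : HasProjectiveDimensionLT (ModuleCat.of A M) (T+1))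
    (p : Ideal A) [p.IsPrime]
    (C : Type) [AddCommGroup C] [Module (A ⧸ p) C] [Module A C] [IsScalarTower A (A ⧸ p) C]
    (hloc : IsLocalRing (A ⧸ p))
    (hC : @IsBalancedBigCM (A ⧸ p) _ hloc C _ _) (e : ℕ)
    (he : ¬ Subsingleton (E0 (Localization.AtPrime p)
      (IsLocalRing.ResidueField (Localization.AtPrime p)) (Localization.AtPrime p) e))
    (n : ℕ) (hn : e ≤ n) :
    Subsingleton (((Tor (ModuleCat.{0} A) (n+1)).obj (ModuleCat.of A C)).obj (ModuleCat.of A M)) := by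
  let Q := projectiveResolution (ModuleCat.of A M)
  let P : ℕ → Type := fun k => Q.complex.X k
  have hproj : ∀ k, Module.Projective A (P k) := fun k =>
    (IsProjective.iff_projective (R:=A) (P k)).mpr (Q.projective k)
  let d : ∀ k, P (k+1) →ₗ[A] P k := fun k => (Q.complex.d (k+1) k).hom
  have hd : ∀ k, Function.Exact (d (k+1)) (d k) := fun k => by
    have := Q.exact_succ k
    rw [ShortComplex.ShortExact.moduleCat_exact_iff_function_exact] at this
    exact this
  let S : ℕ → Type := fun k => P k ⧸ LinearMap.range (d k)
  let π : ∀ k, P k →ₗ[A] S k := fun k => (LinearMap.range (d k)).mkQ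
  choose ι hιπ hιi hιr using fun k => range_quot (d (k+1)) (d k) (hd k)
  have hs : ∀ k, Function.Surjective (π k) := fun k => Submodule.mkQ_surjective _
  have hex : ∀ k, Function.Exact (ι k) (π k) := fun k => by
    rw [LinearMap.exact_iff, hιr, Submodule.ker_mkQ]
  -- augmentation
  let ε : P 0 →ₗ[A] M := (Q.π.f 0).hom
  have hε : Function.Surjective ε := (ModuleCat.epi_iff_surjective (Q.π.f 0)).mp inferInstance
  have hε' : Function.Exact (d 0) ε := by
    have h1 : (ShortComplex.mk _ _ Q.complex_d_comp_π_f_zero).Exact :=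
      ShortComplex.exact_of_g_is_cokernel _ Q.isColimitCokernelCofork
    rw [ShortComplex.ShortExact.moduleCat_exact_iff_function_exact] at h1
    exact h1
  obtain ⟨φ, hφ, hφi, hφr⟩ := range_quot (d 0) ε hε'
  have hφs : Function.Surjective φ := by
    rw [← LinearMap.range_eq_top, hφr, LinearMap.range_eq_top]; exact hε
  let eq : S 0 ≃ₗ[A] M := LinearEquiv.ofBijective φ ⟨hφi, hφs⟩
  have hfin : Module.Finite A (S 0) := Module.Finite.equiv eq.symm
  have hT' : HasProjectiveDimensionLT (ModuleCat.of A (S 0)) (T+1) := 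
    hasProjectiveDimensionLT_of_iso (eq.symm.toModuleIso) (T+1)
  have key := core p C hloc hC e he S P ι π hex hιi hs T hT' n hn
  have hex2 : Function.Exact ((d (n+1)).lTensor C) ((d n).lTensor C) := by
    rw [← hιπ n, LinearMap.lTensor_comp]
    have h1 : Function.Exact (d (n+1)) (π (n+1)) := by
      rw [LinearMap.exact_iff, Submodule.ker_mkQ]
    have h2 := lTensor_exact C h1 (hs (n+1))
    exact h2.comp_injective _ key (map_zero _)
  let F := (MonoidalCategory.tensoringLeft (ModuleCat.{0} A)).obj (ModuleCat.of A C)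
  have hEx : (((F.mapHomologicalComplex _).obj Q.complex)).ExactAt (n+1) := by
    rw [HomologicalComplex.exactAt_iff' _ (n+2) (n+1) n (by simp) (by simp)]
    rw [ShortComplex.ShortExact.moduleCat_exact_iff_function_exact]
    exact hex2
  have hz : IsZero ((F.leftDerived (n+1)).obj (ModuleCat.of A M)) :=
    (hEx.isZero_homology).of_iso (Q.isoLeftDerivedObj F (n+1))
  exact ModuleCat.subsingleton_of_isZero hz
end

end

/-- **Theorem 6.** If `M` is a finitely generated `A`-module of finite
projective dimension, `p` a prime, and `C` a balanced big Cohen-Macaulay module over `A/p`,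
then `Tor^A_n(C, M) = 0` for all `n > depth A_p`. -/
theorem tor_subsingleton_of_balancedBigCM
    (A : Type) [CommRing A] [IsNoetherianRing A] [IsLocalRing A]
    (M : Type) [AddCommGroup M] [Module A M] [Module.Finite A M]
    (hpd : HasFinitePD A M)
    (p : Ideal A) [p.IsPrime]
    (C : Type) [AddCommGroup C] [Module (A ⧸ p) C] [Module A C] [IsScalarTower A (A ⧸ p) C]
    (hloc : IsLocalRing (A ⧸ p))
    (hC : @IsBalancedBigCM (A ⧸ p) _ hloc C _ _)
    (n : ℕ)
    (hn : extDepth (Localization.AtPrime p) (Localization.AtPrime p) < (n : ℕ∞)) :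
    Subsingleton (((Tor (ModuleCat.{0} A) n).obj (ModuleCat.of A C)).obj (ModuleCat.of A M)) := by
  obtain ⟨T, hT⟩ := fpd_lt M hpd
  obtain ⟨e, hen, he⟩ := exists_nontrivial_of_depth n hn
  obtain ⟨n, rfl⟩ : ∃ m, n = m + 1 := ⟨n - 1, by omega⟩
  exact tor_main M T hT p C hloc hC e he n (by omega)
end
end

section
/- Let R be a Gorenstein local ring and M a finitely generated R-module. Then M is a first syzygy (i.e., embeds in a finitely generated free module) if and only if Ass M ⊆ Ass R. -/
open CategoryTheory

noncomputable section

/-- A (noetherian) local ring is Gorenstein if it has finite injective dimension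
as a module over itself. -/
def IsGorensteinLocal (R : Type) [CommRing R] [IsLocalRing R] : Prop :=
  HasFiniteInjDim R R

section Helpers

open Abelian

lemma aux_shortExact {R : Type} [CommRing R] {A B C : Type} [AddCommGroup A] [Module R A]
    [AddCommGroup B] [Module R B] [AddCommGroup C] [Module R C]
    (f : A →ₗ[R] B) (g : B →ₗ[R] C) (hf : Function.Injective f) (hg : Function.Surjective g)
    (hfg : Function.Exact f g) :
    (ShortComplex.mk (ModuleCat.ofHom f) (ModuleCat.ofHom g)
      (by rw [← ModuleCat.ofHom_comp, hfg.linearMap_comp_eq_zero]; rfl)).ShortExact where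
  exact := (ShortComplex.ShortExact.moduleCat_exact_iff_function_exact _).mpr hfg
  mono_f := (ModuleCat.mono_iff_injective _).mpr hf
  epi_g := (ModuleCat.epi_iff_surjective _).mpr hg

/-- `s` kills `Ext^n(A, R)`. -/
def AuxKills (R : Type) [CommRing R] (s : R) (A : Type) [AddCommGroup A] [Module R A]
    (n : ℕ) : Prop :=
  ∀ e : Ext.{1} (ModuleCat.of R A) (ModuleCat.of R R) n, s • e = 0

lemma aux_mid {R : Type} [CommRing R] {A B C : Type} [AddCommGroup A] [Module R A]
    [AddCommGroup B] [Module R B] [AddCommGroup C] [Module R C]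
    (f : A →ₗ[R] B) (g : B →ₗ[R] C) (hf : Function.Injective f) (hg : Function.Surjective g)
    (hfg : Function.Exact f g) {s t : R} {n : ℕ} (hs : AuxKills R s A n)
    (ht : AuxKills R t C n) : AuxKills R (t * s) B n := by
  intro e
  obtain ⟨x, hx⟩ := Ext.contravariant_sequence_exact₂ (aux_shortExact f g hf hg hfg)
    (ModuleCat.of R R) (s • e) (by rw [Ext.comp_smul]; exact hs _)
  rw [mul_smul, ← hx, ← Ext.comp_smul]
  have := ht x
  erw [this]
  simp

lemma aux_emb {R : Type} [CommRing R] {A C : Type} [AddCommGroup A] [Module R A]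
    [AddCommGroup C] [Module R C]
    (f : A →ₗ[R] R) (g : R →ₗ[R] C) (hf : Function.Injective f) (hg : Function.Surjective g)
    (hfg : Function.Exact f g) {s : R} {n : ℕ}
    (hs : AuxKills R s C (n + 2)) : AuxKills R s A (n + 1) := by
  intro e
  obtain ⟨x, hx⟩ := Ext.contravariant_sequence_exact₁ (aux_shortExact f g hf hg hfg)
    (ModuleCat.of R R) (s • e) (n₁ := n + 2) (by omega) (by rw [Ext.comp_smul]; exact hs _)
  have hx0 : x = 0 := by
    have : Projective (ModuleCat.of R R) := inferInstance
    exact Ext.eq_zero_of_projective (P := ModuleCat.of R R) x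
  rw [← hx, hx0]
  simp

lemma aux_lift {R : Type} [CommRing R] {A B C : Type} [AddCommGroup A] [Module R A]
    [AddCommGroup B] [Module R B] [AddCommGroup C] [Module R C]
    (f : A →ₗ[R] B) (g : B →ₗ[R] C) (hf : Function.Injective f) (hg : Function.Surjective g)
    (hfg : Function.Exact f g) {s : R} {n : ℕ}
    (hs : AuxKills R s C (n + 1)) (e : Ext.{1} (ModuleCat.of R A) (ModuleCat.of R R) n) :
    ∃ x : Ext.{1} (ModuleCat.of R B) (ModuleCat.of R R) n,
      (Ext.mk₀ (ModuleCat.ofHom f)).comp x (zero_add n) = s • e :=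
  Ext.contravariant_sequence_exact₁ (aux_shortExact f g hf hg hfg)
    (ModuleCat.of R R) (s • e) (n₁ := n + 1) (by omega) (by rw [Ext.comp_smul]; exact hs _)

lemma aux_smul {R : Type} [CommRing R] {A : Type} [AddCommGroup A] [Module R A] (r : R) (n : ℕ)
    (e : Ext.{1} (ModuleCat.of R A) (ModuleCat.of R R) n) :
    (Ext.mk₀ (ModuleCat.ofHom (r • (LinearMap.id : A →ₗ[R] A)))).comp e (zero_add n) = r • e := by
  have : ModuleCat.ofHom (r • (LinearMap.id : A →ₗ[R] A)) = r • 𝟙 (ModuleCat.of R A) := rfl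
  rw [this, Ext.mk₀_smul, Ext.smul_comp]
  simp

lemma aux_ann {R : Type} [CommRing R] {A : Type} [AddCommGroup A] [Module R A] (r : R) (n : ℕ)
    (hr : ∀ a : A, r • a = 0) : AuxKills R r A n := by
  intro e
  have h0 : r • (LinearMap.id : A →ₗ[R] A) = 0 := by ext a; simpa using hr a
  rw [← aux_smul, h0, ModuleCat.ofHom_zero]
  simp

lemma aux_finite {R : Type} [CommRing R] [IsNoetherianRing R] (n : ℕ) :
    ∀ (A : Type) [AddCommGroup A] [Module R A] [Module.Finite R A],
    Module.Finite R (Ext.{1} (ModuleCat.of R A) (ModuleCat.of R R) n) := by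
  induction n with
  | zero =>
    intro A _ _ _
    exact Module.Finite.equiv (Ext.linearEquiv₀.trans ModuleCat.homLinearEquiv).symm
  | succ n ih =>
    intro A _ _ _
    obtain ⟨k, f, hf⟩ := Module.Finite.exists_fin' R A
    have hS := aux_shortExact (LinearMap.ker f).subtype f (Subtype.val_injective) hf
      (LinearMap.exact_subtype_ker_map f)
    have := ih (LinearMap.ker f)
    refine Module.Finite.of_surjective
      (hS.extClass.precompOfLinear R (ModuleCat.of R R) (add_comm 1 n)) ?_
    intro x
    have : Projective (ModuleCat.of R (Fin k → R)) := inferInstance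
    exact Ext.contravariant_sequence_exact₃ hS _ x
      (Ext.eq_zero_of_projective (P := ModuleCat.of R (Fin k → R)) _) (add_comm 1 n)

lemma aux_nak {R : Type} [CommRing R] {E : Type*} [AddCommGroup E] [Module R E]
    [Module.Finite R E] (p : Ideal R) [hp : p.IsPrime] (x s : R) (hx : x ∈ p) (hs : s ∉ p)
    (h : ∀ e : E, ∃ y : E, x • y = s • e) : ∃ t, t ∉ p ∧ ∀ e : E, t • e = 0 := by
  obtain ⟨P, hP, -, hc, ha⟩ :=
    LinearMap.exists_monic_and_natDegree_eq_and_coeff_mem_pow_and_aeval_eq_zero R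
      (algebraMap R (Module.End R E) s) (Ideal.span {x}) (by
        rintro _ ⟨e, rfl⟩
        obtain ⟨y, hy⟩ := h e
        rw [Module.algebraMap_end_apply, ← hy]
        exact Submodule.smul_mem_smul (Ideal.mem_span_singleton_self x) trivial)
  refine ⟨P.eval s, ?_, ?_⟩
  · intro hmem
    have hle : Ideal.span {x} ≤ p := by simpa [Ideal.span_le] using hx
    have hmap : P.map (Ideal.Quotient.mk p) = Polynomial.X ^ P.natDegree := by
      ext k
      rw [Polynomial.coeff_map, Polynomial.coeff_X_pow]
      split_ifs with hk
      · rw [hk, hP.coeff_natDegree, map_one]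
      · rcases lt_or_gt_of_ne hk with hk | hk
        · rw [Ideal.Quotient.eq_zero_iff_mem]
          exact hle (Ideal.pow_le_self (by omega) (hc k))
        · rw [Polynomial.coeff_eq_zero_of_natDegree_lt hk, map_zero]
    have h1 : (P.map (Ideal.Quotient.mk p)).eval (Ideal.Quotient.mk p s) = 0 := by
      rw [Polynomial.eval_map, Polynomial.eval₂_hom, Ideal.Quotient.eq_zero_iff_mem]
      exact hmem
    rw [hmap, Polynomial.eval_pow, Polynomial.eval_X, ← map_pow,
      Ideal.Quotient.eq_zero_iff_mem] at h1
    exact hs (hp.mem_of_pow_mem _ h1)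
  · intro e
    rw [Polynomial.aeval_algebraMap_apply] at ha
    have := LinearMap.congr_fun ha e
    simpa using this

lemma aux_step {R : Type} [CommRing R] [IsNoetherianRing R] (p : Ideal R) [hp : p.IsPrime]
    (φ : R ⧸ p →ₗ[R] R) (hφ : Function.Injective φ) (n : ℕ)
    (H : ∀ (N : Type) [AddCommGroup N] [Module R N] [Module.Finite R N],
      ∃ s, s ∉ p ∧ AuxKills R s N (n + 2))
    (N : Type) [AddCommGroup N] [Module R N] [hN : Module.Finite R N] :
      ∃ s, s ∉ p ∧ AuxKills R s N (n + 1) := by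
  induction hN using IsNoetherianRing.induction_on_isQuotientEquivQuotientPrime R with
  | subsingleton N =>
    exact ⟨1, fun h => hp.ne_top ((Ideal.eq_top_iff_one p).mpr h),
      aux_ann 1 _ fun a => Subsingleton.elim _ _⟩
  | quotient N q f =>
    by_cases h1 : q.1 ≤ p
    · by_cases h2 : p ≤ q.1
      · have hq : q.1 = p := le_antisymm h1 h2
        let ψ : N →ₗ[R] R := φ ∘ₗ (f.trans (Submodule.quotEquivOfEq _ _ hq)).toLinearMap
        have hψ : Function.Injective ψ := hφ.comp (LinearEquiv.injective _)
        obtain ⟨s, hs, hk⟩ := H (R ⧸ LinearMap.range ψ)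
        exact ⟨s, hs, aux_emb ψ (LinearMap.range ψ).mkQ hψ (Submodule.mkQ_surjective _)
          (LinearMap.exact_map_mkQ_range ψ) hk⟩
      · obtain ⟨x, hxp, hxq⟩ := Set.not_subset.mp h2
        let ψ : N →ₗ[R] N := x • LinearMap.id
        have hψ : Function.Injective ψ := by
          rw [injective_iff_map_eq_zero]
          intro a ha
          have h3 : x • f a = 0 := by rw [← map_smul]; exact (congrArg f ha).trans (map_zero f)
          obtain ⟨b, hb⟩ := Ideal.Quotient.mk_surjective (f a)
          have h4 : x * b ∈ q.1 := by
            rw [← Ideal.Quotient.eq_zero_iff_mem, ← h3, ← hb]; rfl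
          have h5 : b ∈ q.1 := (q.2.mem_or_mem h4).resolve_left hxq
          apply f.injective
          rw [map_zero, ← hb, Ideal.Quotient.eq_zero_iff_mem]
          exact h5
        obtain ⟨s, hs, hk⟩ := H (N ⧸ LinearMap.range ψ)
        have := aux_finite (R := R) (n + 1) N
        refine aux_nak p x s hxp hs fun e => ?_
        obtain ⟨y, hy⟩ := aux_lift ψ (LinearMap.range ψ).mkQ hψ (Submodule.mkQ_surjective _)
          (LinearMap.exact_map_mkQ_range ψ) hk e
        exact ⟨y, by rw [← hy]; exact (aux_smul x _ y).symm⟩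
    · obtain ⟨x, hxq, hxp⟩ := Set.not_subset.mp h1
      refine ⟨x, hxp, aux_ann x _ fun a => f.injective ?_⟩
      obtain ⟨b, hb⟩ := Ideal.Quotient.mk_surjective (f a)
      rw [map_smul, map_zero, ← hb]
      exact Ideal.Quotient.eq_zero_iff_mem.mpr (Ideal.mul_mem_right b _ hxq)
  | exact N₁ N₂ N₃ f g hf hg hfg h₁ h₃ =>
    obtain ⟨s, hs, hs'⟩ := h₁
    obtain ⟨t, ht, ht'⟩ := h₃
    exact ⟨t * s, hp.mul_notMem ht hs, aux_mid f g hf hg hfg hs' ht'⟩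

lemma aux_one {R : Type} [CommRing R] [IsNoetherianRing R] (p : Ideal R) [hp : p.IsPrime]
    (φ : R ⧸ p →ₗ[R] R) (hφ : Function.Injective φ) (n : ℕ)
    (H : ∀ (N : Type) [AddCommGroup N] [Module R N] [Module.Finite R N],
      ∃ s, s ∉ p ∧ AuxKills R s N (n + 1)) :
    ∀ (N : Type) [AddCommGroup N] [Module R N] [Module.Finite R N],
      ∃ s, s ∉ p ∧ AuxKills R s N 1 := by
  induction n with
  | zero => exact H
  | succ n ih => exact ih fun N _ _ _ => aux_step p φ hφ n H N

lemma aux_main_s12 {R : Type} [CommRing R] [IsNoetherianRing R] [IsLocalRing R]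
    (hGor : IsGorensteinLocal R) (M : Type) [AddCommGroup M] [Module R M] [Module.Finite R M]
    (p : Ideal R) [hp : p.IsPrime] (φ : R ⧸ p →ₗ[R] R) (hφ : Function.Injective φ)
    (f : R ⧸ p →ₗ[R] M) (hf : Function.Injective f) :
    ∃ h : M →ₗ[R] R, h (f 1) ≠ 0 := by
  obtain ⟨n, hn⟩ := hGor
  have H1 := aux_one p φ hφ n fun N _ _ _ =>
    ⟨1, fun h => hp.ne_top ((Ideal.eq_top_iff_one p).mpr h), fun e =>
      (hn (n + 1) (Nat.lt_succ_self n) (ModuleCat.of R N)).elim _ _⟩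
  obtain ⟨s, hs, hk⟩ := H1 (M ⧸ LinearMap.range f)
  obtain ⟨y, hy⟩ := aux_lift f (LinearMap.range f).mkQ hf (Submodule.mkQ_surjective _)
          (LinearMap.exact_map_mkQ_range f) hk (Ext.mk₀ (ModuleCat.ofHom φ))
  obtain ⟨h, rfl⟩ := (Ext.mk₀_bijective _ _).2 y
  rw [Ext.mk₀_comp_mk₀, ← Ext.mk₀_smul, (Ext.mk₀_bijective _ _).1.eq_iff] at hy
  refine ⟨h.hom, fun h0 => hs ?_⟩
  have h1 : h.hom (f 1) = s • φ 1 := congrArg (fun k => k.hom (1 : R ⧸ p)) hy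
  rw [h0, ← map_smul] at h1
  have h2 := hφ (h1.symm.trans (map_zero φ).symm)
  rw [← Ideal.Quotient.eq_zero_iff_mem, ← h2, Algebra.smul_def, mul_one]
  rfl

lemma aux_pi {R : Type} [CommRing R] (n : ℕ) :
    associatedPrimes R (Fin n → R) ⊆ associatedPrimes R R := by
  induction n with
  | zero => rw [associatedPrimes.eq_empty_of_subsingleton]; exact Set.empty_subset _
  | succ n ih =>
    rw [LinearEquiv.AssociatedPrimes.eq (Fin.consLinearEquiv R (fun _ : Fin (n+1) => R)).symm,
      associatedPrimes.prod]
    exact Set.union_subset subset_rfl ih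

end Helpers

/-- Over a Gorenstein local ring, a finitely generated module is a first
syzygy (embeds in a finitely generated free module) iff `Ass M ⊆ Ass R`. -/
theorem syzygy_iff_ass_subset
    (R : Type) [CommRing R] [IsNoetherianRing R] [IsLocalRing R]
    (hGor : IsGorensteinLocal R)
    (M : Type) [AddCommGroup M] [Module R M] [Module.Finite R M] :
    (∃ (n : ℕ) (f : M →ₗ[R] (Fin n → R)), Function.Injective f) ↔
      associatedPrimes R M ⊆ associatedPrimes R R := by
  constructor
  · rintro ⟨n, f, hf⟩
    exact (associatedPrimes.subset_of_injective hf).trans (aux_pi n)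
  · intro hA
    obtain ⟨n, g, hg⟩ := Module.Finite.exists_fin (R := R) (M := M →ₗ[R] R)
    refine ⟨n, LinearMap.pi g, ?_⟩
    rw [← LinearMap.ker_eq_bot]
    by_contra hK
    have : Nontrivial (LinearMap.ker (LinearMap.pi g)) :=
      (Submodule.nontrivial_iff_ne_bot).mpr hK
    obtain ⟨p, hpK⟩ := associatedPrimes.nonempty R (LinearMap.ker (LinearMap.pi g))
    have hpR := hA (associatedPrimes.subset_of_injective
      (f := (LinearMap.ker (LinearMap.pi g)).subtype) Subtype.val_injective hpK)
    obtain ⟨hp, f, hf⟩ := (isAssociatedPrime_iff_exists_injective_linearMap ..).mp hpK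
    obtain ⟨-, φ, hφ⟩ := (isAssociatedPrime_iff_exists_injective_linearMap ..).mp hpR
    obtain ⟨h, hh⟩ := aux_main_s12 hGor M p φ hφ ((LinearMap.ker (LinearMap.pi g)).subtype ∘ₗ f)
      (Subtype.val_injective.comp hf)
    apply hh
    have hmem : h ∈ Submodule.span R (Set.range g) := hg ▸ Submodule.mem_top
    have hz : ∀ i, g i (f 1 : M) = 0 := fun i => congrFun (LinearMap.mem_ker.mp (f 1).2) i
    have hle : Submodule.span R (Set.range g) ≤
        LinearMap.ker (LinearMap.applyₗ (R := R) (M₂ := R) (f 1 : M)) := by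
      rw [Submodule.span_le]
      rintro _ ⟨i, rfl⟩
      exact hz i
    exact hle hmem
end
end

section
/- Let R be a Gorenstein local ring and b a proper ideal of R. Then R/b embeds into a finitely generated free R-module (equivalently b is an annihilator ideal, b = Ann a for some ideal a) if and only if b consists of zerodivisors and is unmixed (all associated primes of R/b lie in Ass R). -/
open CategoryTheory

noncomputable section

open Abelian in
theorem finite_ext_aux (R : Type) [CommRing R] [IsNoetherianRing R] (N M : ModuleCat.{0} R)
    [Module.Finite R N] [Module.Finite R M] (i : ℕ) : Module.Finite R (Ext.{1} N M i) := by
  induction i generalizing N with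
  | zero => exact Module.Finite.equiv (Ext.linearEquiv₀.trans ModuleCat.homLinearEquiv).symm
  | succ n ih =>
    obtain ⟨N, _, _, _, _, f, surjf⟩ := Module.exists_finite_presentation R N
    let exac := LinearMap.shortExact_shortComplexKer surjf
    exact Module.Finite.of_surjective (exac.extClass.precompOfLinear R M (add_comm 1 n))
      (fun x ↦ Ext.contravariant_sequence_exact₃ exac M x (Ext.eq_zero_of_projective _)
        (add_comm 1 n))

/-- The short exact sequence attached to an exact pair of linear maps. -/
theorem shortExact_aux {R : Type} [CommRing R] {A B C : Type} [AddCommGroup A] [Module R A]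
    [AddCommGroup B] [Module R B] [AddCommGroup C] [Module R C] (f : A →ₗ[R] B) (g : B →ₗ[R] C)
    (hf : Function.Injective f) (hg : Function.Surjective g) (h : Function.Exact f g) :
    (ShortComplex.moduleCatMk f g h.linearMap_comp_eq_zero).ShortExact where
  exact := (ShortComplex.ShortExact.moduleCat_exact_iff_function_exact _).2 h
  mono_f := (ModuleCat.mono_iff_injective _).2 hf
  epi_g := (ModuleCat.epi_iff_surjective _).2 hg

/-- The localized vanishing property. -/
def VanAt {R : Type} [CommRing R] (p : Ideal R) (i : ℕ) (N : ModuleCat.{0} R) : Prop :=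
  ∀ e : Abelian.Ext.{1} N (ModuleCat.of R R) i, ∃ s, s ∉ p ∧ s • e = 0

theorem nak_aux {R : Type} [CommRing R] {E : Type 1} [AddCommGroup E] [Module R E]
    [Module.Finite R E] (p : Ideal R) [hp : p.IsPrime] (x : R) (hx : x ∈ p)
    (h : ∀ e : E, ∃ s, s ∉ p ∧ ∃ e' : E, s • e = x • e') (e : E) : ∃ s, s ∉ p ∧ s • e = 0 := by
  classical
  obtain ⟨T, hT⟩ := (Module.Finite.fg_top : (⊤ : Submodule R E).FG)
  choose s hs e' he' using h
  let t := ∏ a ∈ T, s a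
  have ht : t ∉ p := by
    intro hh
    obtain ⟨a, ha, h2⟩ := (Ideal.IsPrime.prod_mem_iff).1 hh
    exact hs a h2
  have hr : LinearMap.range (algebraMap R (Module.End R E) t) ≤ p • ⊤ := by
    rw [LinearMap.range_eq_map, ← hT, Submodule.map_span, Submodule.span_le]
    rintro _ ⟨a, ha, rfl⟩
    have ha' : a ∈ T := ha
    have : (algebraMap R (Module.End R E) t) a = x • ((∏ b ∈ T.erase a, s b) • e' a) := by
      rw [Module.algebraMap_end_apply]
      simp only [t]
      rw [← Finset.prod_erase_mul T s ha', mul_smul, he', smul_comm]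
    rw [this, hT]
    exact Submodule.smul_mem_smul hx trivial
  obtain ⟨P, hP, -, hc, h0⟩ :=
    LinearMap.exists_monic_and_natDegree_eq_and_coeff_mem_pow_and_aeval_eq_zero R _ p hr
  rw [Polynomial.aeval_algebraMap_apply] at h0
  refine ⟨P.eval t, ?_, ?_⟩
  · rw [Polynomial.eval_eq_sum_range, Finset.sum_range_succ, hP.coeff_natDegree, one_mul]
    intro hh
    have h1 : ∑ i ∈ Finset.range P.natDegree, P.coeff i * t ^ i ∈ p := by
      refine Ideal.sum_mem _ fun i hi => Ideal.mul_mem_right _ _ ?_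
      have := hc i
      exact Ideal.pow_le_self (by have := Finset.mem_range.1 hi; omega) this
    have h2 := (Ideal.add_mem_iff_right _ h1).1 hh
    exact ht (hp.mem_of_pow_mem _ h2)
  · have := LinearMap.congr_fun h0 e
    simpa [Module.algebraMap_end_apply, Polynomial.aeval_def] using this

open Abelian in
theorem vanAt_iso {R : Type} [CommRing R] (p : Ideal R) (i : ℕ) {A B : Type} [AddCommGroup A]
    [Module R A] [AddCommGroup B] [Module R B] (f : A ≃ₗ[R] B)
    (h : VanAt p i (ModuleCat.of R B)) : VanAt p i (ModuleCat.of R A) := by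
  intro e
  obtain ⟨s, hs, h0⟩ := h ((Ext.mk₀ f.toModuleIso.inv).comp e (zero_add i))
  refine ⟨s, hs, ?_⟩
  have : (Ext.mk₀ f.toModuleIso.hom).comp
      (s • (Ext.mk₀ f.toModuleIso.inv).comp e (zero_add i)) (zero_add i) = s • e := by
    rw [Ext.comp_smul, Ext.mk₀_comp_mk₀_assoc, Iso.hom_inv_id, Ext.mk₀_id_comp]
  rw [← this, h0, Ext.comp_zero]

open Abelian in
theorem vanAt_step {R : Type} [CommRing R] [IsNoetherianRing R] (p : Ideal R) [hp : p.IsPrime]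
    (ι : R ⧸ p →ₗ[R] R) (hι : Function.Injective ι) (i : ℕ) (hi : 1 ≤ i)
    (H : ∀ (N : Type) [AddCommGroup N] [Module R N] [Module.Finite R N],
      VanAt p (i + 1) (ModuleCat.of R N))
    (N : Type) [AddCommGroup N] [Module R N] [Module.Finite R N] :
      VanAt p i (ModuleCat.of R N) := by
  refine IsNoetherianRing.induction_on_isQuotientEquivQuotientPrime R (M := N) inferInstance
    (motive := fun N _ _ _ => VanAt p i (ModuleCat.of R N)) ?_ ?_ ?_
  · intro N _ _ _ _ e
    refine ⟨1, hp.one_notMem, ?_⟩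
    rw [one_smul]
    have : (𝟙 (ModuleCat.of R N)) = 0 := by
      ext x; exact Subsingleton.elim (α := N) _ _
    rw [← Ext.mk₀_id_comp e, this, Ext.mk₀_zero, Ext.zero_comp]
  · intro N _ _ _ q f
    refine vanAt_iso p i f ?_
    by_cases hqp : q.1 ≤ p
    · rcases eq_or_lt_of_le hqp with heq | hlt
      · rw [heq]
        intro e
        have S := shortExact_aux ι (LinearMap.range ι).mkQ hι (Submodule.mkQ_surjective _)
          (LinearMap.exact_map_mkQ_range ι)
        obtain ⟨s, hs, h0⟩ := H (R ⧸ LinearMap.range ι) (S.extClass.comp e (add_comm 1 i))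
        refine ⟨s, hs, ?_⟩
        obtain ⟨e2, he2⟩ := Ext.contravariant_sequence_exact₁ S (ModuleCat.of R R) (s • e)
          (add_comm 1 i) ((Ext.comp_smul _ _ _ s).trans h0)
        obtain ⟨j, rfl⟩ : ∃ j, i = j + 1 := ⟨i - 1, by omega⟩
        have : Projective (ShortComplex.moduleCatMk ι (LinearMap.range ι).mkQ
          (LinearMap.exact_map_mkQ_range ι).linearMap_comp_eq_zero).X₂ :=
          ModuleCat.projective_of_free (M := ModuleCat.of R R) (Module.Basis.singleton Unit R)
        rw [← he2, Ext.eq_zero_of_projective e2, Ext.comp_zero]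
        rfl
      · obtain ⟨x, hxp, hxq⟩ := SetLike.exists_of_lt hlt
        have := finite_ext_aux R (ModuleCat.of R (R ⧸ q.1)) (ModuleCat.of R R) i
        refine nak_aux p x hxp ?_
        intro e
        let m : (R ⧸ q.1) →ₗ[R] (R ⧸ q.1) := LinearMap.lsmul R _ x
        have hm : Function.Injective m := by
          have := q.2
          rw [injective_iff_map_eq_zero]
          intro a ha
          obtain ⟨a, rfl⟩ := Ideal.Quotient.mk_surjective a
          have h1 : Ideal.Quotient.mk q.1 (x * a) = 0 := ha
          rw [Ideal.Quotient.eq_zero_iff_mem] at h1 ⊢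
          exact (q.2.mem_or_mem h1).resolve_left hxq
        have S := shortExact_aux m (LinearMap.range m).mkQ hm (Submodule.mkQ_surjective _)
          (LinearMap.exact_map_mkQ_range m)
        obtain ⟨s, hs, h0⟩ := H ((R ⧸ q.1) ⧸ LinearMap.range m)
          (S.extClass.comp e (add_comm 1 i))
        refine ⟨s, hs, ?_⟩
        obtain ⟨e2, he2⟩ := Ext.contravariant_sequence_exact₁ S (ModuleCat.of R R) (s • e)
          (add_comm 1 i) ((Ext.comp_smul _ _ _ s).trans h0)
        refine ⟨e2, ?_⟩
        rw [← he2]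
        have : (ShortComplex.moduleCatMk m (LinearMap.range m).mkQ
          (LinearMap.exact_map_mkQ_range m).linearMap_comp_eq_zero).f =
            x • 𝟙 (ModuleCat.of R (R ⧸ q.1)) := rfl
        rw [this]
        refine (congrArg (fun z => Ext.comp z e2 (zero_add i)) (Ext.mk₀_smul x _)).trans ?_
        rw [Ext.smul_comp]
        exact congrArg (x • ·) (Ext.mk₀_id_comp e2)
    · obtain ⟨s, hsq, hsp⟩ := Set.not_subset.1 hqp
      intro e
      refine ⟨s, hsp, ?_⟩
      have : s • (𝟙 (ModuleCat.of R (R ⧸ q.1))) = 0 := by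
        ext
        change s • (Ideal.Quotient.mk q.1 1) = 0
        change Ideal.Quotient.mk q.1 (s * 1) = 0
        rw [mul_one]
        exact Ideal.Quotient.eq_zero_iff_mem.2 hsq
      rw [← Ext.mk₀_id_comp e, ← Ext.smul_comp, ← Ext.mk₀_smul, this, Ext.mk₀_zero, Ext.zero_comp]
  · intro N₁ _ _ _ N₂ _ _ _ N₃ _ _ _ f g hf hg hfg h1 h3 e
    have S := shortExact_aux f g hf hg hfg
    obtain ⟨s, hs, hs0⟩ := h1 ((Ext.mk₀ (ModuleCat.ofHom f)).comp e (zero_add i))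
    obtain ⟨e3, he3⟩ := Ext.contravariant_sequence_exact₂ S (ModuleCat.of R R) (s • e)
      ((Ext.comp_smul _ _ _ s).trans hs0)
    obtain ⟨t, ht, ht0⟩ := h3 e3
    refine ⟨t * s, fun h => (hp.mem_or_mem h).elim ht hs, ?_⟩
    rw [mul_smul, ← he3]
    refine (Ext.comp_smul _ _ _ t).symm.trans ?_
    exact (congrArg (fun z => Ext.comp _ z (zero_add i)) ht0).trans (Ext.comp_zero ..)

theorem vanAt_all {R : Type} [CommRing R] [IsNoetherianRing R] (p : Ideal R) [hp : p.IsPrime]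
    (ι : R ⧸ p →ₗ[R] R) (hι : Function.Injective ι) (hG : HasFiniteInjDim R R)
    (N : Type) [AddCommGroup N] [Module R N] [Module.Finite R N] :
      VanAt p 1 (ModuleCat.of R N) := by
  obtain ⟨n, hn⟩ := hG
  suffices ∀ k i : ℕ, 1 ≤ i → n < i + k →
      ∀ (N : Type) [AddCommGroup N] [Module R N] [Module.Finite R N],
      VanAt p i (ModuleCat.of R N) from this n 1 le_rfl (by omega) N
  intro k
  induction k with
  | zero =>
    intro i _ h N _ _ _ e
    have := hn i h (ModuleCat.of R N)
    exact ⟨1, hp.one_notMem, Subsingleton.elim _ _⟩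
  | succ k ih =>
    intro i hi h N _ _ _
    exact vanAt_step p ι hι i hi (fun N _ _ _ => ih (i + 1) (by omega) (by omega) N) N

open Abelian in
theorem extend_aux {R : Type} [CommRing R] [IsNoetherianRing R] (p : Ideal R) [hp : p.IsPrime]
    (ι : R ⧸ p →ₗ[R] R) (hι : Function.Injective ι) (hG : HasFiniteInjDim R R)
    (M : Type) [AddCommGroup M] [Module R M] [Module.Finite R M]
    (φ : R ⧸ p →ₗ[R] M) (hφ : Function.Injective φ) :
    ∃ g : M →ₗ[R] R, ∃ s, s ∉ p ∧ g ∘ₗ φ = s • ι := by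
  have S := shortExact_aux φ (LinearMap.range φ).mkQ hφ (Submodule.mkQ_surjective _)
    (LinearMap.exact_map_mkQ_range φ)
  obtain ⟨s, hs, h0⟩ := vanAt_all p ι hι hG (M ⧸ LinearMap.range φ)
    (S.extClass.comp (Ext.mk₀ (ModuleCat.ofHom ι)) (add_zero 1))
  obtain ⟨e2, he2⟩ := Ext.contravariant_sequence_exact₁ S (ModuleCat.of R R)
    (s • Ext.mk₀ (ModuleCat.ofHom ι)) (add_zero 1) ((Ext.comp_smul _ _ _ s).trans h0)
  obtain ⟨g, rfl⟩ := Ext.addEquiv₀.symm.surjective e2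
  refine ⟨g.hom, s, hs, ?_⟩
  rw [← Ext.mk₀_smul] at he2
  have h2 := (Ext.mk₀_comp_mk₀ _ _).symm.trans he2
  have h3 := (Ext.mk₀_bijective _ _).1 h2
  exact congrArg ModuleCat.Hom.hom h3

/-- Over a Gorenstein local ring, for a proper ideal `b`, the module `R/b`
embeds in a finitely generated free module iff `b` consists of zerodivisors and is unmixed
(`Ass(R/b) ⊆ Ass R`). -/
theorem quotient_embeds_iff_zerodivisors_unmixed
    (R : Type) [CommRing R] [IsNoetherianRing R] [IsLocalRing R]
    (hGor : IsGorensteinLocal R)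
    (b : Ideal R) (hb : b ≠ ⊤) :
    (∃ (n : ℕ) (f : (R ⧸ b) →ₗ[R] (Fin n → R)), Function.Injective f) ↔
      ((∀ x ∈ b, x ∉ nonZeroDivisors R) ∧
        associatedPrimes R (R ⧸ b) ⊆ associatedPrimes R R) := by
  constructor
  · rintro ⟨n, f, hf⟩
    have key : ∀ x : R ⧸ b, x ≠ 0 → ∃ i, f x i ≠ 0 := by
      intro x hx
      by_contra! h
      exact hx (hf (by rw [map_zero]; ext i; exact h i))
    constructor
    · intro x hx hx0
      have h1 : (Ideal.Quotient.mk b 1) ≠ 0 := by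
        rw [Ne, Ideal.Quotient.eq_zero_iff_mem]
        exact fun h => hb ((Ideal.eq_top_iff_one _).2 h)
      obtain ⟨i, hi⟩ := key _ h1
      apply hi
      have h2 : x • (Ideal.Quotient.mk b 1) = 0 := by
        change Ideal.Quotient.mk b (x * 1) = 0
        rw [mul_one]
        exact Ideal.Quotient.eq_zero_iff_mem.2 hx
      have h3 : x * f (Ideal.Quotient.mk b 1) i = 0 := by
        have := congrFun (congrArg f h2) i
        rw [map_smul, map_zero] at this
        exact this
      exact (mul_left_mem_nonZeroDivisors_eq_zero_iff hx0).1 h3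
    · refine (associatedPrimes.subset_of_injective hf).trans ?_
      intro p hp
      rw [AssociatedPrimes.mem_iff, isAssociatedPrime_iff] at hp ⊢
      obtain ⟨hp, y, hy⟩ := hp
      refine ⟨hp, ?_⟩
      have hle : (Finset.univ : Finset (Fin n)).inf
          (fun i => (⊥ : Submodule R R).colon {y i}) ≤ p := by
        intro r hr
        rw [hy]
        simp only [Submodule.mem_finsetInf, Finset.mem_univ, true_imp_iff,
          Submodule.mem_colon_singleton, Submodule.mem_bot] at hr ⊢
        ext i; exact hr i
      obtain ⟨i, -, hi⟩ := (Ideal.IsPrime.inf_le' hp).1 hle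
      refine ⟨y i, le_antisymm ?_ hi⟩
      intro r hr
      rw [hy] at hr
      simp only [Submodule.mem_colon_singleton, Submodule.mem_bot] at hr ⊢
      exact congrFun hr i
  · rintro ⟨-, hass⟩
    obtain ⟨n, v, hv⟩ := Submodule.fg_iff_exists_fin_generating_family.1
      (IsNoetherian.noetherian (Submodule.annihilator b))
    have hann : ∀ x, (∀ y ∈ Submodule.annihilator b, x * y = 0) → x ∈ b := by
      let c : Ideal R := Submodule.annihilator (Submodule.annihilator b)
      let N : Submodule R (R ⧸ b) := Submodule.map (Submodule.mkQ b) c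
      have hN : Subsingleton N := by
        by_contra hN
        rw [not_subsingleton_iff_nontrivial] at hN
        obtain ⟨p, hp⟩ := associatedPrimes.nonempty R N
        have hp2 := hass (associatedPrimes.subset_of_injective N.subtype_injective hp)
        rw [AssociatedPrimes.mem_iff, isAssociatedPrime_iff_exists_injective_linearMap] at hp hp2
        obtain ⟨hpp, φ, hφ⟩ := hp
        obtain ⟨-, ι, hι⟩ := hp2
        obtain ⟨g, s, hs, hg⟩ := extend_aux p ι hι hGor (R ⧸ b) (N.subtype ∘ₗ φ)
          (N.subtype_injective.comp hφ)
        obtain ⟨x, hxc, hx⟩ := (φ (Ideal.Quotient.mk p 1)).2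
        have h1 : g (Submodule.mkQ b x) = s • ι (Ideal.Quotient.mk p 1) := by
          rw [hx]
          exact LinearMap.congr_fun hg (Ideal.Quotient.mk p 1)
        have h2 : Submodule.mkQ b x = x • Submodule.mkQ b (1 : R) := by
          rw [← map_smul, smul_eq_mul, mul_one]
        have h3 : g (Submodule.mkQ b (1 : R)) ∈ Submodule.annihilator b := by
          rw [Submodule.mem_annihilator]
          intro z hz
          rw [smul_eq_mul, mul_comm, ← smul_eq_mul, ← map_smul, ← map_smul, smul_eq_mul, mul_one]
          have hz0 : Submodule.mkQ b z = 0 := (Submodule.Quotient.mk_eq_zero b).2 hz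
          rw [hz0, map_zero]
        have h4 : g (Submodule.mkQ b x) = 0 := by
          rw [h2, map_smul]
          exact Submodule.mem_annihilator.1 hxc _ h3
        rw [h4, ← map_smul] at h1
        have h5 := hι (h1.symm.trans (map_zero ι).symm)
        change Ideal.Quotient.mk p (s * 1) = 0 at h5
        rw [mul_one, Ideal.Quotient.eq_zero_iff_mem] at h5
        exact hs h5
      intro x hx
      have hxc : x ∈ c := Submodule.mem_annihilator.2 hx
      have h1 : (⟨Submodule.mkQ b x, x, hxc, rfl⟩ : N) = 0 := Subsingleton.elim _ _
      exact (Submodule.Quotient.mk_eq_zero b).1 (congrArg Subtype.val h1)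
    let F : R →ₗ[R] (Fin n → R) := LinearMap.pi fun i => LinearMap.toSpanSingleton R R (v i)
    have hF : LinearMap.ker F = b := by
      apply le_antisymm
      · intro x hx
        apply hann
        intro y hy
        rw [← hv] at hy
        have hx' : ∀ i, x * v i = 0 := fun i => congrFun hx i
        induction hy using Submodule.span_induction with
        | mem y hy => obtain ⟨i, rfl⟩ := hy; exact hx' i
        | zero => simp
        | add y z _ _ h1 h2 => rw [mul_add, h1, h2, add_zero]
        | smul r y _ h => rw [smul_eq_mul, mul_left_comm, h, mul_zero]
      · intro x hx
        rw [LinearMap.mem_ker]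
        ext i
        have : v i ∈ Submodule.annihilator b := hv ▸ Submodule.subset_span ⟨i, rfl⟩
        have := Submodule.mem_annihilator.1 this x hx
        rw [smul_eq_mul, mul_comm] at this
        exact this
    refine ⟨n, Submodule.liftQ b F hF.ge, ?_⟩
    rw [← LinearMap.ker_eq_bot]
    exact Submodule.ker_liftQ_eq_bot _ _ _ hF.le
end
end

section
/- Over a Gorenstein local ring R, a finitely generated module M has finite projective dimension if and only if it has finite injective dimension. -/
open CategoryTheory

noncomputable section

/-- Vanishing of `Ext^i(X, Y)`. -/
def ExtV (R : Type) [CommRing R] (X Y : Type) [AddCommGroup X] [Module R X]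
    [AddCommGroup Y] [Module R Y] (i : ℕ) : Prop := Subsingleton (extGrp R X Y i)

section
variable {R : Type} [CommRing R]

section ses
variable {A B C : Type} [AddCommGroup A] [Module R A] [AddCommGroup B] [Module R B]
  [AddCommGroup C] [Module R C] (f : A →ₗ[R] B) (g : B →ₗ[R] C)
  (hf : Function.Injective f) (hfg : Function.Exact f g) (hg : Function.Surjective g)
  {X : Type} [AddCommGroup X] [Module R X]

abbrev sesC (hfg : Function.Exact f g) : ShortComplex (ModuleCat.{0} R) :=
  ShortComplex.mk (ModuleCat.ofHom f) (ModuleCat.ofHom g) (by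
    ext x; exact hfg.apply_apply_eq_zero x)

include hf hg in
lemma sesC_exact : (sesC f g hfg).ShortExact where
  exact := (ShortComplex.ShortExact.moduleCat_exact_iff_function_exact _).2 hfg
  mono_f := (ModuleCat.mono_iff_injective _).2 hf
  epi_g := (ModuleCat.epi_iff_surjective _).2 hg

include hf hfg hg in
lemma extV_right₃ {i : ℕ} (h2 : ExtV R X B i) (h1 : ExtV R X A (i+1)) : ExtV R X C i := by
  have h2 : Subsingleton (Abelian.Ext (ModuleCat.of R X) (sesC f g hfg).X₂ i) := h2
  have h1 : Subsingleton (Abelian.Ext (ModuleCat.of R X) (sesC f g hfg).X₁ (i+1)) := h1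
  refine subsingleton_of_forall_eq 0 fun x => ?_
  obtain ⟨y, hy⟩ := Abelian.Ext.covariant_sequence_exact₃ (ModuleCat.of R X)
    (sesC_exact f g hf hfg hg) x rfl (Subsingleton.elim _ _)
  rw [← hy, Subsingleton.elim y 0, Abelian.Ext.zero_comp]

include hf hfg hg in
lemma extV_right₁ {i : ℕ} (h2 : ExtV R X B (i+1)) (h1 : ExtV R X C i) : ExtV R X A (i+1) := by
  have h2 : Subsingleton (Abelian.Ext (ModuleCat.of R X) (sesC f g hfg).X₂ (i+1)) := h2
  have h1 : Subsingleton (Abelian.Ext (ModuleCat.of R X) (sesC f g hfg).X₃ i) := h1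
  refine subsingleton_of_forall_eq 0 fun x => ?_
  obtain ⟨y, hy⟩ := Abelian.Ext.covariant_sequence_exact₁ (ModuleCat.of R X)
    (sesC_exact f g hf hfg hg) x (Subsingleton.elim _ _) rfl
  rw [← hy, Subsingleton.elim y 0, Abelian.Ext.zero_comp]

include hf hfg hg in
lemma extV_left₃ {i : ℕ} (h2 : ExtV R B X (i+1)) (h1 : ExtV R A X i) : ExtV R C X (i+1) := by
  have h2 : Subsingleton (Abelian.Ext (sesC f g hfg).X₂ (ModuleCat.of R X) (i+1)) := h2
  have h1 : Subsingleton (Abelian.Ext (sesC f g hfg).X₁ (ModuleCat.of R X) i) := h1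
  refine subsingleton_of_forall_eq 0 fun x => ?_
  obtain ⟨y, hy⟩ := Abelian.Ext.contravariant_sequence_exact₃ (sesC_exact f g hf hfg hg)
    (ModuleCat.of R X) x (Subsingleton.elim _ _) (add_comm 1 i)
  rw [← hy, Subsingleton.elim y 0, Abelian.Ext.comp_zero]

include hf hfg hg in
lemma extV_left₁ {i : ℕ} (h2 : ExtV R B X i) (h1 : ExtV R C X (i+1)) : ExtV R A X i := by
  have h2 : Subsingleton (Abelian.Ext (sesC f g hfg).X₂ (ModuleCat.of R X) i) := h2
  have h1 : Subsingleton (Abelian.Ext (sesC f g hfg).X₃ (ModuleCat.of R X) (i+1)) := h1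
  refine subsingleton_of_forall_eq 0 fun x => ?_
  obtain ⟨y, hy⟩ := Abelian.Ext.contravariant_sequence_exact₁ (sesC_exact f g hf hfg hg)
    (ModuleCat.of R X) x (add_comm 1 i) (Subsingleton.elim _ _)
  rw [← hy, Subsingleton.elim y 0, Abelian.Ext.comp_zero]

include hf hfg hg in
lemma extV_extend (h1 : ExtV R C X 1) (u : A →ₗ[R] X) : ∃ v : B →ₗ[R] X, v ∘ₗ f = u := by
  have h1 : Subsingleton (Abelian.Ext (sesC f g hfg).X₃ (ModuleCat.of R X) 1) := h1
  obtain ⟨y, hy⟩ := Abelian.Ext.contravariant_sequence_exact₁ (sesC_exact f g hf hfg hg)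
    (ModuleCat.of R X) (Abelian.Ext.mk₀ (ModuleCat.ofHom u)) (add_comm 1 0)
    (Subsingleton.elim _ _)
  obtain ⟨v, rfl⟩ := (Abelian.Ext.mk₀_bijective _ _).2 y
  rw [Abelian.Ext.mk₀_comp_mk₀, (Abelian.Ext.mk₀_bijective _ _).1.eq_iff] at hy
  exact ⟨v.hom, congrArg ModuleCat.Hom.hom hy⟩

include hf hfg hg in
lemma dual_ses (h : ExtV R C R 1) : Function.Injective g.dualMap ∧
    Function.Exact g.dualMap f.dualMap ∧ Function.Surjective f.dualMap := by
  refine ⟨LinearMap.dualMap_injective_of_surjective hg, fun u => ?_, fun u => ?_⟩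
  · change f.dualMap u = 0 ↔ u ∈ LinearMap.range g.dualMap
    rw [LinearMap.range_dualMap_eq_dualAnnihilator_ker_of_surjective _ hg,
      hfg.linearMap_ker_eq, ← LinearMap.ker_dualMap_eq_dualAnnihilator_range, LinearMap.mem_ker]
  · obtain ⟨v, hv⟩ := extV_extend f g hf hfg hg h u
    exact ⟨v, hv⟩

end ses

variable {X Y Z : Type} [AddCommGroup X] [Module R X] [AddCommGroup Y] [Module R Y]
  [AddCommGroup Z] [Module R Z]

lemma extV_retract {i : ℕ} (s : Y →ₗ[R] Z) (r : Z →ₗ[R] Y) (h : r ∘ₗ s = LinearMap.id)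
    (hZ : ExtV R X Z i) : ExtV R X Y i := by
  have hZ : Subsingleton (Abelian.Ext (ModuleCat.of R X) (ModuleCat.of R Z) i) := hZ
  refine subsingleton_of_forall_eq 0 fun x => ?_
  have e : ModuleCat.ofHom s ≫ ModuleCat.ofHom r = 𝟙 (ModuleCat.of R Y) := by
    rw [← ModuleCat.ofHom_comp, h]; rfl
  rw [← Abelian.Ext.comp_mk₀_id x, ← e, ← Abelian.Ext.mk₀_comp_mk₀,
    ← Abelian.Ext.comp_assoc_of_second_deg_zero,
    Subsingleton.elim (x.comp (Abelian.Ext.mk₀ (ModuleCat.ofHom s)) (add_zero i)) 0,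
    Abelian.Ext.zero_comp]

lemma extV_pi {i : ℕ} (n : ℕ) (h : ExtV R X R i) : ExtV R X (Fin n → R) i := by
  have h : Subsingleton (Abelian.Ext (ModuleCat.of R X) (ModuleCat.of R R) i) := h
  refine subsingleton_of_forall_eq 0 fun x => ?_
  have e : ∑ j : Fin n, (ModuleCat.ofHom (LinearMap.proj (R := R) (φ := fun _ : Fin n => R) j) ≫
      ModuleCat.ofHom (LinearMap.single R (fun _ : Fin n => R) j)) =
      𝟙 (ModuleCat.of R (Fin n → R)) := by
    apply ModuleCat.hom_ext
    rw [ModuleCat.hom_sum]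
    ext j k
    simp [Pi.single_apply]
  rw [← Abelian.Ext.comp_mk₀_id x, ← e, Abelian.Ext.mk₀_sum, Abelian.Ext.comp_sum]
  refine Finset.sum_eq_zero fun j _ => ?_
  rw [← Abelian.Ext.mk₀_comp_mk₀,
    ← Abelian.Ext.comp_assoc_of_second_deg_zero,
    Subsingleton.elim (x.comp (Abelian.Ext.mk₀ (ModuleCat.ofHom (LinearMap.proj j))) (add_zero i)) 0,
    Abelian.Ext.zero_comp]

lemma extV_proj_right {i : ℕ} [Module.Finite R Y] [Module.Projective R Y] (h : ExtV R X R i) :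
    ExtV R X Y i := by
  obtain ⟨n, f, hf⟩ := Module.Finite.exists_fin' R Y
  obtain ⟨s, hs⟩ := Module.projective_lifting_property f LinearMap.id hf
  exact extV_retract s f hs (extV_pi n h)

lemma extV_proj_left {i : ℕ} [Module.Projective R X] : ExtV R X Y (i+1) := by
  have : Projective (ModuleCat.of R X) := inferInstance
  exact Abelian.Ext.subsingleton_of_projective _ _ _

variable [IsNoetherianRing R]

set_option linter.unusedSectionVars false

/-- G-class -/
def GV (R : Type) [CommRing R] (X : Type) [AddCommGroup X] [Module R X] (j : ℕ) : Prop :=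
  ∀ i, j < i → ExtV R X R i

/-- syzygy. -/
lemma exists_syz (X : Type) [AddCommGroup X] [Module R X] [Module.Finite R X] :
    ∃ (n : ℕ) (K : Type) (_ : AddCommGroup K) (_ : Module R K) (_ : Module.Finite R K)
      (f : K →ₗ[R] (Fin n → R)) (g : (Fin n → R) →ₗ[R] X),
      Function.Injective f ∧ Function.Exact f g ∧ Function.Surjective g := by
  obtain ⟨n, g, hg⟩ := Module.Finite.exists_fin' R X
  exact ⟨n, LinearMap.ker g, inferInstance, inferInstance, inferInstance,
    (LinearMap.ker g).subtype, g, Subtype.val_injective, LinearMap.exact_subtype_ker_map g, hg⟩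

lemma finite_dual (X : Type) [AddCommGroup X] [Module R X] [Module.Finite R X] :
    Module.Finite R (Module.Dual R X) := by
  infer_instance

lemma GV_syz {A B C : Type} [AddCommGroup A] [Module R A] [AddCommGroup B] [Module R B]
    [AddCommGroup C] [Module R C] [Module.Projective R B] (f : A →ₗ[R] B) (g : B →ₗ[R] C)
    (hf : Function.Injective f) (hfg : Function.Exact f g) (hg : Function.Surjective g)
    {j : ℕ} (h : GV R C (j+1)) : GV R A j := by
  intro i hi
  obtain ⟨i, rfl⟩ : ∃ k, i = k + 1 := ⟨i - 1, by omega⟩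
  exact extV_left₁ f g hf hfg hg extV_proj_left (h _ (by omega))

lemma GV_mono {j k : ℕ} (hjk : j ≤ k) (h : GV R X j) : GV R X k :=
  fun i hi => h i (by omega)

lemma GV_dual (hR : HasFiniteInjDim R R) (X : Type) [AddCommGroup X] [Module R X]
    [Module.Finite R X] (h : GV R X 0) : GV R (Module.Dual R X) 0 := by
  obtain ⟨D, hD⟩ := hR
  suffices H : ∀ k j : ℕ, k + j = D → ∀ (X : Type) [AddCommGroup X] [Module R X]
      [Module.Finite R X], GV R X 0 → GV R (Module.Dual R X) j from H D 0 rfl X h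
  intro k
  induction k with
  | zero =>
    intro j hj X _ _ _ _ i hi
    exact hD i (by omega) _
  | succ k ih =>
    intro j hj X _ _ _ hX
    obtain ⟨n, K, _, _, _, f, g, hf, hfg, hg⟩ := exists_syz (R := R) X
    obtain ⟨h1, h2, h3⟩ := dual_ses f g hf hfg hg (hX 1 (by omega))
    have hK : GV R K 0 := GV_syz f g hf hfg hg (GV_mono (by omega) hX)
    exact GV_syz _ _ h1 h2 h3 (ih (j+1) (by omega) K hK)

lemma GV_eval_surj (hR : HasFiniteInjDim R R) (X : Type) [AddCommGroup X] [Module R X]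
    [Module.Finite R X] (hX : GV R X 0) : Function.Surjective (Module.Dual.eval R X) := by
  obtain ⟨n, K, _, _, _, f, g, hf, hfg, hg⟩ := exists_syz (R := R) X
  obtain ⟨h1, h2, h3⟩ := dual_ses f g hf hfg hg (hX 1 (by omega))
  have hK : GV R K 0 := GV_syz f g hf hfg hg (GV_mono (by omega) hX)
  obtain ⟨h4, h5, h6⟩ := dual_ses _ _ h1 h2 h3 (GV_dual hR K hK 1 (by omega))
  intro x
  obtain ⟨y, rfl⟩ := h6 x
  obtain ⟨z, rfl⟩ := (Module.bijective_dual_eval R (Fin n → R)).2 y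
  exact ⟨g z, rfl⟩

lemma GV_eval_bij (hR : HasFiniteInjDim R R) (X : Type) [AddCommGroup X] [Module R X]
    [Module.Finite R X] (hX : GV R X 0) : Function.Bijective (Module.Dual.eval R X) := by
  refine ⟨?_, GV_eval_surj hR X hX⟩
  obtain ⟨n, K, _, _, _, f, g, hf, hfg, hg⟩ := exists_syz (R := R) X
  obtain ⟨h1, h2, h3⟩ := dual_ses f g hf hfg hg (hX 1 (by omega))
  have hK : GV R K 0 := GV_syz f g hf hfg hg (GV_mono (by omega) hX)
  obtain ⟨h4, h5, h6⟩ := dual_ses _ _ h1 h2 h3 (GV_dual hR K hK 1 (by omega))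
  rw [injective_iff_map_eq_zero]
  intro x hx
  obtain ⟨z, rfl⟩ := hg x
  have : g.dualMap.dualMap (Module.Dual.eval R _ z) = 0 := hx
  obtain ⟨w, hw⟩ := (h5 _).1 this
  obtain ⟨w, rfl⟩ := GV_eval_surj hR K hK w
  have : Module.Dual.eval R _ (f w) = Module.Dual.eval R _ z := hw
  rw [← (Module.bijective_dual_eval R (Fin n → R)).1 this]
  exact hfg.apply_apply_eq_zero w

/-- cosyzygy. -/
lemma exists_cosyz (hR : HasFiniteInjDim R R) (X : Type) [AddCommGroup X] [Module R X]
    [Module.Finite R X] (hX : GV R X 0) :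
    ∃ (F K : Type) (_ : AddCommGroup F) (_ : Module R F) (_ : Module.Projective R F)
      (_ : AddCommGroup K) (_ : Module R K) (_ : Module.Finite R K)
      (f : X →ₗ[R] F) (g : F →ₗ[R] K),
      Function.Injective f ∧ Function.Exact f g ∧ Function.Surjective g ∧ GV R K 0 := by
  have hX' := GV_dual hR X hX
  obtain ⟨n, K, _, _, _, f, g, hf, hfg, hg⟩ := exists_syz (R := R) (Module.Dual R X)
  obtain ⟨h1, h2, h3⟩ := dual_ses f g hf hfg hg (hX' 1 (by omega))
  have hK : GV R K 0 := GV_syz f g hf hfg hg (GV_mono (by omega) hX')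
  have hb := GV_eval_bij hR X hX
  refine ⟨Module.Dual R (Fin n → R), Module.Dual R K, inferInstance, inferInstance, inferInstance,
    inferInstance, inferInstance, inferInstance, g.dualMap ∘ₗ Module.Dual.eval R X, f.dualMap,
    ?_, ?_, h3, GV_dual hR K hK⟩
  · exact h1.comp hb.1
  · intro y
    rw [h2 y, LinearMap.coe_comp, Set.range_comp, hb.2.range_eq, Set.image_univ]

lemma GV_ext_vanish (hR : HasFiniteInjDim R R) (N : Type) [AddCommGroup N] [Module R N]
    (hN : HasFiniteInjDim R N) (X : Type) [AddCommGroup X] [Module R X]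
    [Module.Finite R X] (hX : GV R X 0) : ExtV R X N 1 := by
  obtain ⟨D, hD⟩ := hN
  suffices H : ∀ k j : ℕ, k + j = D → ∀ (X : Type) [AddCommGroup X] [Module R X]
      [Module.Finite R X], GV R X 0 → ExtV R X N (j+1) from H D 0 rfl X hX
  intro k
  induction k with
  | zero =>
    intro j hj X _ _ _ _
    exact hD _ (by omega) _
  | succ k ih =>
    intro j hj X _ _ _ hX
    obtain ⟨F, K, _, _, _, _, _, _, f, g, hf, hfg, hg, hK⟩ := exists_cosyz hR X hX
    exact extV_left₁ f g hf hfg hg extV_proj_left (ih (j+1) (by omega) K hK)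

lemma injDim_syz {A B C : Type} [AddCommGroup A] [Module R A] [AddCommGroup B] [Module R B]
    [AddCommGroup C] [Module R C] [Module.Finite R B] [Module.Projective R B]
    (hR : HasFiniteInjDim R R) (f : A →ₗ[R] B) (g : B →ₗ[R] C)
    (hf : Function.Injective f) (hfg : Function.Exact f g) (hg : Function.Surjective g)
    (h : HasFiniteInjDim R C) : HasFiniteInjDim R A := by
  obtain ⟨D, hD⟩ := hR
  obtain ⟨E, hE⟩ := h
  refine ⟨D + E + 1, fun i hi N => ?_⟩
  obtain ⟨i, rfl⟩ : ∃ k, i = k + 1 := ⟨i - 1, by omega⟩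
  exact extV_right₁ (X := N) f g hf hfg hg (extV_proj_right (hD _ (by omega) N))
    (hE _ (by omega) N)

lemma injDim_quot {A B C : Type} [AddCommGroup A] [Module R A] [AddCommGroup B] [Module R B]
    [AddCommGroup C] [Module R C] [Module.Finite R B] [Module.Projective R B]
    (hR : HasFiniteInjDim R R) (f : A →ₗ[R] B) (g : B →ₗ[R] C)
    (hf : Function.Injective f) (hfg : Function.Exact f g) (hg : Function.Surjective g)
    (h : HasFiniteInjDim R A) : HasFiniteInjDim R C := by
  obtain ⟨D, hD⟩ := hR
  obtain ⟨E, hE⟩ := h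
  refine ⟨D + E, fun i hi N => ?_⟩
  exact extV_right₃ (X := N) f g hf hfg hg (extV_proj_right (hD _ (by omega) N))
    (hE _ (by omega) N)

lemma pd_of_injDim (hR : HasFiniteInjDim R R) (j : ℕ) : ∀ (M : Type) [AddCommGroup M] [Module R M]
    [Module.Finite R M], GV R M j → HasFiniteInjDim R M → HasFinitePD R M := by
  induction j with
  | zero =>
    intro M _ _ _ hG hM
    obtain ⟨F, K, _, _, _, _, _, _, f, g, hf, hfg, hg, hK⟩ := exists_cosyz hR M hG
    obtain ⟨r, hr⟩ := extV_extend f g hf hfg hg (GV_ext_vanish hR M hM K hK) LinearMap.id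
    have : Module.Projective R M := Module.Projective.of_split f r hr
    refine ⟨0, fun i hi N => ?_⟩
    obtain ⟨i, rfl⟩ : ∃ k, i = k + 1 := ⟨i - 1, by omega⟩
    exact extV_proj_left (X := M) (Y := N)
  | succ j ih =>
    intro M _ _ _ hG hM
    obtain ⟨n, K, _, _, _, f, g, hf, hfg, hg⟩ := exists_syz (R := R) M
    obtain ⟨E, hE⟩ := ih K (GV_syz f g hf hfg hg hG) (injDim_syz hR f g hf hfg hg hM)
    refine ⟨E + 1, fun i hi N => ?_⟩
    obtain ⟨i, rfl⟩ : ∃ k, i = k + 1 := ⟨i - 1, by omega⟩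
    exact extV_left₃ (X := N) f g hf hfg hg extV_proj_left (hE _ (by omega) N)

lemma injDim_of_pd (hR : HasFiniteInjDim R R) (n : ℕ) : ∀ (M : Type) [AddCommGroup M] [Module R M]
    [Module.Finite R M], (∀ i : ℕ, n < i → ∀ N : ModuleCat.{0} R,
    Subsingleton (Abelian.Ext (ModuleCat.of R M) N i)) → HasFiniteInjDim R M := by
  induction n with
  | zero =>
    intro M _ _ _ h
    obtain ⟨n, K, _, _, _, f, g, hf, hfg, hg⟩ := exists_syz (R := R) M
    obtain ⟨r, hr⟩ := extV_extend f g hf hfg hg (h 1 (by omega) (ModuleCat.of R K)) LinearMap.id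
    refine injDim_quot hR f g hf hfg hg ?_
    obtain ⟨D, hD⟩ := hR
    exact ⟨D, fun i hi N => extV_retract (X := N) f r hr (extV_pi n (hD i hi N))⟩
  | succ j ih =>
    intro M _ _ _ h
    obtain ⟨n, K, _, _, _, f, g, hf, hfg, hg⟩ := exists_syz (R := R) M
    refine injDim_quot hR f g hf hfg hg (ih K fun i hi N => ?_)
    obtain ⟨i, rfl⟩ : ∃ k, i = k + 1 := ⟨i - 1, by omega⟩
    exact extV_left₁ (X := N) f g hf hfg hg extV_proj_left (h _ (by omega) N)

end

/-- Over a Gorenstein local ring, a finitely generated module has finite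
projective dimension iff it has finite injective dimension. -/
theorem finitePD_iff_finiteInjDim
    (R : Type) [CommRing R] [IsNoetherianRing R] [IsLocalRing R]
    (hGor : IsGorensteinLocal R)
    (M : Type) [AddCommGroup M] [Module R M] [Module.Finite R M] :
    HasFinitePD R M ↔ HasFiniteInjDim R M := by
  constructor
  · rintro ⟨n, hn⟩
    exact injDim_of_pd hGor n M hn
  · intro h
    have hG := hGor
    obtain ⟨D, hD⟩ := hG
    exact pd_of_injDim hGor D M (fun i hi => hD i hi (ModuleCat.of R M)) h
end
end
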